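/- Let n > 2 and let X ⊆ ℝⁿ be a countable, uniformly discrete set with well-defined density ρ > 0, meaning that #(X ∩ B_R(0)) / vol(B_R(0)) → ρ as R → ∞. Then the following are equivalent: (1) there exist a lattice L ⊆ ℝⁿ of density ρ (that is, L = A·ℤⁿ for some invertible linear map A with |det A| = 1/ρ) and a bijection b : X → L with sup_{x∈X} ‖b(x) − x‖ < ∞; (2) there exist constants c₁, c₂ > 0 such that for every topological ball U ⊆ ℝⁿ (a compact set homeomorphic to the closed unit ball), |#(X ∩ U) − ρ·vol(U)| ≤ c₁ + c₂·(vol(U₁) − vol(U₋₁)), where vol denotes Lebesgue measure, U₁ = {x ∈ ℝⁿ : dist(x, U) ≤ 1} is the closed 1-neighborhood of U, and U₋₁ = {x ∈ U : dist(x, ℝⁿ \ U) ≥ 1}. -/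

import Mathlib

open MeasureTheory

/-- If two points at distance at most `r` are separated by `U`, both are within `r` of the
frontier of `U`. -/
lemma mem_cthickening_frontier_of_separated {E : Type*} [NormedAddCommGroup E]
    [NormedSpace ℝ E] {U : Set E} {x y : E} {r : ℝ} (hx : x ∈ U) (hy : y ∉ U)
    (h : dist y x ≤ r) : y ∈ Metric.cthickening r (frontier U) := by
  have hc : IsPreconnected (segment ℝ x y) := (convex_segment x y).isPreconnected
  have hne : (segment ℝ x y ∩ frontier U).Nonempty := by
    by_contra hne
    rw [Set.not_nonempty_iff_eq_empty] at hne
    have hcov : segment ℝ x y ⊆ interior U ∪ interior Uᶜ := fun z hz => by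
      by_contra hz'
      rw [interior_compl, Set.mem_union, not_or, Set.notMem_compl_iff] at hz'
      exact (Set.eq_empty_iff_forall_notMem.1 hne) z ⟨hz, hz'.2, hz'.1⟩
    have hx' : x ∈ interior U := (hcov (left_mem_segment ℝ x y)).resolve_right
      fun h => interior_subset h hx
    have hy' : y ∈ interior Uᶜ := (hcov (right_mem_segment ℝ x y)).resolve_left
      fun h => hy (interior_subset h)
    obtain ⟨z, -, hz, hz'⟩ := hc _ _ isOpen_interior isOpen_interior hcov
      ⟨x, left_mem_segment ℝ x y, hx'⟩ ⟨y, right_mem_segment ℝ x y, hy'⟩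
    exact interior_subset hz' (interior_subset hz)
  obtain ⟨z, hz, hzf⟩ := hne
  refine Metric.mem_cthickening_of_dist_le y z r _ hzf (le_trans ?_ h)
  rw [dist_comm y z, dist_comm y x]
  have := dist_add_dist_of_mem_segment hz
  linarith [dist_nonneg (x := x) (y := z)]

/-- Any neighbourhood of a set has volume at most a constant multiple of that of its open
unit neighbourhood, the constant depending only on the radius. -/
lemma exists_volume_cthickening_le {n : ℕ} (R : ℝ) (hR : 0 ≤ R) :
    ∃ κ : ℝ, 0 ≤ κ ∧ ∀ s : Set (EuclideanSpace ℝ (Fin n)),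
      volume (Metric.cthickening R s) ≤
        ENNReal.ofReal κ * volume (Metric.thickening 1 s) := by
  have hR' : (0 : ℝ) ≤ 2 * (R + 1 + 2) := by linarith
  refine ⟨(2 * (R + 1 + 2)) ^ n, pow_nonneg hR' n, fun s => ?_⟩
  obtain ⟨u, hus, hdisj, hcov⟩ := Vitali.exists_disjoint_subfamily_covering_enlargement_closedBall
    s (fun x : EuclideanSpace ℝ (Fin n) => x) (fun _ => (1 / 2 : ℝ)) (1 / 2)
    (fun _ _ => le_rfl) 4 (by norm_num)
  have hcount : u.Countable := by
    refine hdisj.countable_of_nonempty_interior fun x _ => ⟨x, ?_⟩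
    exact Metric.ball_subset_interior_closedBall (Metric.mem_ball_self (by norm_num))
  have hsub : Metric.cthickening R s ⊆
      ⋃ x ∈ u, Metric.closedBall x ((2 * (R + 1 + 2)) * (1 / 2)) := by
    intro y hy
    have hy' := Metric.cthickening_subset_thickening' (by linarith : 0 < R + 1)
      (by linarith : R < R + 1) s hy
    obtain ⟨z, hz, hyz⟩ := Metric.mem_thickening_iff.1 hy'
    obtain ⟨x, hx, hzx⟩ := hcov z hz
    have hzx' := hzx (Metric.mem_closedBall_self (by norm_num))
    refine Set.mem_iUnion₂.2 ⟨x, hx, ?_⟩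
    rw [Metric.mem_closedBall] at hzx' ⊢
    linarith [dist_triangle y z x]
  have hball : ∀ x : EuclideanSpace ℝ (Fin n),
      volume (Metric.closedBall x ((2 * (R + 1 + 2)) * (1 / 2))) =
        ENNReal.ofReal ((2 * (R + 1 + 2)) ^ n) * volume (Metric.closedBall x (1 / 2)) := by
    intro x
    rw [Measure.addHaar_closedBall_mul volume x hR' (by norm_num : (0 : ℝ) ≤ 1 / 2),
      finrank_euclideanSpace_fin, Measure.addHaar_closedBall_center volume x]
  calc volume (Metric.cthickening R s)
      ≤ volume (⋃ x ∈ u, Metric.closedBall x ((2 * (R + 1 + 2)) * (1 / 2))) := measure_mono hsub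
    _ ≤ ∑' x : u, volume (Metric.closedBall (x : EuclideanSpace ℝ (Fin n))
          ((2 * (R + 1 + 2)) * (1 / 2))) := measure_biUnion_le _ hcount _
    _ = ENNReal.ofReal ((2 * (R + 1 + 2)) ^ n) *
          ∑' x : u, volume (Metric.closedBall (x : EuclideanSpace ℝ (Fin n)) (1 / 2)) := by
        rw [← ENNReal.tsum_mul_left]
        exact tsum_congr fun x => hball x
    _ = ENNReal.ofReal ((2 * (R + 1 + 2)) ^ n) *
          volume (⋃ x ∈ u, Metric.closedBall x (1 / 2)) := by
        rw [measure_biUnion hcount hdisj fun x _ => Metric.isClosed_closedBall.measurableSet]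
    _ ≤ _ := by
        gcongr
        refine Set.iUnion₂_subset fun x hx y hy => ?_
        refine Metric.mem_thickening_iff.2 ⟨x, hus hx, ?_⟩
        rw [Metric.mem_closedBall] at hy
        linarith

/-- The open unit neighbourhood of the frontier of a compact set lies in its collar. -/
lemma volume_thickening_frontier_le_collar {n : ℕ} {U : Set (EuclideanSpace ℝ (Fin n))}
    (hU : IsCompact U) :
    (volume (Metric.thickening 1 (frontier U))).toReal ≤
      (volume (Metric.cthickening 1 U)).toReal -
        (volume {x ∈ U | 1 ≤ Metric.infDist x Uᶜ}).toReal := by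
  have hclosed : IsClosed {x ∈ U | 1 ≤ Metric.infDist x Uᶜ} :=
    hU.isClosed.inter (isClosed_le continuous_const (Metric.continuous_infDist_pt _))
  have hfin : volume (Metric.cthickening 1 U) ≠ ⊤ := hU.cthickening.measure_lt_top.ne
  have hin : {x ∈ U | 1 ≤ Metric.infDist x Uᶜ} ⊆ Metric.cthickening 1 U :=
    (Set.sep_subset _ _).trans (Metric.self_subset_cthickening U)
  have hfin' := ne_top_of_le_ne_top hfin (measure_mono hin)
  rw [← ENNReal.toReal_sub_of_le (measure_mono hin) hfin,
    ← measure_sdiff hin hclosed.measurableSet.nullMeasurableSet hfin']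
  refine ENNReal.toReal_mono (ne_top_of_le_ne_top hfin (measure_mono Set.sdiff_subset))
    (measure_mono fun x hx => ?_)
  obtain ⟨z, hz, hxz⟩ := Metric.mem_thickening_iff.1 hx
  have hzU : z ∈ U := hU.isClosed.frontier_subset hz
  refine ⟨Metric.mem_cthickening_of_dist_le x z 1 U hzU hxz.le, fun h => ?_⟩
  have hzc : z ∈ closure Uᶜ := by
    rw [← frontier_compl] at hz
    exact frontier_subset_closure hz
  have := Metric.infDist_le_dist_of_mem (x := x) hzc
  rw [Metric.infDist_closure] at this
  linarith [h.2]

/-- The image of the standard integer lattice has a fundamental domain of volume `|det A|`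
given by the fibres of a rounding map of bounded displacement. -/
lemma exists_lattice_rounding {n : ℕ}
    (A : EuclideanSpace ℝ (Fin n) ≃ₗ[ℝ] EuclideanSpace ℝ (Fin n)) :
    ∃ (F : EuclideanSpace ℝ (Fin n) → EuclideanSpace ℝ (Fin n)) (D : ℝ),
      (∀ y, F y ∈ ⇑A '' {x : EuclideanSpace ℝ (Fin n) | ∀ i, ∃ m : ℤ, x i = (m : ℝ)}) ∧
      (∀ y, dist y (F y) ≤ D) ∧
      ∀ l ∈ ⇑A '' {x : EuclideanSpace ℝ (Fin n) | ∀ i, ∃ m : ℤ, x i = (m : ℝ)},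
        MeasurableSet (F ⁻¹' {l}) ∧ volume (F ⁻¹' {l}) = ENNReal.ofReal
          |LinearMap.det (A : EuclideanSpace ℝ (Fin n) →ₗ[ℝ] EuclideanSpace ℝ (Fin n))| := by
  let G : EuclideanSpace ℝ (Fin n) → EuclideanSpace ℝ (Fin n) :=
    fun x => WithLp.toLp 2 fun i => (⌊x i⌋ : ℝ)
  let B := LinearMap.toContinuousLinearMap
    (A : EuclideanSpace ℝ (Fin n) →ₗ[ℝ] EuclideanSpace ℝ (Fin n))
  have hAc : Continuous A := B.continuous
  have hAs : Continuous A.symm :=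
    (LinearMap.toContinuousLinearMap
      (A.symm : EuclideanSpace ℝ (Fin n) →ₗ[ℝ] EuclideanSpace ℝ (Fin n))).continuous
  have hG : ∀ x, ‖x - G x‖ ≤ √n := by
    intro x
    rw [EuclideanSpace.norm_eq]
    refine Real.sqrt_le_sqrt ?_
    calc ∑ i, ‖(x - G x) i‖ ^ 2 ≤ ∑ _i : Fin n, (1 : ℝ) := by
          refine Finset.sum_le_sum fun i _ => ?_
          have h1 := Int.floor_le (x i)
          have h2 := (Int.lt_floor_add_one (x i)).le
          have : (x - G x) i = x i - ⌊x i⌋ := rfl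
          rw [this, Real.norm_eq_abs, sq_abs]
          nlinarith
      _ = n := by simp
  refine ⟨fun y => A (G (A.symm y)), ‖B‖ * √n, fun y => ⟨_, fun i => ⟨_, rfl⟩, rfl⟩,
    fun y => ?_, ?_⟩
  · have h : y - A (G (A.symm y)) = B (A.symm y - G (A.symm y)) := by
      change _ = A _
      rw [map_sub, LinearEquiv.apply_symm_apply]
    rw [dist_eq_norm, h]
    exact (B.le_opNorm _).trans (by gcongr; exact hG _)
  · rintro _ ⟨m, hm, rfl⟩
    choose k hk using hm
    let c : Set (EuclideanSpace ℝ (Fin n)) :=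
      (WithLp.ofLp : EuclideanSpace ℝ (Fin n) → (Fin n → ℝ)) ⁻¹'
        Set.univ.pi fun i => Set.Ico (k i : ℝ) (k i + 1)
    have hmp := PiLp.volume_preserving_ofLp (Fin n)
    have hcm : MeasurableSet (Set.univ.pi fun i => Set.Ico (k i : ℝ) (k i + 1)) :=
      MeasurableSet.univ_pi fun i => measurableSet_Ico
    have hcv : volume c = 1 := by
      rw [hmp.measure_preimage hcm.nullMeasurableSet, Real.volume_pi_Ico]
      simp
    have hfib : (fun y => A (G (A.symm y))) ⁻¹' {A m} = A.symm ⁻¹' c := by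
      ext y
      simp only [Set.mem_preimage, Set.mem_singleton_iff, EmbeddingLike.apply_eq_iff_eq, c,
        Set.mem_univ_pi, Set.mem_Ico]
      constructor
      · intro h i
        have hi : (⌊(A.symm y) i⌋ : ℝ) = k i := by rw [← hk i, ← h]
        exact Int.floor_eq_iff.1 (by exact_mod_cast hi)
      · intro h
        ext i
        rw [hk i]
        change ((⌊(A.symm y) i⌋ : ℤ) : ℝ) = k i
        rw [Int.floor_eq_iff.2 (h i)]
    rw [hfib]
    refine ⟨hAs.measurable (hmp.measurable hcm), ?_⟩
    have : A.symm ⁻¹' c =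
        (A : EuclideanSpace ℝ (Fin n) →ₗ[ℝ] EuclideanSpace ℝ (Fin n)) '' c := by
      exact (LinearEquiv.image_eq_preimage_symm A c).symm
    rw [this, Measure.addHaar_image_linearMap, hcv, mul_one]

/-- A uniformly discrete set meets every compact set in a finite set. -/
lemma finite_inter_of_uniformly_discrete {E : Type*} [PseudoMetricSpace E] {X K : Set E}
    (hud : ∃ δ > 0, ∀ x ∈ X, ∀ y ∈ X, x ≠ y → δ ≤ dist x y) (hK : IsCompact K) :
    (X ∩ K).Finite := by
  obtain ⟨δ, hδ, h⟩ := hud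
  obtain ⟨t, -, ht, hcov⟩ := hK.finite_cover_balls (half_pos hδ)
  choose! f hf hxf using fun x (hx : x ∈ K) => Set.mem_iUnion₂.1 (hcov hx)
  refine Set.Finite.of_finite_image (f := f) (ht.subset ?_) ?_
  · rintro _ ⟨x, hx, rfl⟩
    exact hf x hx.2
  · intro x hx y hy hxy
    by_contra hne
    have h1 := h x hx.1 y hy.1 hne
    have h2 := Metric.mem_ball.1 (hxf x hx.2)
    have h3 := Metric.mem_ball.1 (hxf y hy.2)
    rw [← hxy] at h3
    linarith [dist_triangle_right x y (f x)]

/-- The discrepancy estimate for a set at bounded displacement from a lattice, valid for all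
compact sets. -/
theorem discrepancy_le_collar_of_bounded_displacement {n : ℕ}
    {X : Set (EuclideanSpace ℝ (Fin n))}
    (hud : ∃ δ > 0, ∀ x ∈ X, ∀ y ∈ X, x ≠ y → δ ≤ dist x y) {ρ : ℝ} (hρ : 0 < ρ)
    (A : EuclideanSpace ℝ (Fin n) ≃ₗ[ℝ] EuclideanSpace ℝ (Fin n))
    (hA : |LinearMap.det (A : EuclideanSpace ℝ (Fin n) →ₗ[ℝ] EuclideanSpace ℝ (Fin n))| = 1 / ρ)
    (b : X ≃ (⇑A '' {x : EuclideanSpace ℝ (Fin n) | ∀ i, ∃ m : ℤ, x i = (m : ℝ)} : Set _))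
    {C : ℝ} (hC : ∀ x : X,
      ‖(b x : EuclideanSpace ℝ (Fin n)) - (x : EuclideanSpace ℝ (Fin n))‖ ≤ C) :
    ∃ c > (0 : ℝ), ∀ U : Set (EuclideanSpace ℝ (Fin n)), IsCompact U →
      |((X ∩ U).ncard : ℝ) - ρ * (volume U).toReal| ≤
        c * ((volume (Metric.cthickening 1 U)).toReal -
          (volume {x ∈ U | 1 ≤ Metric.infDist x Uᶜ}).toReal) := by
  obtain ⟨F, D, hFL, hFD, hFv⟩ := exists_lattice_rounding A
  have hdist : ∀ (x : X) (y), F y = b x → dist y x ≤ |C| + |D| := by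
    intro x y h
    have h1 := hFD y
    have h2 := hC x
    rw [h] at h1
    rw [← dist_eq_norm] at h2
    linarith [dist_triangle y (b x) x, le_abs_self C, le_abs_self D]
  set R := |C| + |D| with hRdef
  have hR : 0 ≤ R := by positivity
  obtain ⟨κ, hκ, hκle⟩ := exists_volume_cthickening_le (n := n) R hR
  refine ⟨ρ * κ + 1, by positivity, fun U hU => ?_⟩
  have hfin := finite_inter_of_uniformly_discrete hud hU
  have hcollar := volume_thickening_frontier_le_collar hU
  set N := Metric.cthickening R (frontier U)
  have hfc : IsCompact (frontier U) :=
    hU.of_isClosed_subset isClosed_frontier hU.isClosed.frontier_subset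
  have hNfin : volume N ≠ ⊤ := hfc.cthickening.measure_lt_top.ne
  have hTfin : volume (Metric.thickening 1 (frontier U)) ≠ ⊤ :=
    ne_top_of_le_ne_top (hfc.cthickening (r := 1)).measure_lt_top.ne
      (measure_mono (Metric.thickening_subset_cthickening _ _))
  have hN : (volume N).toReal ≤ κ * (volume (Metric.thickening 1 (frontier U))).toReal := by
    have := ENNReal.toReal_mono (ENNReal.mul_ne_top ENNReal.ofReal_ne_top hTfin)
      (hκle (frontier U))
    rwa [ENNReal.toReal_mul, ENNReal.toReal_ofReal hκ] at this
  have hUfin : volume U ≠ ⊤ := hU.measure_lt_top.ne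
  let S : Set X := {x | (x : EuclideanSpace ℝ (Fin n)) ∈ U}
  have hS : ((↑) : X → EuclideanSpace ℝ (Fin n)) '' S = X ∩ U := by
    ext y; constructor
    · rintro ⟨x, hx, rfl⟩; exact ⟨x.2, hx⟩
    · rintro ⟨h1, h2⟩; exact ⟨⟨y, h1⟩, h2, rfl⟩
  have hSfin : S.Finite := Set.Finite.of_finite_image (hS ▸ hfin) Subtype.val_injective.injOn
  have hScard : (X ∩ U).ncard = hSfin.toFinset.card := by
    rw [← hS, Set.ncard_image_of_injective _ Subtype.val_injective, Set.ncard_eq_toFinset_card S hSfin]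
  let W : Set (EuclideanSpace ℝ (Fin n)) :=
    ⋃ x ∈ hSfin.toFinset, F ⁻¹' {(b x : EuclideanSpace ℝ (Fin n))}
  have hWv : volume W = ENNReal.ofReal ((X ∩ U).ncard * (1 / ρ)) := by
    rw [measure_biUnion_finset]
    · rw [Finset.sum_congr rfl fun x _ => (hFv _ (b x).2).2, Finset.sum_const, hA, hScard,
        ENNReal.ofReal_mul (by positivity), ENNReal.ofReal_natCast, nsmul_eq_mul]
    · intro x _ y _ hxy
      refine Set.disjoint_left.2 fun z hz hz' => hxy (b.injective (Subtype.ext ?_))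
      exact (Set.mem_singleton_iff.1 hz).symm.trans hz'
    · exact fun x _ => (hFv _ (b x).2).1
  have hWr : (volume W).toReal = (X ∩ U).ncard * (1 / ρ) := by
    rw [hWv, ENNReal.toReal_ofReal (by positivity)]
  have hup : W ⊆ U ∪ N := by
    refine Set.iUnion₂_subset fun x hx y hy => ?_
    by_cases hyU : y ∈ U
    · exact Or.inl hyU
    · exact Or.inr (mem_cthickening_frontier_of_separated
        (hSfin.mem_toFinset.1 hx) hyU (hdist x y hy))
  have hlow : U ⊆ W ∪ N := by
    intro y hy
    let x : X := b.symm ⟨F y, hFL y⟩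
    have hx : F y = b x := by simp [x]
    by_cases hxU : (x : EuclideanSpace ℝ (Fin n)) ∈ U
    · exact Or.inl (Set.mem_iUnion₂.2 ⟨x, hSfin.mem_toFinset.2 hxU, hx⟩)
    · refine Or.inr ?_
      have : y ∈ Metric.cthickening R (frontier Uᶜ) :=
        mem_cthickening_frontier_of_separated (U := Uᶜ) hxU (fun h => h hy) (hdist x y hx)
      rwa [frontier_compl] at this
  have hWfin : volume W ≠ ⊤ := hWv ▸ ENNReal.ofReal_ne_top
  have h1 : (volume W).toReal ≤ (volume U).toReal + (volume N).toReal := by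
    rw [← ENNReal.toReal_add hUfin hNfin]
    exact ENNReal.toReal_mono (ENNReal.add_ne_top.2 ⟨hUfin, hNfin⟩)
      ((measure_mono hup).trans (measure_union_le _ _))
  have h2 : (volume U).toReal ≤ (volume W).toReal + (volume N).toReal := by
    rw [← ENNReal.toReal_add hWfin hNfin]
    exact ENNReal.toReal_mono (ENNReal.add_ne_top.2 ⟨hWfin, hNfin⟩)
      ((measure_mono hlow).trans (measure_union_le _ _))
  have h3 : ((X ∩ U).ncard : ℝ) = ρ * (volume W).toReal := by
    rw [hWr]; field_simp
  have hT0 : 0 ≤ (volume (Metric.thickening 1 (frontier U))).toReal := ENNReal.toReal_nonneg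
  have h4 : |(volume W).toReal - (volume U).toReal| ≤ (volume N).toReal :=
    abs_le.2 ⟨by linarith, by linarith⟩
  rw [h3, ← mul_sub, abs_mul, abs_of_pos hρ]
  calc ρ * |(volume W).toReal - (volume U).toReal|
      ≤ ρ * (κ * (volume (Metric.thickening 1 (frontier U))).toReal) := by
        gcongr; exact h4.trans hN
    _ ≤ (ρ * κ + 1) * (volume (Metric.thickening 1 (frontier U))).toReal := by
        rw [add_mul, ← mul_assoc]; linarith
    _ ≤ _ := by gcongr

namespace CellSet

variable {n d : ℕ}

/-- The discrete cube of integer points with lower corner `a` and side `s`. -/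
noncomputable def cube (a : Fin n → ℤ) (s : ℕ) : Finset (Fin n → ℤ) :=
  Fintype.piFinset fun l => Finset.Ico (a l) (a l + s)

lemma mem_cube {a : Fin n → ℤ} {s : ℕ} {x : Fin n → ℤ} :
    x ∈ cube a s ↔ ∀ l, a l ≤ x l ∧ x l < a l + s := by
  simp [cube]

lemma card_cube (a : Fin n → ℤ) (s : ℕ) : (cube a s).card = s ^ n := by
  simp [cube]

lemma insertNth_mem_cube {a : Fin (d + 1) → ℤ} {s : ℕ} {i : Fin (d + 1)} {t : ℤ}
    {x : Fin d → ℤ} : (i.insertNth t x : Fin (d + 1) → ℤ) ∈ cube a s ↔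
      (a i ≤ t ∧ t < a i + s) ∧ x ∈ cube (i.removeNth a) s := by
  rw [mem_cube, mem_cube, Fin.forall_iff_succAbove i]
  simp [Fin.removeNth]

lemma removeNth_mem_cube {a : Fin (d + 1) → ℤ} {s : ℕ} {x : Fin (d + 1) → ℤ} (i : Fin (d + 1))
    (hx : x ∈ cube a s) : i.removeNth x ∈ cube (i.removeNth a) s :=
  mem_cube.2 fun l => mem_cube.1 hx (i.succAbove l)

lemma sum_cube_eq_sum_lines {M : Type*} [AddCommMonoid M] (i : Fin (d + 1))
    (a : Fin (d + 1) → ℤ) (s : ℕ) (φ : (Fin (d + 1) → ℤ) → M) :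
    ∑ x ∈ cube a s, φ x = ∑ y ∈ cube (i.removeNth a) s,
      ∑ t ∈ Finset.Ico (a i) (a i + s), φ (i.insertNth t y) := by
  rw [← Finset.sum_product']
  refine Finset.sum_bij' (fun x _ => (i.removeNth x, x i)) (fun p _ => i.insertNth p.2 p.1)
    ?_ ?_ ?_ ?_ ?_
  · intro x hx
    exact Finset.mk_mem_product (removeNth_mem_cube i hx) (Finset.mem_Ico.2 (mem_cube.1 hx i))
  · rintro ⟨y, t⟩ h
    obtain ⟨h₁, h₂⟩ := Finset.mem_product.1 h
    exact insertNth_mem_cube.2 ⟨Finset.mem_Ico.1 h₂, h₁⟩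
  · intro x _
    simp
  · rintro ⟨y, t⟩ _
    simp
  · intro x _
    simp

/-- The face between `x` and `x + eᵢ` separates `u` from its complement. -/
def IsBdry (u : Set (Fin n → ℤ)) (x : Fin n → ℤ) (i : Fin n) : Prop :=
  ¬ (x ∈ u ↔ x + Pi.single i 1 ∈ u)

lemma isBdry_compl {u : Set (Fin n → ℤ)} {x : Fin n → ℤ} {i : Fin n} :
    IsBdry uᶜ x i ↔ IsBdry u x i := by
  simp only [IsBdry, Set.mem_compl_iff, not_iff_not]

open Classical in
/-- The boundary faces of `u` in the interior of `Q`. -/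
noncomputable def faces (u : Set (Fin n → ℤ)) (Q : Finset (Fin n → ℤ)) :
    Finset ((Fin n → ℤ) × Fin n) :=
  (Q ×ˢ Finset.univ).filter fun p => p.1 + Pi.single p.2 1 ∈ Q ∧ IsBdry u p.1 p.2

lemma mem_faces {u : Set (Fin n → ℤ)} {Q : Finset (Fin n → ℤ)} {p : (Fin n → ℤ) × Fin n} :
    p ∈ faces u Q ↔ p.1 ∈ Q ∧ p.1 + Pi.single p.2 1 ∈ Q ∧ IsBdry u p.1 p.2 := by
  simp [faces]

lemma faces_compl (u : Set (Fin n → ℤ)) (Q : Finset (Fin n → ℤ)) : faces uᶜ Q = faces u Q := by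
  ext p
  simp only [mem_faces, isBdry_compl]

lemma faces_mono {u : Set (Fin n → ℤ)} {Q R : Finset (Fin n → ℤ)} (h : Q ⊆ R) :
    faces u Q ⊆ faces u R := fun p hp => by
  rw [mem_faces] at hp ⊢
  exact ⟨h hp.1, h hp.2.1, hp.2.2⟩

lemma cube_subset_cube {a b : Fin n → ℤ} {s t : ℕ}
    (h : ∀ l, b l ≤ a l ∧ a l + s ≤ b l + t) : cube a s ⊆ cube b t := fun x hx => by
  rw [mem_cube] at hx ⊢
  intro l
  have := hx l
  have := h l
  constructor <;> linarith

open Classical in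
/-- The number of cells of `u` in `Q`. -/
noncomputable def cnt (u : Set (Fin n → ℤ)) (Q : Finset (Fin n → ℤ)) : ℕ :=
  (Q.filter (· ∈ u)).card

lemma cnt_add_cnt_compl (u : Set (Fin n → ℤ)) (Q : Finset (Fin n → ℤ)) :
    cnt u Q + cnt uᶜ Q = Q.card := by
  classical
  simp only [cnt, Set.mem_compl_iff]
  exact Finset.card_filter_add_card_filter_not _

lemma cnt_mono {u : Set (Fin n → ℤ)} {Q R : Finset (Fin n → ℤ)} (h : Q ⊆ R) :
    cnt u Q ≤ cnt u R := by
  classical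
  exact Finset.card_le_card (Finset.filter_subset_filter _ h)

open Classical in
/-- The total weight of the cells of `u` in `Q`. -/
noncomputable def wt (ν : (Fin n → ℤ) → ℝ) (u : Set (Fin n → ℤ)) (Q : Finset (Fin n → ℤ)) : ℝ :=
  ∑ x ∈ Q.filter (· ∈ u), ν x

lemma wt_add_wt_compl (ν : (Fin n → ℤ) → ℝ) (u : Set (Fin n → ℤ)) (Q : Finset (Fin n → ℤ)) :
    wt ν u Q + wt ν uᶜ Q = ∑ x ∈ Q, ν x := by
  classical
  simp only [wt, Set.mem_compl_iff]
  exact Finset.sum_filter_add_sum_filter_not _ _ _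

lemma abs_wt_le {ν : (Fin n → ℤ) → ℝ} {c : ℝ} (hν : ∀ x, |ν x| ≤ c)
    (u : Set (Fin n → ℤ)) (Q : Finset (Fin n → ℤ)) : |wt ν u Q| ≤ c * cnt u Q := by
  classical
  refine (Finset.abs_sum_le_sum_abs _ _).trans ((Finset.sum_le_card_nsmul _ _ c
    fun x _ => hν x).trans ?_)
  rw [nsmul_eq_mul, mul_comm, cnt]

/-- A labelling of the points of `Q` by subcubes of `Q` that partition it. -/
structure IsPartition (Q : Finset (Fin n → ℤ)) (key : (Fin n → ℤ) → (Fin n → ℤ) × ℕ) :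
    Prop where
  self_mem : ∀ x ∈ Q, x ∈ cube (key x).1 (key x).2
  subset : ∀ x ∈ Q, cube (key x).1 (key x).2 ⊆ Q
  eq_of_mem : ∀ x ∈ Q, ∀ y ∈ cube (key x).1 (key x).2, key y = key x

namespace IsPartition

variable {Q : Finset (Fin n → ℤ)} {key : (Fin n → ℤ) → (Fin n → ℤ) × ℕ}

lemma sum_eq {M : Type*} [AddCommMonoid M] (h : IsPartition Q key) (φ : (Fin n → ℤ) → M) :
    ∑ x ∈ Q, φ x = ∑ p ∈ Q.image key, ∑ x ∈ cube p.1 p.2, φ x := by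
  rw [← Finset.sum_fiberwise_of_maps_to (fun x hx => Finset.mem_image_of_mem key hx)]
  refine Finset.sum_congr rfl fun p hp => Finset.sum_congr ?_ fun _ _ => rfl
  obtain ⟨x, hx, rfl⟩ := Finset.mem_image.1 hp
  ext y
  rw [Finset.mem_filter]
  constructor
  · rintro ⟨hy, hyx⟩
    rw [← hyx]
    exact h.self_mem y hy
  · exact fun hy => ⟨h.subset x hx hy, h.eq_of_mem x hx y hy⟩

lemma cnt_eq (h : IsPartition Q key) (u : Set (Fin n → ℤ)) :
    cnt u Q = ∑ p ∈ Q.image key, cnt u (cube p.1 p.2) := by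
  classical
  simp only [cnt, Finset.card_filter]
  exact h.sum_eq _

lemma wt_eq (h : IsPartition Q key) (ν : (Fin n → ℤ) → ℝ) (u : Set (Fin n → ℤ)) :
    wt ν u Q = ∑ p ∈ Q.image key, wt ν u (cube p.1 p.2) := by
  classical
  simp only [wt, Finset.sum_filter]
  exact h.sum_eq _

lemma sum_faces_add_le (h : IsPartition Q key) (u : Set (Fin n → ℤ))
    {E : Finset ((Fin n → ℤ) × Fin n)} (hE : E ⊆ faces u Q)
    (hE' : ∀ p ∈ E, key p.1 ≠ key (p.1 + Pi.single p.2 1)) :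
    ∑ p ∈ Q.image key, (faces u (cube p.1 p.2)).card + E.card ≤ (faces u Q).card := by
  classical
  rw [← Finset.card_biUnion, ← Finset.card_union_of_disjoint]
  · refine Finset.card_le_card (Finset.union_subset (Finset.biUnion_subset.2 fun p hp => ?_) hE)
    obtain ⟨x, hx, rfl⟩ := Finset.mem_image.1 hp
    exact faces_mono (h.subset x hx)
  · rw [Finset.disjoint_left]
    intro f hf hfE
    obtain ⟨p, hp, hfp⟩ := Finset.mem_biUnion.1 hf
    obtain ⟨x, hx, rfl⟩ := Finset.mem_image.1 hp
    obtain ⟨h₁, h₂, -⟩ := mem_faces.1 hfp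
    exact hE' f hfE ((h.eq_of_mem x hx _ h₁).trans (h.eq_of_mem x hx _ h₂).symm)
  · intro p hp q hq hpq
    obtain ⟨x, hx, rfl⟩ := Finset.mem_image.1 hp
    obtain ⟨y, hy, rfl⟩ := Finset.mem_image.1 hq
    refine Finset.disjoint_left.2 fun f hf hf' => hpq ?_
    exact (h.eq_of_mem x hx _ (mem_faces.1 hf).1).symm.trans
      (h.eq_of_mem y hy _ (mem_faces.1 hf').1)

lemma sum_faces_le (h : IsPartition Q key) (u : Set (Fin n → ℤ)) :
    ∑ p ∈ Q.image key, (faces u (cube p.1 p.2)).card ≤ (faces u Q).card := by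
  simpa using h.sum_faces_add_le u (E := ∅) (by simp) (by simp)

end IsPartition

/-- The corner of the grid cube of side `s` containing `x`, for the grid based at `a`. -/
def gridCorner (a : Fin n → ℤ) (s : ℕ) (x : Fin n → ℤ) : Fin n → ℤ :=
  fun l => a l + s * ((x l - a l) / s)

lemma mem_cube_gridCorner (a : Fin n → ℤ) {s : ℕ} (hs : 0 < s) (x : Fin n → ℤ) :
    x ∈ cube (gridCorner a s x) s := by
  rw [mem_cube]
  intro l
  have hs' : (0 : ℤ) < s := by exact_mod_cast hs
  have h₁ := Int.emod_add_mul_ediv (x l - a l) s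
  have h₂ := Int.emod_nonneg (x l - a l) hs'.ne'
  have h₃ := Int.emod_lt_of_pos (x l - a l) hs'
  simp only [gridCorner]
  constructor <;> linarith

lemma gridCorner_eq_of_mem {a : Fin n → ℤ} {s : ℕ} {x y : Fin n → ℤ}
    (hy : y ∈ cube (gridCorner a s x) s) : gridCorner a s y = gridCorner a s x := by
  funext l
  have h := mem_cube.1 hy l
  simp only [gridCorner] at h ⊢
  have hs' : (0 : ℤ) < s := by linarith
  have : (y l - a l) / s = (x l - a l) / s := by
    rw [Int.ediv_eq_iff_of_pos hs']
    constructor <;> nlinarith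
  rw [this]

lemma cube_gridCorner_subset {a : Fin n → ℤ} {s t : ℕ} (hs : 0 < s) (hst : s ∣ t)
    {x : Fin n → ℤ} (hx : x ∈ cube a t) : cube (gridCorner a s x) s ⊆ cube a t := by
  obtain ⟨m, rfl⟩ := hst
  refine cube_subset_cube fun l => ?_
  have h := mem_cube.1 hx l
  have hs' : (0 : ℤ) < s := by exact_mod_cast hs
  push_cast at h ⊢
  have h₁ : 0 ≤ (x l - a l) / s := Int.ediv_nonneg (by linarith) hs'.le
  have h₂ : (x l - a l) / s < m := Int.ediv_lt_of_lt_mul hs' (by linarith)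
  simp only [gridCorner]
  constructor
  · nlinarith
  · nlinarith

lemma isPartition_grid (a : Fin n → ℤ) {s t : ℕ} (hs : 0 < s) (hst : s ∣ t) :
    IsPartition (cube a t) fun x => (gridCorner a s x, s) where
  self_mem x _ := mem_cube_gridCorner a hs x
  subset x hx := cube_gridCorner_subset hs hst hx
  eq_of_mem x _ y hy := by simp [gridCorner_eq_of_mem hy]

lemma gridCorner_nested {a : Fin n → ℤ} {s t : ℕ} (hs : 0 < s) (hst : s ∣ t)
    {x y : Fin n → ℤ} (hxy : gridCorner a s x = gridCorner a s y) :
    gridCorner a t x = gridCorner a t y := by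
  obtain ⟨m, rfl⟩ := hst
  funext l
  have hs' : (s : ℤ) ≠ 0 := by exact_mod_cast hs.ne'
  have h := congrFun hxy l
  simp only [gridCorner] at h ⊢
  have h' : (x l - a l) / (s : ℤ) = (y l - a l) / s := by
    have := mul_left_cancel₀ hs' (by linarith : (s : ℤ) * ((x l - a l) / (s : ℤ)) =
      s * ((y l - a l) / s))
    exact this
  push_cast
  rw [← Int.ediv_ediv_of_nonneg (by positivity), ← Int.ediv_ediv_of_nonneg (by positivity), h']

lemma exists_switch {p : ℤ → Prop} {t t' : ℤ} (h : t ≤ t') (hp : ¬ (p t ↔ p t')) :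
    ∃ τ, t ≤ τ ∧ τ < t' ∧ ¬ (p τ ↔ p (τ + 1)) := by
  induction t', h using Int.leInduction with
  | base => exact absurd Iff.rfl hp
  | succ m hm ih =>
    by_cases hpm : p t ↔ p m
    · exact ⟨m, hm, by lia, fun h => hp (hpm.trans h)⟩
    · obtain ⟨τ, h₁, h₂, h₃⟩ := ih hpm
      exact ⟨τ, h₁, by lia, h₃⟩

lemma update_mem_cube {a : Fin n → ℤ} {s : ℕ} {x : Fin n → ℤ} {i : Fin n} {t : ℤ}
    (hx : x ∈ cube a s) (ht : a i ≤ t ∧ t < a i + s) : Function.update x i t ∈ cube a s := by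
  rw [mem_cube] at hx ⊢
  intro l
  by_cases hl : l = i
  · subst hl
    simpa using ht
  · simpa [hl] using hx l

lemma update_add_single (x : Fin n → ℤ) (i : Fin n) (t : ℤ) :
    Function.update x i t + Pi.single i 1 = Function.update x i (t + 1) := by
  funext l
  by_cases hl : l = i
  · subst hl
    simp
  · simp [hl]

/-- A line of a cube that meets `u` and its complement carries a boundary face between. -/
lemma exists_face_of_line {u : Set (Fin n → ℤ)} {a : Fin n → ℤ} {s : ℕ} {x : Fin n → ℤ}
    {i : Fin n} {t t' : ℤ} (hx : x ∈ cube a s) (ht : a i ≤ t ∧ t < a i + s)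
    (ht' : a i ≤ t' ∧ t' < a i + s)
    (h : ¬ (Function.update x i t ∈ u ↔ Function.update x i t' ∈ u)) :
    ∃ τ, (Function.update x i τ, i) ∈ faces u (cube a s) := by
  wlog htt : t ≤ t' generalizing t t'
  · exact this ht' ht (fun h' => h h'.symm) (by lia)
  obtain ⟨τ, h₁, h₂, h₃⟩ := exists_switch (p := fun τ => Function.update x i τ ∈ u) htt h
  refine ⟨τ, mem_faces.2 ⟨update_mem_cube hx ⟨by lia, by lia⟩, ?_, ?_⟩⟩
  · rw [update_add_single]
    exact update_mem_cube hx ⟨by lia, by lia⟩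
  · rw [IsBdry, update_add_single]
    exact h₃

open Classical in
/-- The pairs `(z, z')` for which moving the coordinate `i` of `z` to that of `z'` switches
membership in `u`. -/
noncomputable def switchPairs (u : Set (Fin n → ℤ)) (Q : Finset (Fin n → ℤ)) (i : Fin n) :
    Finset ((Fin n → ℤ) × (Fin n → ℤ)) :=
  (Q ×ˢ Q).filter fun p => ¬ (p.1 ∈ u ↔ Function.update p.1 i (p.2 i) ∈ u)

lemma cnt_mul_cnt_compl_le_sum_switchPairs (u : Set (Fin n → ℤ)) (a : Fin n → ℤ) (s : ℕ) :
    cnt u (cube a s) * cnt uᶜ (cube a s) ≤ ∑ i, (switchPairs u (cube a s) i).card := by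
  classical
  set hyb : ℕ → (Fin n → ℤ) → (Fin n → ℤ) → (Fin n → ℤ) :=
    fun k x y l => if l.val < k then y l else x l with hhyb
  have hmem : ∀ k x y, x ∈ cube a s → y ∈ cube a s → hyb k x y ∈ cube a s := by
    intro k x y hx hy
    rw [mem_cube] at hx hy ⊢
    intro l
    simp only [hhyb]
    split_ifs
    exacts [hy l, hx l]
  have hsucc : ∀ (k : Fin n) x y,
      hyb (k + 1) x y = Function.update (hyb k x y) k (hyb k y x k) := by
    intro k x y
    funext l
    by_cases hl : l = k
    · subst hl
      simp [hhyb]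
    · have : l.val ≠ k.val := fun h => hl (Fin.ext h)
      rw [Function.update_of_ne hl]
      simp only [hhyb]
      congr 1
      simp only [eq_iff_iff]
      lia
  have hinv : ∀ k x y, hyb k (hyb k x y) (hyb k y x) = x := by
    intro k x y
    funext l
    simp only [hhyb]
    split_ifs <;> rfl
  rw [cnt, cnt, ← Finset.card_product]
  calc _ ≤ (Finset.univ.biUnion fun k : Fin n => ((cube a s ×ˢ cube a s).filter fun p =>
        ¬ (hyb k p.1 p.2 ∈ u ↔ hyb (k + 1) p.1 p.2 ∈ u))).card := by
        refine Finset.card_le_card ?_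
        rintro ⟨x, y⟩ hxy
        simp only [Finset.mem_product, Finset.mem_filter, Set.mem_compl_iff] at hxy
        obtain ⟨⟨hx, hxu⟩, hy, hyu⟩ := hxy
        have h₀ : hyb 0 x y = x := by funext l; simp [hhyb]
        have hn : hyb n x y = y := by funext l; simp [hhyb]
        obtain ⟨τ, h₁, h₂, h₃⟩ := exists_switch (p := fun τ : ℤ => hyb τ.toNat x y ∈ u)
          (t := 0) (t' := n) (by positivity) (by simp [h₀, hn, hxu, hyu])
        lift τ to ℕ using h₁
        have hτ : τ < n := by exact_mod_cast h₂
        simp only [Finset.mem_biUnion, Finset.mem_univ, true_and, Finset.mem_filter,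
          Finset.mem_product]
        refine ⟨⟨τ, hτ⟩, ⟨hx, hy⟩, ?_⟩
        have e : ((τ : ℤ) + 1).toNat = τ + 1 := by lia
        simpa [e] using h₃
    _ ≤ _ := by
        refine Finset.card_biUnion_le.trans (Finset.sum_le_sum fun k _ => ?_)
        refine Finset.card_le_card_of_injOn (fun p => (hyb k p.1 p.2, hyb k p.2 p.1)) ?_ ?_
        · rintro ⟨x, y⟩ hxy
          simp only [Finset.coe_filter, Finset.mem_product, Set.mem_ofPred_eq] at hxy
          simp only [switchPairs, Finset.coe_filter, Finset.mem_product, Set.mem_ofPred_eq]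
          refine ⟨⟨hmem _ _ _ hxy.1.1 hxy.1.2, hmem _ _ _ hxy.1.2 hxy.1.1⟩, ?_⟩
          rw [← hsucc]
          exact hxy.2
        · rintro ⟨x, y⟩ - ⟨x', y'⟩ - h
          simp only [Prod.mk.injEq] at h ⊢
          constructor
          · rw [← hinv k x y, ← hinv k x' y', h.1, h.2]
          · rw [← hinv k y x, ← hinv k y' x', h.1, h.2]

lemma sum_switchPairs_le (u : Set (Fin n → ℤ)) (a : Fin n → ℤ) (s : ℕ) :
    ∑ i, (switchPairs u (cube a s) i).card ≤ s ^ (n + 1) * (faces u (cube a s)).card := by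
  classical
  have key : ∀ i, (switchPairs u (cube a s) i).card ≤
      s ^ (n + 1) * ((faces u (cube a s)).filter fun p => p.2 = i).card := by
    intro i
    have hf : ∀ p : (Fin n → ℤ) × (Fin n → ℤ), ∃ τ : ℤ, p ∈ switchPairs u (cube a s) i →
        (Function.update p.1 i τ, i) ∈ faces u (cube a s) := by
      rintro ⟨z, z'⟩
      by_cases h : (z, z') ∈ switchPairs u (cube a s) i
      · simp only [switchPairs, Finset.mem_filter, Finset.mem_product] at h
        obtain ⟨τ, hτ⟩ := exists_face_of_line (u := u) (i := i) (t := z i) (t' := z' i) h.1.1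
          (mem_cube.1 h.1.1 i) (mem_cube.1 h.1.2 i) (by simpa using h.2)
        exact ⟨τ, fun _ => hτ⟩
      · exact ⟨0, fun h' => absurd h' h⟩
    choose τ hτ using hf
    have hcard : s ^ (n + 1) * ((faces u (cube a s)).filter fun p => p.2 = i).card =
        (((faces u (cube a s)).filter fun p => p.2 = i) ×ˢ
          (Finset.Ico (a i) (a i + s) ×ˢ cube a s)).card := by
      simp only [Finset.card_product, card_cube, Int.card_Ico, add_sub_cancel_left,
        Int.toNat_natCast]
      ring
    rw [hcard]
    refine Finset.card_le_card_of_injOn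
      (fun p => ((Function.update p.1 i (τ p), i), (p.1 i, p.2))) ?_ ?_
    · intro p hp
      have h₁ := hτ p hp
      simp only [Finset.mem_coe, switchPairs, Finset.mem_filter, Finset.mem_product] at hp
      simp only [Finset.coe_product, Set.mem_prod, Finset.mem_coe, Finset.mem_filter,
        and_true, Finset.mem_Ico]
      exact ⟨h₁, mem_cube.1 hp.1.1 i, hp.1.2⟩
    · rintro ⟨z, z'⟩ - ⟨w, w'⟩ - h
      simp only [Prod.mk.injEq, and_true] at h ⊢
      refine ⟨?_, h.2.2⟩
      funext l
      by_cases hl : l = i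
      · rw [hl]
        exact h.2.1
      · simpa [hl] using congrFun h.1 l
  refine (Finset.sum_le_sum fun i _ => key i).trans ?_
  rw [← Finset.mul_sum]
  gcongr
  rw [Finset.card_eq_sum_card_fiberwise (f := Prod.snd) (t := Finset.univ)
    (fun _ _ => by simp)]

/-- A discrete Poincaré inequality. -/
lemma cnt_mul_cnt_compl_le (u : Set (Fin n → ℤ)) (a : Fin n → ℤ) (s : ℕ) :
    cnt u (cube a s) * cnt uᶜ (cube a s) ≤ s ^ (n + 1) * (faces u (cube a s)).card :=
  (cnt_mul_cnt_compl_le_sum_switchPairs u a s).trans (sum_switchPairs_le u a s)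

lemma cnt_le_of_minority {u : Set (Fin n → ℤ)} {a : Fin n → ℤ} {s : ℕ} (hs : 0 < s)
    (h : 2 * cnt u (cube a s) ≤ s ^ n) :
    cnt u (cube a s) ≤ 2 * s * (faces u (cube a s)).card := by
  have h₁ := cnt_mul_cnt_compl_le u a s
  have h₂ := cnt_add_cnt_compl u (cube a s)
  rw [card_cube] at h₂
  have h₃ : s ^ n ≤ 2 * cnt uᶜ (cube a s) := by lia
  have h₄ : s ^ n * cnt u (cube a s) ≤ s ^ n * (2 * s * (faces u (cube a s)).card) := by
    calc s ^ n * cnt u (cube a s) ≤ 2 * cnt uᶜ (cube a s) * cnt u (cube a s) := by gcongr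
      _ = 2 * (cnt u (cube a s) * cnt uᶜ (cube a s)) := by ring
      _ ≤ 2 * (s ^ (n + 1) * (faces u (cube a s)).card) := by gcongr
      _ = _ := by ring
  exact Nat.le_of_mul_le_mul_left h₄ (by positivity)

open Classical in
/-- The cells of `u` in the layer `xᵢ = t` of `Q`. -/
noncomputable def layer (u : Set (Fin n → ℤ)) (Q : Finset (Fin n → ℤ)) (i : Fin n) (t : ℤ) :
    Finset (Fin n → ℤ) :=
  Q.filter fun x => x i = t ∧ x ∈ u

/-- The trace of a minority colour on a layer of a cube is bounded by its boundary. -/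
lemma card_layer_le_of_minority {u : Set (Fin n → ℤ)} {a : Fin n → ℤ} {s : ℕ} (hs : 0 < s)
    (h : 2 * cnt u (cube a s) ≤ s ^ n) (i : Fin n) (t : ℤ) :
    (layer u (cube a s) i t).card ≤ 3 * (faces u (cube a s)).card := by
  classical
  set T := layer u (cube a s) i t with hT
  have hTmem : ∀ x ∈ T, x ∈ cube a s ∧ x i = t ∧ x ∈ u := fun x hx => by
    simpa [hT, layer] using hx
  set T₁ := T.filter fun x => ∀ τ, a i ≤ τ → τ < a i + s → Function.update x i τ ∈ u with hT₁
  have h₁ : s * T₁.card ≤ cnt u (cube a s) := by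
    have : s * T₁.card = (T₁ ×ˢ Finset.Ico (a i) (a i + s)).card := by
      simp [mul_comm]
    rw [this, cnt]
    refine Finset.card_le_card_of_injOn (fun p => Function.update p.1 i p.2) ?_ ?_
    · rintro ⟨x, τ⟩ hx
      simp only [Finset.coe_product, Set.mem_prod, Finset.mem_coe, Finset.mem_Ico, hT₁,
        Finset.mem_filter] at hx
      simp only [Finset.coe_filter, Set.mem_ofPred_eq]
      exact ⟨update_mem_cube (hTmem x hx.1.1).1 hx.2, hx.1.2 τ hx.2.1 hx.2.2⟩
    · rintro ⟨x, τ⟩ hx ⟨y, τ'⟩ hy hxy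
      simp only [Finset.coe_product, Set.mem_prod, Finset.mem_coe, Finset.mem_Ico, hT₁,
        Finset.mem_filter] at hx hy
      simp only at hxy
      simp only [Prod.mk.injEq]
      refine ⟨?_, by simpa using congrFun hxy i⟩
      funext l
      by_cases hl : l = i
      · rw [hl, (hTmem x hx.1.1).2.1, (hTmem y hy.1.1).2.1]
      · simpa [hl] using congrFun hxy l
  have h₂ : T₁.card ≤ 2 * (faces u (cube a s)).card := by
    have := h₁.trans (cnt_le_of_minority hs h)
    refine Nat.le_of_mul_le_mul_left (this.trans (le_of_eq ?_)) hs
    ring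
  have h₃ : (T.filter fun x => ¬ ∀ τ, a i ≤ τ → τ < a i + s → Function.update x i τ ∈ u).card ≤
      (faces u (cube a s)).card := by
    have hf : ∀ x ∈ T.filter fun x => ¬ ∀ τ, a i ≤ τ → τ < a i + s → Function.update x i τ ∈ u,
        ∃ τ : ℤ, (Function.update x i τ, i) ∈ faces u (cube a s) := by
      intro x hx
      obtain ⟨hxT, hx'⟩ := Finset.mem_filter.1 hx
      push Not at hx'
      obtain ⟨τ, h₁, h₂, h₃⟩ := hx'
      have hx := hTmem x hxT
      refine exists_face_of_line (t := t) (t' := τ) hx.1 (hx.2.1 ▸ mem_cube.1 hx.1 i)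
        ⟨h₁, h₂⟩ ?_
      rw [← hx.2.1, Function.update_eq_self]
      simp [hx.2.2, h₃]
    choose! τ hτ using hf
    refine Finset.card_le_card_of_injOn (fun x => (Function.update x i (τ x), i))
      (fun x hx => hτ x hx) ?_
    intro x hx y hy hxy
    simp only [Finset.coe_filter, Set.mem_ofPred_eq] at hx hy
    simp only [Prod.mk.injEq, and_true] at hxy
    funext l
    by_cases hl : l = i
    · rw [hl, (hTmem x hx.1).2.1, (hTmem y hy.1).2.1]
    · simpa [hl] using congrFun hxy l
  have := Finset.card_filter_add_card_filter_not (s := T)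
    (fun x => ∀ τ, a i ≤ τ → τ < a i + s → Function.update x i τ ∈ u)
  lia

lemma exists_levels (u : Set (Fin (d + 1) → ℤ)) (a : Fin (d + 1) → ℤ) {s : ℕ}
    (hs : 0 < s) [DecidablePred (· ∈ u)] :
    ∃ i : Fin (d + 1), ∃ t t' : ℤ, (a i ≤ t ∧ t < a i + s) ∧ (a i ≤ t' ∧ t' < a i + s) ∧
      cnt u (cube a s) * cnt uᶜ (cube a s) ≤ (d + 1) * s ^ (d + 2) *
        ((cube (i.removeNth a) s).filter fun y =>
          ¬ ((i.insertNth t y : Fin (d + 1) → ℤ) ∈ u ↔ i.insertNth t' y ∈ u)).card := by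
  set N : Fin (d + 1) → ℤ → ℤ → ℕ := fun i t t' => ((cube (i.removeNth a) s).filter fun y =>
          ¬ ((i.insertNth t y : Fin (d + 1) → ℤ) ∈ u ↔ i.insertNth t' y ∈ u)).card with hN
  by_contra hcon
  replace hcon : ∀ i t t', (a i ≤ t ∧ t < a i + s) → (a i ≤ t' ∧ t' < a i + s) →
      (d + 1) * s ^ (d + 2) * N i t t' < cnt u (cube a s) * cnt uᶜ (cube a s) :=
    fun i t t' h h' => not_le.1 fun h'' => hcon ⟨i, t, t', h, h', h''⟩
  have hK : ∀ i, (switchPairs u (cube a s) i).card ≤ s ^ d *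
      ∑ p ∈ Finset.Ico (a i) (a i + s) ×ˢ Finset.Ico (a i) (a i + s), N i p.1 p.2 := by
    intro i
    rw [← Finset.card_sigma, ← card_cube (i.removeNth a) s, ← Finset.card_product]
    refine Finset.card_le_card_of_injOn
      (fun p => (i.removeNth p.2, ⟨(p.1 i, p.2 i), i.removeNth p.1⟩)) ?_ ?_
    · rintro ⟨z, z'⟩ h
      simp only [Finset.mem_coe, switchPairs, Finset.mem_filter, Finset.mem_product] at h
      simp only [Finset.coe_product, Set.mem_prod, Finset.mem_coe, Finset.mem_sigma,
        Finset.mem_product, Finset.mem_Ico, Finset.mem_filter]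
      refine ⟨removeNth_mem_cube i h.1.2, ⟨mem_cube.1 h.1.1 i, mem_cube.1 h.1.2 i⟩,
        removeNth_mem_cube i h.1.1, ?_⟩
      rw [Fin.insertNth_self_removeNth, Fin.insertNth_removeNth]
      exact h.2
    · rintro ⟨z, z'⟩ - ⟨w, w'⟩ - h
      simp only [Prod.mk.injEq, Sigma.mk.injEq] at h
      obtain ⟨h₁, ⟨h₂, h₃⟩, h₄⟩ := h
      have h₄ := eq_of_heq h₄
      rw [Prod.mk.injEq, ← Fin.insertNth_self_removeNth i z, ← Fin.insertNth_self_removeNth i z',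
        ← Fin.insertNth_self_removeNth i w, ← Fin.insertNth_self_removeNth i w', h₁, h₂, h₃, h₄]
      exact ⟨rfl, rfl⟩
  set c := cnt u (cube a s) * cnt uᶜ (cube a s) with hc
  have h₁ : (d + 1) * s ^ (d + 2) * c ≤ (d + 1) * s ^ (d + 2) *
      ∑ i, s ^ d *
        ∑ p ∈ Finset.Ico (a i) (a i + s) ×ˢ Finset.Ico (a i) (a i + s), N i p.1 p.2 := by
    gcongr
    exact (cnt_mul_cnt_compl_le_sum_switchPairs u a s).trans (Finset.sum_le_sum fun i _ => hK i)
  have h₂ : (d + 1) * s ^ (d + 2) * ∑ i, s ^ d *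
        ∑ p ∈ Finset.Ico (a i) (a i + s) ×ˢ Finset.Ico (a i) (a i + s), N i p.1 p.2 <
      (d + 1) * s ^ (d + 2) * c := by
    have : ∀ i : Fin (d + 1), (d + 1) * s ^ (d + 2) *
        ∑ p ∈ Finset.Ico (a i) (a i + s) ×ˢ Finset.Ico (a i) (a i + s), N i p.1 p.2 <
        s ^ 2 * c := by
      intro i
      rw [Finset.mul_sum]
      calc _ < ∑ p ∈ Finset.Ico (a i) (a i + s) ×ˢ Finset.Ico (a i) (a i + s), c := by
            refine Finset.sum_lt_sum_of_nonempty ?_ ?_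
            · refine ⟨(a i, a i), ?_⟩
              simp [hs]
            · rintro ⟨t, t'⟩ h
              simp only [Finset.mem_product, Finset.mem_Ico] at h
              exact hcon i t t' h.1 h.2
        _ = s ^ 2 * c := by simp [sq]
    calc _ = ∑ i : Fin (d + 1), s ^ d * ((d + 1) * s ^ (d + 2) *
        ∑ p ∈ Finset.Ico (a i) (a i + s) ×ˢ Finset.Ico (a i) (a i + s), N i p.1 p.2) := by
          rw [Finset.mul_sum]
          exact Finset.sum_congr rfl fun i _ => by ring
      _ < ∑ i : Fin (d + 1), s ^ d * (s ^ 2 * c) := by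
          refine Finset.sum_lt_sum_of_nonempty Finset.univ_nonempty fun i _ => ?_
          have := this i
          gcongr
      _ = _ := by simp; ring
  exact absurd h₁ (not_le.2 h₂)

open Classical in
/-- The faces of cells of `u ∩ Q` through which one leaves `Q` in a positive direction. -/
noncomputable def sliceUp (u : Set (Fin n → ℤ)) (Q : Finset (Fin n → ℤ)) :
    Finset ((Fin n → ℤ) × Fin n) :=
  (Q ×ˢ Finset.univ).filter fun p => p.1 ∈ u ∧ p.1 + Pi.single p.2 1 ∉ Q

open Classical in
/-- The faces of cells of `u ∩ Q` through which one leaves `Q` in a negative direction. -/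
noncomputable def sliceDown (u : Set (Fin n → ℤ)) (Q : Finset (Fin n → ℤ)) :
    Finset ((Fin n → ℤ) × Fin n) :=
  (Q ×ˢ Finset.univ).filter fun p => p.1 ∈ u ∧ p.1 - Pi.single p.2 1 ∉ Q

/-- The area of the part of `∂Q` that is adjacent to cells of `u ∩ Q`. -/
noncomputable def slice (u : Set (Fin n → ℤ)) (Q : Finset (Fin n → ℤ)) : ℕ :=
  (sliceUp u Q).card + (sliceDown u Q).card

lemma coord_of_mem_sliceUp {u : Set (Fin n → ℤ)} {a : Fin n → ℤ} {s : ℕ}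
    {p : (Fin n → ℤ) × Fin n} (hp : p ∈ sliceUp u (cube a s)) :
    p.1 ∈ cube a s ∧ p.1 ∈ u ∧ p.1 p.2 = a p.2 + s - 1 := by
  simp only [sliceUp, Finset.mem_filter, Finset.mem_product, Finset.mem_univ, and_true] at hp
  refine ⟨hp.1, hp.2.1, ?_⟩
  by_contra h
  have h₁ := mem_cube.1 hp.1
  refine hp.2.2 (mem_cube.2 fun l => ?_)
  have := h₁ l
  by_cases hl : l = p.2
  · subst hl
    simp only [Pi.add_apply, Pi.single_eq_same]
    lia
  · simpa [hl] using this

lemma coord_of_mem_sliceDown {u : Set (Fin n → ℤ)} {a : Fin n → ℤ} {s : ℕ}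
    {p : (Fin n → ℤ) × Fin n} (hp : p ∈ sliceDown u (cube a s)) :
    p.1 ∈ cube a s ∧ p.1 ∈ u ∧ p.1 p.2 = a p.2 := by
  simp only [sliceDown, Finset.mem_filter, Finset.mem_product, Finset.mem_univ, and_true] at hp
  refine ⟨hp.1, hp.2.1, ?_⟩
  by_contra h
  have h₁ := mem_cube.1 hp.1
  refine hp.2.2 (mem_cube.2 fun l => ?_)
  have := h₁ l
  by_cases hl : l = p.2
  · subst hl
    simp only [Pi.sub_apply, Pi.single_eq_same]
    lia
  · simpa [hl] using this

lemma card_le_of_coord {a : Fin (d + 1) → ℤ} {s : ℕ} {c : Fin (d + 1) → ℤ}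
    {T : Finset ((Fin (d + 1) → ℤ) × Fin (d + 1))}
    (hT : ∀ p ∈ T, p.1 ∈ cube a s ∧ p.1 p.2 = c p.2) : T.card ≤ (d + 1) * s ^ d := by
  have : (d + 1) * s ^ d = (Finset.univ.sigma fun i : Fin (d + 1) =>
      cube (i.removeNth a) s).card := by
    simp [Finset.card_sigma, card_cube]
  rw [this]
  refine Finset.card_le_card_of_injOn (fun p => ⟨p.2, p.2.removeNth p.1⟩) ?_ ?_
  · intro p hp
    simpa using removeNth_mem_cube p.2 (hT p hp).1
  · rintro ⟨x, i⟩ hx ⟨y, i'⟩ hy h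
    simp only [Sigma.mk.injEq] at h
    obtain ⟨rfl, h⟩ := h
    have h := eq_of_heq h
    have hx' := (hT _ hx).2
    have hy' := (hT _ hy).2
    simp only at hx' hy'
    rw [Prod.mk.injEq, ← Fin.insertNth_self_removeNth i x, ← Fin.insertNth_self_removeNth i y,
      h, hx', hy']
    exact ⟨rfl, rfl⟩

lemma slice_cube_le (u : Set (Fin (d + 1) → ℤ)) (a : Fin (d + 1) → ℤ) (s : ℕ) :
    slice u (cube a s) ≤ 2 * (d + 1) * s ^ d := by
  have h₁ : (sliceUp u (cube a s)).card ≤ (d + 1) * s ^ d :=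
    card_le_of_coord (a := a) (c := fun i => a i + s - 1) fun p hp =>
      ⟨(coord_of_mem_sliceUp hp).1, (coord_of_mem_sliceUp hp).2.2⟩
  have h₂ : (sliceDown u (cube a s)).card ≤ (d + 1) * s ^ d :=
    card_le_of_coord (a := a) (c := a) fun p hp =>
      ⟨(coord_of_mem_sliceDown hp).1, (coord_of_mem_sliceDown hp).2.2⟩
  rw [slice]
  linarith

/-- No dyadic-size cube up to scale `k` can be removed from `u` or added to `u` so as to
substantially decrease the perimeter. -/
def NoProfit (u : Set (Fin n → ℤ)) (k : ℕ) : Prop :=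
  ∀ j ≤ k, ∀ a, 0 < (faces u (cube a (2 ^ j))).card →
    (faces u (cube a (2 ^ j))).card < 2 * slice u (cube a (2 ^ j)) ∧
    (faces u (cube a (2 ^ j))).card < 2 * slice uᶜ (cube a (2 ^ j))

lemma NoProfit.compl {u : Set (Fin n → ℤ)} {k : ℕ} (h : NoProfit u k) : NoProfit uᶜ k := by
  intro j hj a hm
  rw [faces_compl] at hm ⊢
  rw [compl_compl]
  exact (h j hj a hm).symm

lemma NoProfit.card_faces_le {u : Set (Fin (d + 1) → ℤ)} {k j : ℕ} (h : NoProfit u k)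
    (hj : j ≤ k) (a : Fin (d + 1) → ℤ) :
    (faces u (cube a (2 ^ j))).card ≤ 4 * (d + 1) * (2 ^ j) ^ d := by
  rcases Nat.eq_zero_or_pos (faces u (cube a (2 ^ j))).card with h₀ | h₀
  · simp [h₀]
  · have h₁ := (h j hj a h₀).1
    have h₂ := slice_cube_le u a (2 ^ j)
    linarith

lemma cnt_le_of_small {u : Set (Fin n → ℤ)} {a : Fin n → ℤ} {s t : ℕ} (hs : 0 < s)
    (hst : s ∣ t) (h : 2 * cnt u (cube a t) ≤ s ^ n) :
    cnt u (cube a t) ≤ 2 * s * (faces u (cube a t)).card := by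
  have hp := isPartition_grid a hs hst
  calc cnt u (cube a t) = _ := hp.cnt_eq u
    _ ≤ ∑ p ∈ (cube a t).image (fun x => (gridCorner a s x, s)),
        2 * s * (faces u (cube p.1 p.2)).card := by
        refine Finset.sum_le_sum fun p hp' => ?_
        obtain ⟨x, hx, rfl⟩ := Finset.mem_image.1 hp'
        refine cnt_le_of_minority hs (le_trans ?_ h)
        gcongr
        exact cnt_mono (hp.subset x hx)
    _ = 2 * s * ∑ p ∈ (cube a t).image (fun x => (gridCorner a s x, s)),
        (faces u (cube p.1 p.2)).card := by rw [Finset.mul_sum]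
    _ ≤ _ := by
        gcongr
        exact hp.sum_faces_le u

/-- Averaging over translates: a family of cubes of side `2 ^ (j + 1)` inside the cube of side
`2 ^ (j + 2)` meets few cells of `u` along its boundaries. -/
lemma NoProfit.faces_le_cnt {u : Set (Fin (d + 1) → ℤ)} {k j : ℕ} (h : NoProfit u k)
    (hj : 1 ≤ j) (hjk : j + 1 ≤ k) (x : Fin (d + 1) → ℤ) :
    2 ^ j * (faces u (cube (fun l => x l - 2 ^ (j - 1)) (2 ^ j))).card ≤
      4 * (d + 1) * cnt u (cube (fun l => x l - 2 ^ (j + 1)) (2 ^ (j + 2))) := by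
  classical
  set m := (faces u (cube (fun l => x l - 2 ^ (j - 1)) (2 ^ j))).card with hm
  obtain ⟨j, rfl⟩ : ∃ i, j = i + 1 := ⟨j - 1, by lia⟩
  simp only [add_tsub_cancel_right] at hm ⊢
  rcases Nat.eq_zero_or_pos m with h₀ | h₀
  · simp [h₀]
  set Z : Finset (Fin (d + 1) → ℤ) := cube (fun _ => -2 ^ j) (2 ^ (j + 1)) with hZ
  set c : (Fin (d + 1) → ℤ) → Fin (d + 1) → ℤ := fun z l => x l - 2 ^ (j + 1) + z l with hc
  set R := cube (fun l => x l - 2 ^ (j + 1 + 1)) (2 ^ (j + 1 + 2)) with hR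
  have hZm : ∀ z ∈ Z, ∀ l, -2 ^ j ≤ z l ∧ z l < 2 ^ j := by
    intro z hz l
    have := mem_cube.1 hz l
    push_cast at this
    rw [pow_succ] at this
    constructor <;> linarith
  have hsub : ∀ z ∈ Z, cube (c z) (2 ^ (j + 2)) ⊆ R := by
    intro z hz
    refine cube_subset_cube fun l => ?_
    have := hZm z hz l
    simp only [hc]
    push_cast
    simp only [pow_succ] at this ⊢
    constructor <;> linarith
  have h₁ : ∀ z ∈ Z, m ≤ 2 * slice u (cube (c z) (2 ^ (j + 2))) := by
    intro z hz
    have h₂ : m ≤ (faces u (cube (c z) (2 ^ (j + 2)))).card := by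
      refine Finset.card_le_card (faces_mono (cube_subset_cube fun l => ?_))
      have := hZm z hz l
      simp only [hc]
      push_cast
      simp only [pow_succ] at this ⊢
      constructor <;> linarith
    exact h₂.trans (h (j + 2) hjk (c z) (h₀.trans_le h₂)).1.le
  have hT : ((R.filter (· ∈ u)) ×ˢ (Finset.univ.sigma fun i : Fin (d + 1) =>
      cube (i.removeNth (fun _ => -2 ^ j)) (2 ^ (j + 1)))).card =
      cnt u R * ((d + 1) * (2 ^ (j + 1)) ^ d) := by
    simp [Finset.card_sigma, card_cube, cnt]
  have hbound : ∀ (S : (Fin (d + 1) → ℤ) → Finset ((Fin (d + 1) → ℤ) × Fin (d + 1))) (e : ℤ),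
      (∀ z ∈ Z, ∀ p ∈ S z, p.1 ∈ cube (c z) (2 ^ (j + 2)) ∧ p.1 ∈ u ∧ p.1 p.2 = c z p.2 + e) →
      ∑ z ∈ Z, (S z).card ≤ cnt u R * ((d + 1) * (2 ^ (j + 1)) ^ d) := by
    intro S e hS
    rw [← hT, ← Finset.card_sigma]
    refine Finset.card_le_card_of_injOn (fun q => (q.2.1, ⟨q.2.2, q.2.2.removeNth q.1⟩)) ?_ ?_
    · rintro ⟨z, p⟩ hq
      simp only [Finset.mem_coe, Finset.mem_sigma] at hq
      have := hS z hq.1 p hq.2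
      simp only [Finset.coe_product, Set.mem_prod, Finset.mem_coe, Finset.mem_filter,
        Finset.mem_sigma, Finset.mem_univ, true_and]
      exact ⟨⟨hsub z hq.1 this.1, this.2.1⟩, removeNth_mem_cube _ hq.1⟩
    · rintro ⟨z, w, i⟩ hq ⟨z', w', i'⟩ hq' h
      simp only [Finset.mem_coe, Finset.mem_sigma] at hq hq'
      simp only [Prod.mk.injEq, Sigma.mk.injEq] at h
      obtain ⟨rfl, rfl, h⟩ := h
      have h := eq_of_heq h
      have e₁ := (hS z hq.1 _ hq.2).2.2
      have e₂ := (hS z' hq'.1 _ hq'.2).2.2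
      simp only [hc] at e₁ e₂
      have e₃ : z i = z' i := by linarith
      have : z = z' := by
        rw [← Fin.insertNth_self_removeNth i z, ← Fin.insertNth_self_removeNth i z', h, e₃]
      rw [this]
  have hup := hbound (fun z => sliceUp u (cube (c z) (2 ^ (j + 2)))) (2 ^ (j + 2) - 1)
    fun z hz p hp => by
      have := coord_of_mem_sliceUp hp
      push_cast at this
      exact ⟨this.1, this.2.1, by linarith [this.2.2]⟩
  have hdown := hbound (fun z => sliceDown u (cube (c z) (2 ^ (j + 2)))) 0
    fun z hz p hp => by
      have := coord_of_mem_sliceDown hp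
      exact ⟨this.1, this.2.1, by linarith [this.2.2]⟩
  have h₃ : (2 ^ (j + 1)) ^ (d + 1) * m ≤
      2 * (2 * (cnt u R * ((d + 1) * (2 ^ (j + 1)) ^ d))) := by
    calc (2 ^ (j + 1)) ^ (d + 1) * m = ∑ z ∈ Z, m := by simp [hZ, card_cube]
      _ ≤ ∑ z ∈ Z, 2 * slice u (cube (c z) (2 ^ (j + 2))) := Finset.sum_le_sum h₁
      _ = 2 * (∑ z ∈ Z, (sliceUp u (cube (c z) (2 ^ (j + 2)))).card +
          ∑ z ∈ Z, (sliceDown u (cube (c z) (2 ^ (j + 2)))).card) := by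
          rw [← Finset.mul_sum, ← Finset.sum_add_distrib]
          rfl
      _ ≤ _ := by linarith
  refine Nat.le_of_mul_le_mul_left (c := (2 ^ (j + 1)) ^ d) ?_ (by positivity)
  calc _ = (2 ^ (j + 1)) ^ (d + 1) * m := by ring
    _ ≤ _ := h₃
    _ = _ := by ring

/-- The constant in the lower density bound `NoProfit.le_card_faces`. -/
def lowConst (d : ℕ) : ℕ := 4 * (2 ^ (3 * d + 6)) ^ (d + 1)

lemma lowConst_pos (d : ℕ) : 0 < lowConst d := by
  unfold lowConst
  positivity

/-- In the absence of profitable cubes, the boundary has large area near each of its faces. -/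
lemma NoProfit.le_card_faces {u : Set (Fin (d + 1) → ℤ)} {k : ℕ} (h : NoProfit u k)
    {x : Fin (d + 1) → ℤ} {i : Fin (d + 1)} (hx : IsBdry u x i) {j : ℕ} (hj : 2 ≤ j)
    (hjk : j ≤ k) : (2 ^ j) ^ d ≤
      lowConst d * (faces u (cube (fun l => x l - 2 ^ (j - 1)) (2 ^ j))).card := by
  induction j using Nat.strong_induction_on with
  | _ j ih =>
  have hpos : 0 < (faces u (cube (fun l => x l - 2 ^ (j - 1)) (2 ^ j))).card := by
    obtain ⟨j, rfl⟩ : ∃ i, j = i + 2 := ⟨j - 2, by lia⟩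
    have h2 : (1 : ℤ) ≤ 2 ^ j := one_le_pow₀ (by norm_num)
    refine Finset.card_pos.2 ⟨(x, i), mem_faces.2 ⟨mem_cube.2 fun l => ?_,
      mem_cube.2 fun l => ?_, hx⟩⟩
    · rw [show j + 2 - 1 = j + 1 by lia]
      push_cast
      simp only [pow_succ]
      constructor <;> linarith
    · rw [show j + 2 - 1 = j + 1 by lia]
      push_cast
      simp only [pow_succ, Pi.add_apply, Pi.single_apply]
      split_ifs <;> constructor <;> linarith
  rcases lt_or_ge j (3 * d + 6) with hjr | hjr
  · calc (2 ^ j) ^ d ≤ (2 ^ (3 * d + 6)) ^ d := by gcongr; norm_num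
      _ ≤ (2 ^ (3 * d + 6)) ^ (d + 1) := Nat.pow_le_pow_right (by positivity) (by lia)
      _ ≤ lowConst d * 1 := by unfold lowConst; lia
      _ ≤ _ := by gcongr; exact hpos
  by_contra! hcon
  wlog hmin : 2 * cnt u (cube (fun l => x l - 2 ^ (j - 1)) (2 ^ j)) ≤ (2 ^ j) ^ (d + 1)
    generalizing u
  · refine this h.compl (isBdry_compl.2 hx) ?_ ?_ ?_ ?_
    · simpa only [faces_compl] using ih
    · simpa only [faces_compl] using hpos
    · simpa only [faces_compl] using hcon
    · have := cnt_add_cnt_compl u (cube (fun l => x l - 2 ^ (j - 1)) (2 ^ j))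
      rw [card_cube] at this
      lia
  set m := (faces u (cube (fun l => x l - 2 ^ (j - 1)) (2 ^ j))).card with hm
  set V := cnt u (cube (fun l => x l - 2 ^ (j - 1)) (2 ^ j)) with hV
  obtain ⟨s, rfl⟩ : ∃ s, j = s + (3 * d + 6) := ⟨j - (3 * d + 6), by lia⟩
  have hV₁ : V ≤ 2 * 2 ^ (s + (3 * d + 6)) * m := cnt_le_of_minority (by positivity) hmin
  have hV₂ : 2 * V ≤ (2 ^ s) ^ (d + 1) := by
    refine Nat.le_of_mul_le_mul_left (c := lowConst d) ?_ (lowConst_pos d)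
    calc lowConst d * (2 * V) ≤ lowConst d * (2 * (2 * 2 ^ (s + (3 * d + 6)) * m)) := by gcongr
      _ = 4 * 2 ^ (s + (3 * d + 6)) * (lowConst d * m) := by ring
      _ ≤ 4 * 2 ^ (s + (3 * d + 6)) * (2 ^ (s + (3 * d + 6))) ^ d := by gcongr
      _ = lowConst d * (2 ^ s) ^ (d + 1) := by unfold lowConst; ring
  have hV₃ : V ≤ 2 * 2 ^ s * m :=
    cnt_le_of_small (by positivity) (pow_dvd_pow 2 (by lia)) hV₂
  have h₁ := h.faces_le_cnt (j := s + 3 * d + 4) (by lia) (by lia) x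
  have h₂ := ih (s + 3 * d + 4) (by lia) (by lia) (by lia)
  rw [show s + 3 * d + 4 + 2 = s + (3 * d + 6) by lia,
    show s + 3 * d + 4 + 1 = s + (3 * d + 6) - 1 by lia, ← hV] at h₁
  set m' := (faces u (cube (fun l => x l - 2 ^ (s + 3 * d + 4 - 1)) (2 ^ (s + 3 * d + 4)))).card
  have hd : d + 1 ≤ 2 ^ d := Nat.lt_two_pow_self
  have e4 : (4 : ℕ) ^ d = 2 ^ (2 * d) := by rw [show (4 : ℕ) = 2 ^ 2 by norm_num, pow_mul]
  have h₃ : 2 ^ (3 * d + 4) * (2 ^ (s + (3 * d + 6))) ^ d ≤ 2 ^ (3 * d + 4) * (lowConst d * m) := by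
    refine Nat.le_of_mul_le_mul_left (c := 2 ^ s) ?_ (by positivity)
    calc 2 ^ s * (2 ^ (3 * d + 4) * (2 ^ (s + (3 * d + 6))) ^ d)
        = 4 ^ d * 2 ^ (s + 3 * d + 4) * (2 ^ (s + 3 * d + 4)) ^ d := by
          rw [e4]
          simp only [← pow_mul, ← pow_add]
          congr 1
          ring
      _ ≤ 4 ^ d * 2 ^ (s + 3 * d + 4) * (lowConst d * m') := by gcongr
      _ = 4 ^ d * lowConst d * (2 ^ (s + 3 * d + 4) * m') := by ring
      _ ≤ 4 ^ d * lowConst d * (4 * (d + 1) * (2 * 2 ^ s * m)) := by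
          exact Nat.mul_le_mul_left _ (h₁.trans (by gcongr))
      _ ≤ 4 ^ d * lowConst d * (4 * 2 ^ d * (2 * 2 ^ s * m)) := by gcongr
      _ = 2 ^ (3 * d + 3) * 2 ^ s * (lowConst d * m) := by
          rw [e4]
          ring
      _ ≤ 2 ^ (3 * d + 4) * 2 ^ s * (lowConst d * m) := by gcongr <;> norm_num
      _ = _ := by ring
  exact absurd (Nat.le_of_mul_le_mul_left h₃ (by positivity)) (not_le.2 hcon)

/-- The set of boundary faces of `u`. -/
def bdrySet (u : Set (Fin n → ℤ)) : Set ((Fin n → ℤ) × Fin n) := {p | IsBdry u p.1 p.2}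

lemma bdrySet_compl (u : Set (Fin n → ℤ)) : bdrySet uᶜ = bdrySet u := by
  ext p
  exact isBdry_compl

lemma bdrySet_diff_subset (u : Set (Fin n → ℤ)) (Q : Finset (Fin n → ℤ)) :
    bdrySet (u \ Q) ⊆ (bdrySet u \ faces u Q) ∪ (sliceUp u Q ∪
      (fun p => (p.1 - Pi.single p.2 1, p.2)) '' (sliceDown u Q : Set ((Fin n → ℤ) × Fin n))) := by
  classical
  rintro ⟨x, i⟩ hx
  simp only [bdrySet, IsBdry, Set.mem_ofPred_eq, Set.mem_sdiff, Finset.mem_coe] at hx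
  by_cases h₁ : x ∈ Q <;> by_cases h₂ : x + Pi.single i 1 ∈ Q
  · exact absurd (by simp [h₁, h₂]) hx
  · by_cases h₃ : x ∈ u
    · right; left
      simp [sliceUp, h₁, h₂, h₃]
    · left
      refine ⟨?_, fun h => h₂ (mem_faces.1 h).2.1⟩
      simp only [bdrySet, IsBdry, Set.mem_ofPred_eq]
      simpa [h₁, h₂, h₃] using hx
  · by_cases h₃ : x + Pi.single i 1 ∈ u
    · right; right
      refine ⟨(x + Pi.single i 1, i), ?_, by simp⟩
      simp [sliceDown, h₁, h₂, h₃]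
    · left
      refine ⟨?_, fun h => h₁ (mem_faces.1 h).1⟩
      simp only [bdrySet, IsBdry, Set.mem_ofPred_eq]
      simpa [h₁, h₂, h₃] using hx
  · left
    refine ⟨?_, fun h => h₁ (mem_faces.1 h).1⟩
    simp only [bdrySet, IsBdry, Set.mem_ofPred_eq]
    simpa [h₁, h₂] using hx

lemma ncard_bdrySet_diff_add_le {u : Set (Fin n → ℤ)} (hu : (bdrySet u).Finite)
    (Q : Finset (Fin n → ℤ)) :
    (bdrySet (u \ Q)).ncard + (faces u Q).card ≤ (bdrySet u).ncard + slice u Q := by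
  have h₁ := Set.ncard_le_ncard (bdrySet_diff_subset u Q)
    ((hu.sdiff).union ((Finset.finite_toSet _).union ((Finset.finite_toSet _).image _)))
  have h₂ : (faces u Q : Set ((Fin n → ℤ) × Fin n)) ⊆ bdrySet u := fun p hp =>
    (mem_faces.1 hp).2.2
  have h₃ := Set.ncard_sdiff_add_ncard_of_subset h₂ hu
  have h₄ := Set.ncard_union_le (bdrySet u \ faces u Q) (sliceUp u Q ∪
      (fun p => (p.1 - Pi.single p.2 1, p.2)) '' (sliceDown u Q : Set ((Fin n → ℤ) × Fin n)))
  have h₅ := Set.ncard_union_le (sliceUp u Q : Set ((Fin n → ℤ) × Fin n))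
      ((fun p => (p.1 - Pi.single p.2 1, p.2)) '' (sliceDown u Q : Set ((Fin n → ℤ) × Fin n)))
  have h₆ := Set.ncard_image_le (f := fun p : (Fin n → ℤ) × Fin n => (p.1 - Pi.single p.2 1, p.2))
    (sliceDown u Q).finite_toSet
  rw [Set.ncard_coe_finset] at h₃ h₅ h₆
  rw [slice]
  lia

/-- Along a line with few switches, some downward switch is an extremum for two different
slopes of the discrepancy function. -/
lemma exists_stable_crossing (p : ℤ → Prop) [DecidablePred p] {t t' : ℤ} (htt : t < t') (ht : p t)
    (ht' : ¬ p t') {N : ℕ}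
    (hN : ((Finset.Ico t t').filter fun τ => ¬ (p τ ↔ p (τ + 1))).card ≤ N) :
    ∃ s r r' : ℤ, t < s ∧ s ≤ t' ∧ 1 ≤ r ∧ r < r' ∧ r' ≤ N + 1 ∧ p (s - 1) ∧ ¬ p s ∧
      (∀ s', s ≤ s' → s' ≤ t' →
        (N + 2) * (((Finset.Ico s s').filter p).card : ℤ) ≤ r * (s' - s)) ∧
      (∀ s', t ≤ s' → s' ≤ s →
        r' * (s - s') ≤ (N + 2) * (((Finset.Ico s' s).filter p).card : ℤ)) := by
  set c : ℤ → ℤ := fun s => (((Finset.Ico t s).filter p).card : ℤ) with hc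
  have hadd : ∀ s s', t ≤ s → s ≤ s' → c s' = c s + ((Finset.Ico s s').filter p).card := by
    intro s s' h h'
    simp only [hc]
    rw [← Finset.Ico_union_Ico_eq_Ico h h', Finset.filter_union, Finset.card_union_of_disjoint]
    · push_cast
      rfl
    · exact Finset.disjoint_filter_filter (Finset.Ico_disjoint_Ico_consecutive _ _ _)
  have hsucc : ∀ s, t ≤ s → c (s + 1) = c s + if p s then 1 else 0 := by
    intro s h
    rw [hadd s (s + 1) h (by lia)]
    congr 1
    have : Finset.Ico s (s + 1) = {s} := by ext; simp; lia
    rw [this, Finset.filter_singleton]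
    split_ifs <;> simp
  have hmax : ∀ r : ℤ, ∃ s, 1 ≤ r → r ≤ N + 1 → (t < s ∧ s ≤ t' ∧ p (s - 1) ∧ ¬ p s ∧
      ∀ s', t ≤ s' → s' ≤ t' + 1 →
        (N + 2) * c s' - r * (s' - t) ≤ (N + 2) * c s - r * (s - t)) := by
    intro r
    obtain ⟨s, hs, hsm⟩ := Finset.exists_max_image (Finset.Icc t (t' + 1))
      (fun s => (N + 2) * c s - r * (s - t)) ⟨t, by simp; lia⟩
    refine ⟨s, fun hr hr' => ?_⟩
    rw [Finset.mem_Icc] at hs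
    have hm : ∀ s', t ≤ s' → s' ≤ t' + 1 →
        (N + 2) * c s' - r * (s' - t) ≤ (N + 2) * c s - r * (s - t) :=
      fun s' h h' => hsm s' (Finset.mem_Icc.2 ⟨h, h'⟩)
    have h₁ : ∀ s', t ≤ s' → p s' → s' ≤ t' → s ≠ s' := by
      rintro s' h hp h' rfl
      have := hm (s + 1) (by lia) (by lia)
      rw [hsucc s h, if_pos hp] at this
      linarith
    have h₂ : ∀ s', t ≤ s' → ¬ p s' → s ≠ s' + 1 := by
      rintro s' h hp rfl
      have := hm s' h (by lia)
      rw [hsucc s' h, if_neg hp] at this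
      linarith
    have h₃ : t < s := lt_of_le_of_ne hs.1 (h₁ t le_rfl ht htt.le).symm
    have h₄ : s ≤ t' := by
      have := h₂ t' htt.le ht'
      lia
    refine ⟨h₃, h₄, ?_, fun h => h₁ s hs.1 h h₄ rfl, hm⟩
    by_contra h
    exact h₂ (s - 1) (by lia) h (by lia)
  choose s hs using hmax
  obtain ⟨r, hr, r', hr', hne, heq⟩ := Finset.exists_ne_map_eq_of_card_lt_of_maps_to
    (s := Finset.Icc (1 : ℤ) (N + 1))
    (t := (Finset.Ico t t').filter fun τ => ¬ (p τ ↔ p (τ + 1))) (f := fun r => s r - 1)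
    (by simp; lia) (by
      intro r hr
      simp only [Finset.coe_Icc, Set.mem_Icc] at hr
      obtain ⟨h₁, h₂, h₃, h₄, -⟩ := hs r hr.1 hr.2
      simp only [Finset.coe_filter, Finset.mem_Ico, Set.mem_ofPred_eq]
      refine ⟨⟨by lia, by lia⟩, fun h => h₄ ?_⟩
      rw [sub_add_cancel] at h
      exact h.1 h₃)
  wlog hlt : r < r' generalizing r r'
  · exact this r' hr' r hr hne.symm heq.symm (lt_of_le_of_ne (not_lt.1 hlt) hne.symm)
  have hss : s r = s r' := by simpa using heq
  rw [Finset.mem_Icc] at hr hr'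
  obtain ⟨h₁, h₂, h₃, h₄, h₅⟩ := hs r hr.1 hr.2
  obtain ⟨-, -, -, -, h₆⟩ := hs r' hr'.1 hr'.2
  rw [← hss] at h₆
  refine ⟨s r, r, r', h₁, h₂, hr.1, hlt, hr'.2, h₃, h₄, fun s' hs' hs'' => ?_,
    fun s' hs' hs'' => ?_⟩
  · have := h₅ s' (by lia) (by lia)
    rw [hadd (s r) s' h₁.le hs'] at this
    linarith
  · have := h₆ s' hs' (by lia)
    rw [hadd s' (s r) hs' hs''] at this
    linarith

lemma cnt_pos {u : Set (Fin n → ℤ)} {Q : Finset (Fin n → ℤ)} {x : Fin n → ℤ} (hx : x ∈ Q)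
    (hxu : x ∈ u) : 0 < cnt u Q :=
  Finset.card_pos.2 ⟨x, by simp [hx, hxu]⟩

lemma insertNth_add_single (i : Fin (d + 1)) (τ : ℤ) (y : Fin d → ℤ) (l : Fin d) :
    (i.insertNth τ y : Fin (d + 1) → ℤ) + Pi.single (i.succAbove l) 1 =
      i.insertNth τ (y + Pi.single l 1) := by
  funext l'
  rcases Fin.eq_self_or_eq_succAbove i l' with rfl | ⟨m, rfl⟩
  · simp [Fin.ne_succAbove]
  · simp [Pi.single_apply]

lemma insertNth_add_single_self (i : Fin (d + 1)) (τ : ℤ) (y : Fin d → ℤ) :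
    (i.insertNth τ y : Fin (d + 1) → ℤ) + Pi.single i 1 = i.insertNth (τ + 1) y := by
  funext l'
  rcases Fin.eq_self_or_eq_succAbove i l' with rfl | ⟨m, rfl⟩
  · simp
  · simp [Fin.succAbove_ne]

/-- If two points at height `τ` have different colours, then there is a boundary face at
height `τ` close to them. -/
lemma exists_face_at_height {u : Set (Fin (d + 1) → ℤ)} {i : Fin (d + 1)} {τ : ℤ}
    {y y' : Fin d → ℤ} {D : ℕ} (hD : ∀ l, |y l - y' l| ≤ D)
    (h : ¬ ((i.insertNth τ y : Fin (d + 1) → ℤ) ∈ u ↔ i.insertNth τ y' ∈ u)) :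
    ∃ w : Fin (d + 1) → ℤ, ∃ l, IsBdry u w l ∧ w i = τ ∧ ∀ m, |i.removeNth w m - y m| ≤ D := by
  classical
  set U : Set (Fin d → ℤ) := {z | (i.insertNth τ z : Fin (d + 1) → ℤ) ∈ u} with hU
  set c : Fin d → ℤ := fun l => min (y l) (y' l)
  have hy : y ∈ cube c (D + 1) := mem_cube.2 fun l => by
    have := abs_le.1 (hD l)
    simp only [c]
    push_cast
    constructor
    · exact min_le_left _ _
    · rcases min_cases (y l) (y' l) with h | h <;> lia
  have hy' : y' ∈ cube c (D + 1) := mem_cube.2 fun l => by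
    have := abs_le.1 (hD l)
    simp only [c]
    push_cast
    constructor
    · exact min_le_right _ _
    · rcases min_cases (y l) (y' l) with h | h <;> lia
  have hpos : 0 < cnt U (cube c (D + 1)) * cnt Uᶜ (cube c (D + 1)) := by
    by_cases h₁ : (i.insertNth τ y : Fin (d + 1) → ℤ) ∈ u
    · have h₂ : (i.insertNth τ y' : Fin (d + 1) → ℤ) ∉ u := fun h₂ => h (iff_of_true h₁ h₂)
      exact Nat.mul_pos (cnt_pos hy h₁) (cnt_pos hy' h₂)
    · have h₂ : (i.insertNth τ y' : Fin (d + 1) → ℤ) ∈ u :=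
        by_contra fun h₂ => h (iff_of_false h₁ h₂)
      exact Nat.mul_pos (cnt_pos hy' h₂) (cnt_pos hy h₁)
  have hf := Nat.pos_of_mul_pos_left (hpos.trans_le (cnt_mul_cnt_compl_le U c (D + 1)))
  obtain ⟨⟨w, l⟩, hw⟩ := Finset.card_pos.1 hf
  obtain ⟨hw₁, -, hw₂⟩ := mem_faces.1 hw
  refine ⟨i.insertNth τ w, i.succAbove l, ?_, by simp, fun m => ?_⟩
  · rw [IsBdry, insertNth_add_single]
    exact hw₂
  · have h₁ := mem_cube.1 hw₁ m
    have h₂ := mem_cube.1 hy m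
    rw [Fin.removeNth_insertNth, abs_le]
    push_cast at h₁ h₂
    constructor <;> lia

/-- The faces of `u` in the cube five times as large as `cube a (2 ^ j)`. -/
lemma NoProfit.card_faces_quintuple_le {u : Set (Fin (d + 1) → ℤ)} {k j : ℕ} (h : NoProfit u k)
    (hj : 2 ≤ j) (hjk : j ≤ k) (a : Fin (d + 1) → ℤ) :
    (faces u (cube (fun l => a l - 2 * 2 ^ j) (5 * 2 ^ j))).card ≤
      10 ^ (d + 1) * (4 * (d + 1)) * (2 ^ j) ^ d := by
  classical
  obtain ⟨j, rfl⟩ : ∃ i, j = i + 1 := ⟨j - 1, by lia⟩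
  set b : Fin (d + 1) → ℤ := fun l => a l - 2 * 2 ^ (j + 1)
  have hsub : faces u (cube b (5 * 2 ^ (j + 1))) ⊆
      (cube (0 : Fin (d + 1) → ℤ) 10).biUnion fun c =>
        faces u (cube (fun l => b l + 2 ^ j * c l) (2 ^ (j + 1))) := by
    rintro ⟨x, i⟩ hx
    rw [mem_faces] at hx
    have h2 : (2 : ℤ) ≤ 2 ^ j := by
      calc (2 : ℤ) = 2 ^ 1 := by norm_num
        _ ≤ 2 ^ j := pow_le_pow_right₀ (by norm_num) (by lia)
    have hx' := mem_cube.1 hx.1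
    have e : ∀ l, 2 ^ j * ((x l - b l) / 2 ^ j) ≤ x l - b l ∧
        x l - b l < 2 ^ j * ((x l - b l) / 2 ^ j) + 2 ^ j := by
      intro l
      have h₁ := Int.emod_add_mul_ediv (x l - b l) (2 ^ j)
      have h₂ := Int.emod_nonneg (x l - b l) (by positivity : (2 : ℤ) ^ j ≠ 0)
      have h₃ := Int.emod_lt_of_pos (x l - b l) (by positivity : (0 : ℤ) < 2 ^ j)
      constructor <;> linarith
    refine Finset.mem_biUnion.2 ⟨fun l => (x l - b l) / 2 ^ j, mem_cube.2 fun l => ?_,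
      mem_faces.2 ⟨mem_cube.2 fun l => ?_, mem_cube.2 fun l => ?_, hx.2.2⟩⟩
    · have := hx' l
      push_cast [pow_succ] at this
      constructor
      · exact Int.ediv_nonneg (by linarith) (by positivity)
      · simp only [Pi.zero_apply, zero_add]
        push_cast
        exact Int.ediv_lt_of_lt_mul (by positivity) (by linarith)
    · have := e l
      push_cast [pow_succ]
      constructor <;> linarith
    · have := e l
      push_cast [pow_succ]
      simp only [Pi.add_apply, Pi.single_apply]
      split_ifs <;> constructor <;> linarith
  refine (Finset.card_le_card hsub).trans (Finset.card_biUnion_le.trans ?_)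
  refine (Finset.sum_le_card_nsmul _ _ (4 * (d + 1) * (2 ^ (j + 1)) ^ d)
    fun c _ => h.card_faces_le hjk _).trans (le_of_eq ?_)
  rw [card_cube, smul_eq_mul]
  ring

/-- If `u` has different colours above `y` and `y'` at the heights `T`, there is a large boundary
near `y`. -/
lemma NoProfit.card_le_card_faces_near {u : Set (Fin (d + 1) → ℤ)} {k j g : ℕ}
    (h : NoProfit u k) (hg : 2 ≤ g) (hgj : g ≤ j) (hjk : j ≤ k) {a : Fin (d + 1) → ℤ}
    {i : Fin (d + 1)} {y y' : Fin d → ℤ} (hy : y ∈ cube (i.removeNth a) (2 ^ j)) {D : ℕ} (hD : ∀ l, |y l - y' l| ≤ D)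
    (hDg : D ≤ 2 ^ g)
    {T : Finset ℤ} (hT : ∀ τ ∈ T, a i ≤ τ ∧ τ < a i + 2 ^ j ∧
      ¬ ((i.insertNth τ y : Fin (d + 1) → ℤ) ∈ u ↔ i.insertNth τ y' ∈ u)) :
    T.card * (2 ^ g) ^ d ≤ lowConst d * (2 ^ g * ((faces u
      (cube (fun l => a l - 2 * 2 ^ j) (5 * 2 ^ j))).filter
        fun p => ∀ l, |i.removeNth p.1 l - y l| ≤ 2 * 2 ^ g).card) := by
  classical
  set M := (faces u (cube (fun l => a l - 2 * 2 ^ j) (5 * 2 ^ j))).filter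
        fun p => ∀ l, |i.removeNth p.1 l - y l| ≤ 2 * 2 ^ g with hM
  have hw : ∀ τ ∈ T, ∃ w : Fin (d + 1) → ℤ, ∃ l, IsBdry u w l ∧ w i = τ ∧
      ∀ m, |i.removeNth w m - y m| ≤ D := fun τ hτ => exists_face_at_height hD (hT τ hτ).2.2
  choose! w l hw using hw
  obtain ⟨g, rfl⟩ : ∃ f, g = f + 1 := ⟨g - 1, by lia⟩
  have hgj' : (2 : ℤ) ^ (g + 1) ≤ 2 ^ j := pow_le_pow_right₀ (by norm_num) hgj
  have hDg' : (D : ℤ) ≤ 2 ^ (g + 1) := by exact_mod_cast hDg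
  set S : ℤ → Finset ((Fin (d + 1) → ℤ) × Fin (d + 1)) :=
    fun τ => faces u (cube (fun m => w τ m - 2 ^ g) (2 ^ (g + 1))) with hS
  have hSp : ∀ τ ∈ T, ∀ p ∈ S τ, ∀ x, x = p.1 ∨ x = p.1 + Pi.single p.2 1 →
      ∀ m, w τ m - 2 ^ g ≤ x m ∧ x m < w τ m + 2 ^ g := by
    rintro τ hτ p hp x hx m
    have hp := mem_faces.1 hp
    have : x ∈ cube (fun m => w τ m - 2 ^ g) (2 ^ (g + 1)) := by
      rcases hx with rfl | rfl
      exacts [hp.1, hp.2.1]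
    have := mem_cube.1 this m
    push_cast [pow_succ] at this
    constructor <;> linarith
  have h₁ : ∀ τ ∈ T, (2 ^ (g + 1)) ^ d ≤ lowConst d * (S τ).card := by
    intro τ hτ
    have := h.le_card_faces (hw τ hτ).1 hg (hgj.trans hjk)
    simpa using this
  have hbig : ∀ τ ∈ T, ∀ p ∈ S τ, ∀ x, x = p.1 ∨ x = p.1 + Pi.single p.2 1 →
      x ∈ cube (fun l => a l - 2 * 2 ^ j) (5 * 2 ^ j) := by
    intro τ hτ p hp x hx
    refine mem_cube.2 fun m => ?_
    have h₂ := hSp τ hτ p hp x hx m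
    push_cast
    rcases Fin.eq_self_or_eq_succAbove i m with rfl | ⟨m, rfl⟩
    · have h₃ := (hw τ hτ).2.1
      have h₄ := hT τ hτ
      rw [pow_succ] at hgj'
      constructor <;> linarith
    · have h₃ := abs_le.1 ((hw τ hτ).2.2 m)
      have h₄ := mem_cube.1 hy m
      simp only [Fin.removeNth] at h₃ h₄
      push_cast at h₄
      rw [pow_succ] at hgj' hDg'
      constructor <;> linarith
  have h₂ : ∑ τ ∈ T, (S τ).card ≤ 2 ^ (g + 1) * M.card := by
    have e : 2 ^ (g + 1) * M.card = (M ×ˢ Finset.Ico (-2 ^ g : ℤ) (2 ^ g)).card := by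
      rw [Finset.card_product, Int.card_Ico, mul_comm]
      congr 1
      have : (2 : ℤ) ^ g - -2 ^ g = ((2 ^ (g + 1) : ℕ) : ℤ) := by push_cast [pow_succ]; ring
      rw [this, Int.toNat_natCast]
    rw [e, ← Finset.card_sigma]
    refine Finset.card_le_card_of_injOn (fun q => (q.2, q.2.1 i - q.1)) ?_ ?_
    · rintro ⟨τ, p⟩ hq
      simp only [Finset.mem_coe, Finset.mem_sigma] at hq
      obtain ⟨hτ, hp⟩ := hq
      have hp' := hSp τ hτ p hp p.1 (Or.inl rfl)
      simp only [Finset.coe_product, Set.mem_prod, Finset.mem_coe, hM, Finset.mem_filter,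
        Finset.mem_Ico]
      refine ⟨⟨mem_faces.2 ⟨hbig τ hτ p hp _ (Or.inl rfl), hbig τ hτ p hp _ (Or.inr rfl),
        (mem_faces.1 hp).2.2⟩, fun m => ?_⟩, ?_⟩
      · have h₃ := abs_le.1 ((hw τ hτ).2.2 m)
        have h₄ := hp' (i.succAbove m)
        simp only [Fin.removeNth] at h₃ ⊢
        rw [pow_succ] at hDg' ⊢
        rw [abs_le]
        constructor <;> linarith
      · have h₃ := (hw τ hτ).2.1
        have h₄ := hp' i
        constructor <;> linarith
    · rintro ⟨τ, p⟩ - ⟨τ', p'⟩ - h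
      simp only [Prod.mk.injEq] at h
      obtain ⟨rfl, h⟩ := h
      have : τ = τ' := by linarith
      rw [this]
  calc T.card * (2 ^ (g + 1)) ^ d = ∑ τ ∈ T, (2 ^ (g + 1)) ^ d := by simp
    _ ≤ ∑ τ ∈ T, lowConst d * (S τ).card := Finset.sum_le_sum h₁
    _ = lowConst d * ∑ τ ∈ T, (S τ).card := by rw [Finset.mul_sum]
    _ ≤ _ := by gcongr

/-- `F` is `L`-Lipschitz for the supremum distance. -/
def IsLip (L : ℕ) (F : (Fin d → ℤ) → ℤ) : Prop :=
  ∀ (x y : Fin d → ℤ) (D : ℕ), (∀ l, |x l - y l| ≤ D) → |F x - F y| ≤ L * D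

lemma exists_isLip_extension {L : ℕ} {S : Finset (Fin d → ℤ)} (hS : S.Nonempty)
    {f : (Fin d → ℤ) → ℤ} {lo hi : ℤ}
    (hf : ∀ x ∈ S, ∀ y ∈ S, ∀ D : ℕ, (∀ l, |x l - y l| ≤ D) → |f x - f y| ≤ L * D)
    (hlo : ∀ x ∈ S, lo ≤ f x) (hhi : ∀ x ∈ S, f x ≤ hi) :
    ∃ F, IsLip L F ∧ (∀ x ∈ S, F x = f x) ∧ ∀ x, lo ≤ F x ∧ F x ≤ hi := by
  set dst : (Fin d → ℤ) → (Fin d → ℤ) → ℕ := fun x y => Finset.univ.sup fun l => (x l - y l).natAbs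
    with hdst
  have hle : ∀ (x y : Fin d → ℤ) (l : Fin d), |x l - y l| ≤ (dst x y : ℤ) := by
    intro x y l
    have := Finset.le_sup (f := fun l => (x l - y l).natAbs) (Finset.mem_univ l)
    rw [Int.abs_eq_natAbs]
    exact_mod_cast this
  have htri : ∀ (x y z : Fin d → ℤ) (D : ℕ), (∀ l, |x l - y l| ≤ (D : ℤ)) → dst x z ≤ D + dst y z := by
    intro x y z D h
    refine Finset.sup_le fun l _ => ?_
    have h₁ := h l
    have h₂ := hle y z l
    have h₃ := abs_sub_le (x l) (y l) (z l)
    zify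
    linarith
  have hxx : ∀ x, dst x x = 0 := by
    intro x
    simp [hdst]
  set G : (Fin d → ℤ) → ℤ := fun x => S.inf' hS fun y => f y + L * dst x y with hG
  have hGle : ∀ (x y : Fin d → ℤ) (D : ℕ), (∀ l, |x l - y l| ≤ (D : ℤ)) → G x ≤ G y + L * D := by
    intro x y D h
    obtain ⟨z, hz, hGz⟩ := Finset.exists_mem_eq_inf' hS fun z => f z + L * dst y z
    have h₁ : G x ≤ f z + L * dst x z := Finset.inf'_le (fun z => f z + L * dst x z) hz
    have h₂ : G y = f z + L * dst y z := hGz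
    have h₃ : (L : ℤ) * dst x z ≤ L * (D + dst y z) := by
      gcongr
      exact_mod_cast htri x y z D h
    rw [h₂]
    linarith
  have hlo' : ∀ x ∈ S, lo ≤ hi := fun x hx => (hlo x hx).trans (hhi x hx)
  obtain ⟨x₀, hx₀⟩ := id hS
  have hlohi := hlo' x₀ hx₀
  refine ⟨fun x => min hi (G x), ?_, ?_, ?_⟩
  · intro x y D h
    have h' : ∀ l, |y l - x l| ≤ D := fun l => by rw [abs_sub_comm]; exact h l
    have h₁ := hGle x y D h
    have h₂ := hGle y x D h'
    have h₃ : (0 : ℤ) ≤ L * D := by positivity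
    rw [abs_le]
    rcases min_cases hi (G x) with h₄ | h₄ <;> rcases min_cases hi (G y) with h₅ | h₅ <;>
      constructor <;> linarith
  · intro x hx
    have h₁ : G x ≤ f x := by
      have := Finset.inf'_le (fun z => f z + L * dst x z) hx
      simpa [hxx] using this
    have h₂ : f x ≤ G x := by
      refine Finset.le_inf' hS _ fun y hy => ?_
      have := hf x hx y hy (dst x y) (hle x y)
      have := (abs_le.1 this).2
      linarith
    have := hhi x hx
    change min hi (G x) = f x
    rw [le_antisymm h₁ h₂]
    exact min_eq_right this
  · intro x
    refine ⟨le_min hlohi (Finset.le_inf' hS _ fun y hy => ?_), min_le_left _ _⟩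
    have := hlo y hy
    have : (0 : ℤ) ≤ L * dst x y := by positivity
    linarith

/-- A Vitali-type maximal estimate on the integer lattice. -/
lemma card_le_of_forall_ball {α : Type*} {B : Finset (Fin d → ℤ)} {M : Finset α}
    (π : α → Fin d → ℤ) (r : (Fin d → ℤ) → ℕ) (hr : ∀ y ∈ B, 0 < r y) (A K : ℕ)
    (hB : ∀ y ∈ B, A * r y ^ d ≤ K * (M.filter fun p => ∀ l, |π p l - y l| ≤ r y).card) :
    A * B.card ≤ 11 ^ d * K * M.card := by
  classical
  obtain ⟨u, huB, hdisj, hcov⟩ := Vitali.exists_disjoint_subfamily_covering_enlargement_closedBall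
    (B : Set (Fin d → ℤ)) id (fun y => (r y : ℝ)) ((B.sup r : ℕ) : ℝ)
    (fun y hy => by exact_mod_cast Finset.le_sup (f := r) hy) 5 (by norm_num)
  have hufin : u.Finite := B.finite_toSet.subset huB
  lift u to Finset (Fin d → ℤ) using hufin
  have hball : ∀ (x y : Fin d → ℤ) (m : ℕ),
      x ∈ Metric.closedBall y (m : ℝ) ↔ ∀ l, |x l - y l| ≤ m := by
    intro x y m
    rw [Metric.mem_closedBall, dist_pi_le_iff (by positivity)]
    refine forall_congr' fun l => ?_
    rw [Int.dist_eq]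
    exact_mod_cast Iff.rfl
  have h₁ : B ⊆ u.biUnion fun y => cube (fun l => y l - 5 * r y) (11 * r y) := by
    intro x hx
    obtain ⟨y, hy, hxy⟩ := hcov x hx
    have h₂ : x ∈ Metric.closedBall y ((5 * r y : ℕ) : ℝ) := by
      push_cast
      exact hxy (Metric.mem_closedBall_self (by positivity))
    refine Finset.mem_biUnion.2 ⟨y, hy, mem_cube.2 fun l => ?_⟩
    have h₃ := abs_le.1 ((hball _ _ _).1 h₂ l)
    have h₄ : (1 : ℤ) ≤ r y := by exact_mod_cast hr y (huB hy)
    push_cast at h₃ ⊢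
    constructor <;> linarith
  have h₂ : ∑ y ∈ u, (M.filter fun p => ∀ l, |π p l - y l| ≤ r y).card ≤ M.card := by
    rw [← Finset.card_biUnion]
    · exact Finset.card_le_card (Finset.biUnion_subset.2 fun y _ => Finset.filter_subset _ _)
    · intro y hy z hz hyz
      refine Finset.disjoint_left.2 fun p hp hp' => ?_
      exact Set.disjoint_left.1 (hdisj hy hz hyz) ((hball _ _ _).2 (Finset.mem_filter.1 hp).2)
        ((hball _ _ _).2 (Finset.mem_filter.1 hp').2)
  calc A * B.card ≤ A * ∑ y ∈ u, (11 * r y) ^ d := by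
        gcongr
        refine (Finset.card_le_card h₁).trans (Finset.card_biUnion_le.trans (le_of_eq ?_))
        simp [card_cube]
    _ = 11 ^ d * ∑ y ∈ u, A * r y ^ d := by
        simp only [Finset.mul_sum]
        exact Finset.sum_congr rfl fun y _ => by ring
    _ ≤ 11 ^ d * ∑ y ∈ u, K * (M.filter fun p => ∀ l, |π p l - y l| ≤ r y).card :=
        Nat.mul_le_mul_left _ (Finset.sum_le_sum fun y hy => hB y (huB hy))
    _ = 11 ^ d * K * ∑ y ∈ u, (M.filter fun p => ∀ l, |π p l - y l| ≤ r y).card := by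
        rw [← Finset.mul_sum]; ring
    _ ≤ _ := by gcongr

lemma exists_separated_levels (u : Set (Fin (d + 1) → ℤ)) (a : Fin (d + 1) → ℤ) {s Θ : ℕ}
    (hs : 0 < s)
    (h : s ^ (2 * d + 2) ≤ Θ * (cnt u (cube a s) * cnt uᶜ (cube a s))) :
    ∃ v, (v = u ∨ v = uᶜ) ∧ ∃ (i : Fin (d + 1)) (t t' : ℤ), a i ≤ t ∧ t < t' ∧ t' < a i + s ∧
      ∃ W ⊆ cube (i.removeNth a) s, s ^ d ≤ 2 * Θ * (d + 1) * W.card ∧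
        ∀ y ∈ W, (i.insertNth t y : Fin (d + 1) → ℤ) ∈ v ∧
          (i.insertNth t' y : Fin (d + 1) → ℤ) ∉ v := by
  classical
  obtain ⟨i, t, t', ht, ht', hW⟩ := exists_levels u a hs
  set W := (cube (i.removeNth a) s).filter fun y =>
    ¬ ((i.insertNth t y : Fin (d + 1) → ℤ) ∈ u ↔ i.insertNth t' y ∈ u) with hWdef
  have hcard : s ^ d ≤ Θ * (d + 1) * W.card := by
    have h₁ : s ^ (d + 2) * s ^ d ≤ s ^ (d + 2) * (Θ * (d + 1) * W.card) := by
      calc s ^ (d + 2) * s ^ d = s ^ (2 * d + 2) := by rw [← pow_add]; congr 1; ring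
        _ ≤ _ := h
        _ ≤ Θ * ((d + 1) * s ^ (d + 2) * W.card) := by gcongr
        _ = _ := by ring
    exact Nat.le_of_mul_le_mul_left h₁ (by positivity)
  set W₁ := W.filter fun y => (i.insertNth t y : Fin (d + 1) → ℤ) ∈ u with hW₁
  set W₂ := W.filter fun y => ¬ (i.insertNth t y : Fin (d + 1) → ℤ) ∈ u with hW₂
  have hsum : W₁.card + W₂.card = W.card := Finset.card_filter_add_card_filter_not _
  have hsub₁ : W₁ ⊆ cube (i.removeNth a) s :=
    (Finset.filter_subset _ _).trans (Finset.filter_subset _ _)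
  have hsub₂ : W₂ ⊆ cube (i.removeNth a) s :=
    (Finset.filter_subset _ _).trans (Finset.filter_subset _ _)
  have hm₁ : ∀ y ∈ W₁, (i.insertNth t y : Fin (d + 1) → ℤ) ∈ u ∧
      (i.insertNth t' y : Fin (d + 1) → ℤ) ∉ u := by
    intro y hy
    simp only [hW₁, hWdef, Finset.mem_filter] at hy
    tauto
  have hm₂ : ∀ y ∈ W₂, (i.insertNth t y : Fin (d + 1) → ℤ) ∉ u ∧
      (i.insertNth t' y : Fin (d + 1) → ℤ) ∈ u := by
    intro y hy
    simp only [hW₂, hWdef, Finset.mem_filter] at hy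
    tauto
  have hne : t ≠ t' := by
    rintro rfl
    have : W = ∅ := by simp [hWdef]
    rw [this] at hcard
    have : 0 < s ^ d := by positivity
    simp at hcard
    lia
  have hle : W.card ≤ 2 * W₁.card ∨ W.card ≤ 2 * W₂.card := by lia
  rcases hle with hle | hle
  · have hc : s ^ d ≤ 2 * Θ * (d + 1) * W₁.card := by
      calc s ^ d ≤ _ := hcard
        _ ≤ Θ * (d + 1) * (2 * W₁.card) := by gcongr
        _ = _ := by ring
    rcases lt_or_gt_of_ne hne with hlt | hlt
    · exact ⟨u, Or.inl rfl, i, t, t', ht.1, hlt, ht'.2, W₁, hsub₁, hc, hm₁⟩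
    · exact ⟨uᶜ, Or.inr rfl, i, t', t, ht'.1, hlt, ht.2, W₁, hsub₁, hc,
        fun y hy => ⟨(hm₁ y hy).2, not_not.2 (hm₁ y hy).1⟩⟩
  · have hc : s ^ d ≤ 2 * Θ * (d + 1) * W₂.card := by
      calc s ^ d ≤ _ := hcard
        _ ≤ Θ * (d + 1) * (2 * W₂.card) := by gcongr
        _ = _ := by ring
    rcases lt_or_gt_of_ne hne with hlt | hlt
    · exact ⟨uᶜ, Or.inr rfl, i, t, t', ht.1, hlt, ht'.2, W₂, hsub₂, hc,
        fun y hy => ⟨(hm₂ y hy).1, not_not.2 (hm₂ y hy).2⟩⟩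
    · exact ⟨u, Or.inl rfl, i, t', t, ht'.1, hlt, ht.2, W₂, hsub₂, hc,
        fun y hy => (hm₂ y hy).symm⟩

/-- Most lines that cross the boundary do so only a bounded number of times. -/
lemma exists_few_crossings {v : Set (Fin (d + 1) → ℤ)} {a : Fin (d + 1) → ℤ} {s P : ℕ}
    [DecidablePred (· ∈ v)]
    {i : Fin (d + 1)} {t t' : ℤ} (ht : a i ≤ t) (ht' : t' < a i + s)
    (hm : (faces v (cube a s)).card ≤ 4 * (d + 1) * s ^ d)
    {W : Finset (Fin d → ℤ)} (hW : W ⊆ cube (i.removeNth a) s) (hc : s ^ d ≤ P * W.card) :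
    ∃ W' ⊆ W, W.card ≤ 2 * W'.card ∧ ∀ y ∈ W', ((Finset.Ico t t').filter fun τ =>
      ¬ ((i.insertNth τ y : Fin (d + 1) → ℤ) ∈ v ↔ i.insertNth (τ + 1) y ∈ v)).card ≤
        8 * (d + 1) * P := by
  classical
  set X : (Fin d → ℤ) → ℕ := fun y => ((Finset.Ico t t').filter fun τ =>
      ¬ ((i.insertNth τ y : Fin (d + 1) → ℤ) ∈ v ↔ i.insertNth (τ + 1) y ∈ v)).card with hX
  have hsum : ∑ y ∈ W, X y ≤ (faces v (cube a s)).card := by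
    simp only [hX]
    rw [← Finset.card_sigma]
    refine Finset.card_le_card_of_injOn (fun p => (i.insertNth p.2 p.1, i)) ?_ ?_
    · rintro ⟨y, τ⟩ hp
      simp only [Finset.coe_sigma, Set.mem_sigma_iff, Finset.mem_coe, Finset.mem_filter,
        Finset.mem_Ico] at hp
      refine mem_faces.2 ⟨insertNth_mem_cube.2 ⟨⟨by lia, by lia⟩, hW hp.1⟩, ?_, ?_⟩
      · rw [insertNth_add_single_self]
        exact insertNth_mem_cube.2 ⟨⟨by lia, by lia⟩, hW hp.1⟩
      · rw [IsBdry, insertNth_add_single_self]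
        exact hp.2.2
    · rintro ⟨y, τ⟩ - ⟨y', τ'⟩ - h
      simp only [Prod.mk.injEq, and_true] at h
      have := Fin.insertNth_injective2 h
      simp [this.1, this.2]
  refine ⟨W.filter fun y => X y ≤ 8 * (d + 1) * P, Finset.filter_subset _ _, ?_,
    fun y hy => (Finset.mem_filter.1 hy).2⟩
  have h₁ := Finset.card_filter_add_card_filter_not (s := W) (fun y => X y ≤ 8 * (d + 1) * P)
  have h₂ : (W.filter fun y => ¬ X y ≤ 8 * (d + 1) * P).card * (8 * (d + 1) * P + 1) ≤
      ∑ y ∈ W, X y := by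
    calc _ ≤ ∑ y ∈ W.filter fun y => ¬ X y ≤ 8 * (d + 1) * P, X y := by
          rw [← smul_eq_mul]
          exact Finset.card_nsmul_le_sum _ _ _ fun y hy => by
            have := (Finset.mem_filter.1 hy).2
            lia
      _ ≤ _ := Finset.sum_le_sum_of_subset (Finset.filter_subset _ _)
  set b := (W.filter fun y => ¬ X y ≤ 8 * (d + 1) * P).card
  have h₃ : b * (8 * (d + 1) * P + 1) ≤ 4 * (d + 1) * (P * W.card) :=
    h₂.trans (hsum.trans (hm.trans (by gcongr)))
  have h₄ : 2 * b ≤ W.card := by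
    by_contra hlt
    push Not at hlt
    have : 4 * (d + 1) * P * W.card ≤ 4 * (d + 1) * P * (2 * b) := by gcongr
    have hb : 0 < b := by lia
    nlinarith
  lia

lemma card_sub_le_of_stable {p p' : ℤ → Prop} [DecidablePred p] [DecidablePred p']
    {s s' r r' J : ℤ} (hr : r < r') (hss : s ≤ s')
    (h₁ : J * (((Finset.Ico s s').filter p).card : ℤ) ≤ r * (s' - s))
    (h₂ : r' * (s' - s) ≤ J * (((Finset.Ico s s').filter p').card : ℤ)) (hJ : 0 ≤ J) :
    s' - s ≤ J * (((Finset.Ico s s').filter fun τ => ¬ (p τ ↔ p' τ)).card : ℤ) := by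
  have h₃ : ((Finset.Ico s s').filter p').card ≤ ((Finset.Ico s s').filter p).card +
      ((Finset.Ico s s').filter fun τ => ¬ (p τ ↔ p' τ)).card := by
    classical
    refine (Finset.card_le_card fun τ hτ => ?_).trans (Finset.card_union_le _ _)
    simp only [Finset.mem_union, Finset.mem_filter] at hτ ⊢
    tauto
  have h₄ : J * (((Finset.Ico s s').filter p').card : ℤ) ≤
      J * (((Finset.Ico s s').filter p).card +
      ((Finset.Ico s s').filter fun τ => ¬ (p τ ↔ p' τ)).card) := by
    gcongr
    exact_mod_cast h₃
  nlinarith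

/-- Discarding few lines makes the chosen crossing heights Lipschitz. -/
lemma exists_lipschitz_subset {v : Set (Fin (d + 1) → ℤ)} {k j : ℕ} (h : NoProfit v k)
    (hj : 2 ≤ j) (hjk : j ≤ k) {a : Fin (d + 1) → ℤ} {i : Fin (d + 1)} {f : (Fin d → ℤ) → ℤ}
    {S : Finset (Fin d → ℤ)} (hS : S ⊆ cube (i.removeNth a) (2 ^ j)) {J R : ℕ}
    (hR : (2 ^ j) ^ d ≤ R * S.card) [DecidablePred (· ∈ v)]
    (hf : ∀ y ∈ S, a i < f y ∧ f y < a i + 2 ^ j)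
    (hst : ∀ y ∈ S, ∀ y' ∈ S, f y ≤ f y' → f y' - f y ≤ J * (((Finset.Ico (f y) (f y')).filter
      fun τ => ¬ ((i.insertNth τ y : Fin (d + 1) → ℤ) ∈ v ↔ i.insertNth τ y' ∈ v)).card : ℤ)) :
    ∃ S' ⊆ S, S.card ≤ 2 * S'.card ∧ ∀ x ∈ S', ∀ y ∈ S', ∀ D : ℕ, (∀ l, |x l - y l| ≤ D) →
      |f x - f y| ≤ (2 * (11 ^ d * (2 ^ d * (4 * J * lowConst d)) *
        (10 ^ (d + 1) * (4 * (d + 1)) * R) + 1) : ℕ) * D := by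
  classical
  obtain ⟨K₁, hK₁⟩ : ∃ K₁, K₁ = 2 ^ d * (4 * J * lowConst d) := ⟨_, rfl⟩
  obtain ⟨K₂, hK₂⟩ : ∃ K₂, K₂ = 10 ^ (d + 1) * (4 * (d + 1)) := ⟨_, rfl⟩
  obtain ⟨c, hc⟩ : ∃ c, c = 11 ^ d * K₁ * (K₂ * R) := ⟨_, rfl⟩
  obtain ⟨L, hL⟩ : ∃ L, L = 2 * (c + 1) := ⟨_, rfl⟩
  rw [← hK₁, ← hK₂, ← hc, ← hL]
  set B := S.filter fun y => ∃ y' ∈ S, ∃ D : ℕ, (∀ l, |y l - y' l| ≤ D) ∧ L * D < |f y - f y'|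
    with hB
  set M := faces v (cube (fun l => a l - 2 * 2 ^ j) (5 * 2 ^ j)) with hM
  have hM' : M.card ≤ K₂ * (2 ^ j) ^ d := hK₂ ▸
    h.card_faces_quintuple_le hj hjk a
  have hbad : ∀ y ∈ B, ∃ g : ℕ, L * (2 * 2 ^ g) ^ d ≤ K₁ *
      (M.filter fun p => ∀ l, |i.removeNth p.1 l - y l| ≤ ((2 * 2 ^ g : ℕ) : ℤ)).card := by
    intro y hy
    obtain ⟨hyS, y', hyS', D, hD, hlt⟩ := Finset.mem_filter.1 hy
    have hf₁ := hf y hyS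
    have hf₂ := hf y' hyS'
    have hfl : |f y - f y'| < 2 ^ j := by
      rw [abs_lt]
      constructor <;> lia
    have hDpos : 0 < D := by
      rcases Nat.eq_zero_or_pos D with rfl | hpos
      · have : y = y' := funext fun l => by
          have := hD l
          rw [Nat.cast_zero, abs_nonpos_iff] at this
          linarith
        subst this
        simp at hlt
      · exact hpos
    have hDlt : D < 2 ^ j := by
      have h₁ : (L * D : ℤ) < 2 ^ j := hlt.trans hfl
      have h₂ : 1 ≤ L := by lia
      have h₃ : L * D < 2 ^ j := by exact_mod_cast h₁
      nlinarith
    obtain ⟨g, hg, hgj, hDg, hgD⟩ : ∃ g, 2 ≤ g ∧ g ≤ j ∧ D ≤ 2 ^ g ∧ 2 ^ g ≤ 4 * D := by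
      refine ⟨max 2 (Nat.clog 2 D), le_max_left _ _, max_le hj ?_, ?_, ?_⟩
      · exact Nat.clog_le_of_le_pow hDlt.le
      · exact (Nat.le_pow_clog one_lt_two D).trans
          (Nat.pow_le_pow_right (by norm_num) (le_max_right _ _))
      · rcases max_cases 2 (Nat.clog 2 D) with h₁ | h₁
        · rw [h₁.1]; lia
        · rw [h₁.1]
          have h₂ : 2 ^ (Nat.clog 2 D).pred < D := Nat.pow_pred_clog_lt_self one_lt_two (by
            by_contra hcon
            have : D = 1 := by lia
            rw [this] at h₁
            simp at h₁)
          obtain ⟨m, hm⟩ : ∃ m, Nat.clog 2 D = m + 1 := ⟨Nat.clog 2 D - 1, by lia⟩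
          rw [hm] at h₂ ⊢
          simp only [Nat.pred_eq_sub_one, add_tsub_cancel_right] at h₂
          rw [pow_succ]
          lia
    have hT : ∃ T : Finset ℤ, (∀ τ ∈ T, a i ≤ τ ∧ τ < a i + 2 ^ j ∧
        ¬ ((i.insertNth τ y : Fin (d + 1) → ℤ) ∈ v ↔ i.insertNth τ y' ∈ v)) ∧
        |f y - f y'| ≤ J * (T.card : ℤ) := by
      rcases le_total (f y) (f y') with hle | hle
      · refine ⟨(Finset.Ico (f y) (f y')).filter fun τ =>
          ¬ ((i.insertNth τ y : Fin (d + 1) → ℤ) ∈ v ↔ i.insertNth τ y' ∈ v), ?_, ?_⟩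
        rotate_left
        · rw [abs_sub_comm, abs_of_nonneg (by linarith)]
          exact hst y hyS y' hyS' hle
        · intro τ hτ
          rw [Finset.mem_filter, Finset.mem_Ico] at hτ
          exact ⟨by lia, by lia, hτ.2⟩
      · refine ⟨(Finset.Ico (f y') (f y)).filter fun τ =>
          ¬ ((i.insertNth τ y' : Fin (d + 1) → ℤ) ∈ v ↔ i.insertNth τ y ∈ v), ?_, ?_⟩
        rotate_left
        · rw [abs_of_nonneg (by linarith)]
          exact hst y' hyS' y hyS hle
        · intro τ hτ
          rw [Finset.mem_filter, Finset.mem_Ico] at hτ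
          exact ⟨by lia, by lia, fun hcon => hτ.2 hcon.symm⟩
    obtain ⟨T, hT, hTc⟩ := hT
    have hmain := h.card_le_card_faces_near hg hgj hjk (hS hyS) hD hDg hT
    refine ⟨g, ?_⟩
    push_cast
    rw [← hM] at hmain
    set m := (M.filter fun p => ∀ l, |i.removeNth p.1 l - y l| ≤ 2 * 2 ^ g).card with hm
    have h₁ : L * D ≤ J * T.card := by
      have : (L * D : ℤ) ≤ J * T.card := hlt.le.trans hTc
      exact_mod_cast this
    have h₂ : D * (L * (2 ^ g) ^ d) ≤ D * (4 * J * lowConst d * m) := by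
      calc D * (L * (2 ^ g) ^ d) = (L * D) * (2 ^ g) ^ d := by ring
        _ ≤ (J * T.card) * (2 ^ g) ^ d := by gcongr
        _ = J * (T.card * (2 ^ g) ^ d) := by ring
        _ ≤ J * (lowConst d * (2 ^ g * m)) := by gcongr
        _ ≤ J * (lowConst d * (4 * D * m)) := by gcongr
        _ = _ := by ring
    have h₃ := Nat.le_of_mul_le_mul_left h₂ hDpos
    calc L * (2 * 2 ^ g) ^ d = 2 ^ d * (L * (2 ^ g) ^ d) := by rw [mul_pow]; ring
      _ ≤ 2 ^ d * (4 * J * lowConst d * m) := by gcongr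
      _ = _ := by rw [hK₁]; ring
  choose! g hg using hbad
  have hcount := card_le_of_forall_ball (M := M) (B := B) (fun p => i.removeNth p.1)
    (fun y => 2 * 2 ^ g y) (fun y _ => by positivity) L _ hg
  have h2B : 2 * B.card ≤ S.card := by
    have h₁ : L * B.card ≤ c * S.card := by
      calc L * B.card ≤ _ := hcount
        _ ≤ 11 ^ d * K₁ * (K₂ * (2 ^ j) ^ d) := by gcongr
        _ ≤ 11 ^ d * K₁ * (K₂ * (R * S.card)) := by gcongr
        _ = _ := by rw [hc]; ring
    have h₂ : (c + 1) * (2 * B.card) ≤ (c + 1) * S.card := by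
      calc (c + 1) * (2 * B.card) = L * B.card := by rw [hL]; ring
        _ ≤ c * S.card := h₁
        _ ≤ _ := by gcongr; lia
    exact Nat.le_of_mul_le_mul_left h₂ (by positivity)
  refine ⟨S \ B, Finset.sdiff_subset, ?_, ?_⟩
  · have := Finset.card_sdiff_add_card_eq_card (Finset.filter_subset _ S : B ⊆ S)
    lia
  · intro x hx y hy D hD
    rw [Finset.mem_sdiff] at hx hy
    by_contra hcon
    exact hx.2 (Finset.mem_filter.2 ⟨hx.1, y, hy.1, D, hD, not_le.1 hcon⟩)

lemma exists_card_le_mul_card_fiber {α β : Type*} [DecidableEq β] {s : Finset α} {t : Finset β}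
    {f : α → β} (hf : ∀ x ∈ s, f x ∈ t) (ht : t.Nonempty) :
    ∃ y ∈ t, s.card ≤ t.card * (s.filter fun x => f x = y).card := by
  obtain ⟨y, hy, hmax⟩ := t.exists_max_image (fun y => (s.filter fun x => f x = y).card) ht
  refine ⟨y, hy, ?_⟩
  rw [Finset.card_eq_sum_card_fiberwise hf]
  exact Finset.sum_le_card_nsmul _ _ _ hmax

/-- In a cube without profitable subcubes where both `u` and its complement are abundant, a
positive proportion of the boundary lies on a Lipschitz graph. -/
lemma exists_lipschitz_graph (d Θ : ℕ) : ∃ L K : ℕ, ∀ (u : Set (Fin (d + 1) → ℤ)) (k j : ℕ),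
    NoProfit u k → 2 ≤ j → j ≤ k → ∀ a : Fin (d + 1) → ℤ,
    (2 ^ j) ^ (2 * d + 2) ≤ Θ * (cnt u (cube a (2 ^ j)) * cnt uᶜ (cube a (2 ^ j))) →
    ∃ (i : Fin (d + 1)) (S : Finset (Fin d → ℤ)) (F : (Fin d → ℤ) → ℤ),
      S ⊆ cube (i.removeNth a) (2 ^ j) ∧ S.Nonempty ∧ IsLip L F ∧
      (∀ y, a i ≤ F y ∧ F y ≤ a i + 2 ^ j) ∧ (2 ^ j) ^ d ≤ K * S.card ∧
      ∀ y ∈ S, a i ≤ F y - 1 ∧ F y < a i + 2 ^ j ∧ IsBdry u (i.insertNth (F y - 1) y) i := by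
  obtain ⟨P, hP⟩ : ∃ P, P = 2 * Θ * (d + 1) := ⟨_, rfl⟩
  obtain ⟨N, hN⟩ : ∃ N, N = 8 * (d + 1) * P := ⟨_, rfl⟩
  obtain ⟨R, hR⟩ : ∃ R, R = P * 2 * (N + 1) ^ 2 := ⟨_, rfl⟩
  obtain ⟨L, hL⟩ : ∃ L, L = 2 * (11 ^ d * (2 ^ d * (4 * (N + 2) * lowConst d)) *
        (10 ^ (d + 1) * (4 * (d + 1)) * R) + 1) := ⟨_, rfl⟩
  refine ⟨L, R * 2, ?_⟩
  intro u k j hu hj hjk a hcnt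
  classical
  obtain ⟨v, hv, i, t, t', ht, htt, ht', W, hW, hWc, hWv⟩ :=
    exists_separated_levels u a (s := 2 ^ j) (by positivity) hcnt
  rw [← hP] at hWc
  have hvP : NoProfit v k := by
    rcases hv with rfl | rfl
    exacts [hu, hu.compl]
  have hvB : ∀ x l, IsBdry v x l → IsBdry u x l := by
    rcases hv with rfl | rfl
    exacts [fun _ _ h => h, fun _ _ h => isBdry_compl.1 h]
  obtain ⟨W', hW', hW'c, hX⟩ := exists_few_crossings ht ht' (hvP.card_faces_le hjk a) hW hWc
  rw [← hN] at hX
  have hsel := fun y (hy : y ∈ W') => exists_stable_crossing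
    (fun τ => (i.insertNth τ y : Fin (d + 1) → ℤ) ∈ v) htt (hWv y (hW' hy)).1 (hWv y (hW' hy)).2
    (hX y hy)
  choose! f r r' hsel using hsel
  obtain ⟨⟨q, q'⟩, -, hq⟩ := exists_card_le_mul_card_fiber (s := W')
    (t := Finset.Icc (1 : ℤ) (N + 1) ×ˢ Finset.Icc (1 : ℤ) (N + 1)) (f := fun y => (r y, r' y))
    (fun y hy => by
      obtain ⟨-, -, h₁, h₂, h₃, -⟩ := hsel y hy
      simp only [Finset.mem_product, Finset.mem_Icc]
      lia)
    ⟨(1, 1), by simp⟩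
  set S := W'.filter fun y => (r y, r' y) = (q, q') with hS
  have hSW : S ⊆ W' := Finset.filter_subset _ _
  have hSR : (2 ^ j) ^ d ≤ R * S.card := by
    have hcardN : (Finset.Icc (1 : ℤ) (N + 1) ×ˢ Finset.Icc (1 : ℤ) (N + 1)).card =
        (N + 1) ^ 2 := by
      rw [Finset.card_product, Int.card_Icc, sq]
      congr 1 <;> lia
    rw [hcardN] at hq
    calc (2 ^ j) ^ d ≤ P * W.card := hWc
      _ ≤ P * (2 * ((N + 1) ^ 2 * S.card)) := by gcongr; lia
      _ = R * S.card := by rw [hR]; ring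
  have hrr : ∀ y ∈ S, r y = q ∧ r' y = q' := fun y hy => by
    simpa using (Finset.mem_filter.1 hy).2
  have hf : ∀ y ∈ S, a i < f y ∧ f y < a i + 2 ^ j := by
    intro y hy
    obtain ⟨h₁, h₂, -⟩ := hsel y (hSW hy)
    push_cast at ht'
    constructor <;> linarith
  obtain ⟨S', hS', hcard, hlip⟩ := exists_lipschitz_subset hvP hj hjk (f := f) (i := i)
    (J := N + 2) (hSW.trans (hW'.trans hW)) hSR hf (by
      intro y hy y' hy' hyy
      obtain ⟨h₁, -, -, h₂, -, -, -, h₃, -⟩ := hsel y (hSW hy)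
      obtain ⟨-, h₄, -, -, -, -, -, -, h₅⟩ := hsel y' (hSW hy')
      rw [(hrr y hy).1, (hrr y hy).2] at h₂
      have h₆ := h₃ (f y') hyy h₄
      have h₇ := h₅ (f y) h₁.le hyy
      rw [(hrr y hy).1] at h₆
      rw [(hrr y' hy').2] at h₇
      push_cast
      exact card_sub_le_of_stable h₂ hyy h₆ h₇ (by positivity))
  rw [← hL] at hlip
  have hSR' : (2 ^ j) ^ d ≤ R * 2 * S'.card := by
    calc _ ≤ _ := hSR
      _ ≤ R * (2 * S'.card) := by gcongr
      _ = _ := by ring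
  have hne : S'.Nonempty := by
    rw [← Finset.card_pos]
    by_contra hcon
    have : S'.card = 0 := by lia
    rw [this, mul_zero] at hSR'
    have : 0 < (2 ^ j) ^ d := by positivity
    lia
  obtain ⟨F, hF, hFf, hFr⟩ := exists_isLip_extension hne hlip (lo := a i) (hi := a i + 2 ^ j)
    (fun x hx => (hf x (hS' hx)).1.le) (fun x hx => (hf x (hS' hx)).2.le)
  refine ⟨i, S', F, hS'.trans (hSW.trans (hW'.trans hW)), hne, hF, hFr, hSR', ?_⟩
  intro y hy
  rw [hFf y hy]
  have := hf y (hS' hy)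
  refine ⟨by lia, this.2, hvB _ _ ?_⟩
  obtain ⟨-, -, -, -, -, h₁, h₂, -⟩ := hsel y (hSW (hS' hy))
  rw [IsBdry, insertNth_add_single_self]
  simp only [sub_add_cancel]
  tauto

/-- The grid cube of side `2 ^ g` containing `x` is far from the graph of `F`. -/
def IsFar (i : Fin (d + 1)) (F : (Fin d → ℤ) → ℤ) (a : Fin (d + 1) → ℤ) (g : ℕ)
    (x : Fin (d + 1) → ℤ) : Prop :=
  ∀ z ∈ cube (gridCorner a (2 ^ g) x) (2 ^ g), 2 ^ g ≤ |z i - F (i.removeNth z)|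

open Classical in
/-- The exponent of the side of the Whitney cube containing `x`. -/
noncomputable def scale (i : Fin (d + 1)) (F : (Fin d → ℤ) → ℤ) (a : Fin (d + 1) → ℤ) (j : ℕ)
    (x : Fin (d + 1) → ℤ) : ℕ :=
  Nat.findGreatest (fun g => IsFar i F a g x) j

section Whitney

variable {i : Fin (d + 1)} {F : (Fin d → ℤ) → ℤ} {a : Fin (d + 1) → ℤ} {j : ℕ}

lemma scale_le (x : Fin (d + 1) → ℤ) : scale i F a j x ≤ j := by
  classical
  exact Nat.findGreatest_le j

lemma isFar_scale {x : Fin (d + 1) → ℤ} (h : scale i F a j x ≠ 0) :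
    IsFar i F a (scale i F a j x) x := by
  classical
  exact Nat.findGreatest_of_ne_zero (P := fun g => IsFar i F a g x) rfl h

lemma not_isFar_of_scale_lt {x : Fin (d + 1) → ℤ} {g : ℕ} (h : scale i F a j x < g) (hg : g ≤ j) :
    ¬ IsFar i F a g x := by
  classical
  exact Nat.findGreatest_is_greatest (P := fun g => IsFar i F a g x) h hg

lemma le_scale {x : Fin (d + 1) → ℤ} {g : ℕ} (hg : g ≤ j) (h : IsFar i F a g x) :
    g ≤ scale i F a j x := by
  classical
  exact Nat.le_findGreatest (P := fun g => IsFar i F a g x) hg h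

lemma scale_eq_of_mem {x y : Fin (d + 1) → ℤ}
    (hy : y ∈ cube (gridCorner a (2 ^ scale i F a j x) x) (2 ^ scale i F a j x)) :
    scale i F a j y = scale i F a j x := by
  classical
  have h₁ := gridCorner_eq_of_mem hy
  have h₂ : ∀ g, scale i F a j x ≤ g → (IsFar i F a g y ↔ IsFar i F a g x) := by
    intro g hg
    rw [IsFar, IsFar, gridCorner_nested (by positivity) (pow_dvd_pow 2 hg) h₁]
  refine le_antisymm ?_ ?_
  · by_contra hlt
    push Not at hlt
    have h₀ : scale i F a j y ≠ 0 := by lia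
    exact not_isFar_of_scale_lt hlt (scale_le y) ((h₂ _ hlt.le).1 (isFar_scale h₀))
  · rcases Nat.eq_zero_or_pos (scale i F a j x) with h₀ | h₀
    · lia
    · exact le_scale (scale_le x) ((h₂ _ le_rfl).2 (isFar_scale h₀.ne'))

lemma isPartition_scale : IsPartition (cube a (2 ^ j)) fun x =>
    (gridCorner a (2 ^ scale i F a j x) x, 2 ^ scale i F a j x) where
  self_mem x _ := mem_cube_gridCorner a (by positivity) x
  subset x hx := cube_gridCorner_subset (by positivity) (pow_dvd_pow 2 (scale_le x)) hx
  eq_of_mem x _ y hy := by rw [scale_eq_of_mem hy, gridCorner_eq_of_mem hy]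

lemma abs_sub_le_of_scale_lt {L : ℕ} (hF : IsLip L F) {x : Fin (d + 1) → ℤ}
    (hx : scale i F a j x < j) :
    |x i - F (i.removeNth x)| ≤ (2 * L + 4) * 2 ^ scale i F a j x := by
  classical
  have h₁ : ¬ IsFar i F a (scale i F a j x + 1) x :=
    not_isFar_of_scale_lt (Nat.lt_succ_self _) hx
  rw [IsFar] at h₁
  push Not at h₁
  obtain ⟨z, hz, hzF⟩ := h₁
  set g := scale i F a j x
  have hx' := mem_cube_gridCorner a (s := 2 ^ (g + 1)) (by positivity) x
  have hd : ∀ l, |x l - z l| ≤ ((2 ^ (g + 1) : ℕ) : ℤ) := by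
    intro l
    have h₁ := mem_cube.1 hz l
    have h₂ := mem_cube.1 hx' l
    rw [abs_le]
    constructor <;> linarith
  have h₂ := hF (i.removeNth x) (i.removeNth z) (2 ^ (g + 1)) fun l => hd _
  have h₃ := hd i
  push_cast at h₂ h₃
  have h₄ : x i - F (i.removeNth x) = (x i - z i) + (z i - F (i.removeNth z)) -
    (F (i.removeNth x) - F (i.removeNth z)) := by ring
  rw [h₄]
  have h₅ := abs_sub (x i - z i + (z i - F (i.removeNth z))) (F (i.removeNth x) - F (i.removeNth z))
  have h₆ := abs_add_le (x i - z i) (z i - F (i.removeNth z))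
  rw [pow_succ] at h₂ h₃ hzF
  linarith

lemma scale_lt_of_mem (hj : 0 < j) {x z : Fin (d + 1) → ℤ} (hx : x ∈ cube a (2 ^ j))
    (hz : z ∈ cube a (2 ^ j)) (hzF : z i = F (i.removeNth z)) : scale i F a j x < j := by
  classical
  refine lt_of_le_of_ne (scale_le x) fun h => ?_
  have h₁ : IsFar i F a j x := by
    have := isFar_scale (i := i) (F := F) (a := a) (j := j) (x := x) (by lia)
    rwa [h] at this
  have h₂ : ∀ x ∈ cube a (2 ^ j), gridCorner a (2 ^ j) x = a := by
    intro x hx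
    funext l
    have h := mem_cube.1 hx l
    have : (x l - a l) / ((2 ^ j : ℕ) : ℤ) = 0 :=
      Int.ediv_eq_zero_of_lt (by linarith) (by linarith)
    simp only [gridCorner, this, mul_zero, add_zero]
  have h₃ := h₁ z (by rw [h₂ x hx]; exact hz)
  rw [hzF, sub_self, abs_zero] at h₃
  have : (0 : ℤ) < 2 ^ j := by positivity
  linarith

lemma scale_eq_zero {x : Fin (d + 1) → ℤ} (hx : |x i - F (i.removeNth x)| ≤ 1) :
    scale i F a j x = 0 := by
  classical
  by_contra h
  have h₁ := isFar_scale h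
  have h₂ := h₁ x (mem_cube_gridCorner a (by positivity) x)
  have h₃ : (2 : ℤ) ^ 1 ≤ 2 ^ scale i F a j x :=
    pow_le_pow_right₀ (by norm_num) (Nat.one_le_iff_ne_zero.2 h)
  linarith

lemma gridCorner_one (x : Fin n → ℤ) (a : Fin n → ℤ) : gridCorner a 1 x = x := by
  funext l
  simp [gridCorner]

end Whitney

/-- At least half of the cells of `Q` belong to `u`. -/
def IsMajority (u : Set (Fin n → ℤ)) (Q : Finset (Fin n → ℤ)) : Prop :=
  2 * cnt uᶜ Q ≤ Q.card

lemma two_mul_cnt_le_of_not_isMajority {u : Set (Fin n → ℤ)} {Q : Finset (Fin n → ℤ)}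
    (h : ¬ IsMajority u Q) : 2 * cnt u Q ≤ Q.card := by
  have := cnt_add_cnt_compl u Q
  rw [IsMajority] at h
  lia

open Classical in
lemma IsPartition.card_jumps_le {u : Set (Fin (d + 1) → ℤ)} {Q : Finset (Fin (d + 1) → ℤ)}
    {key : (Fin (d + 1) → ℤ) → (Fin (d + 1) → ℤ) × ℕ} (h : IsPartition Q key) (i : Fin (d + 1)) :
    (Q.filter fun x => x + Pi.single i 1 ∈ Q ∧ ¬ (IsMajority u (cube (key x).1 (key x).2) ↔
      IsMajority u (cube (key (x + Pi.single i 1)).1 (key (x + Pi.single i 1)).2))).card ≤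
      7 * (faces u Q).card := by
  set v : (Fin (d + 1) → ℤ) × ℕ → Set (Fin (d + 1) → ℤ) := fun p =>
    if IsMajority u (cube p.1 p.2) then uᶜ else u with hv
  have hvmin : ∀ p : (Fin (d + 1) → ℤ) × ℕ, 2 * cnt (v p) (cube p.1 p.2) ≤ p.2 ^ (d + 1) := by
    intro p
    rw [← card_cube p.1]
    simp only [hv]
    split_ifs with hp
    exacts [hp, two_mul_cnt_le_of_not_isMajority hp]
  have hvf : ∀ p : (Fin (d + 1) → ℤ) × ℕ, faces (v p) (cube p.1 p.2) = faces u (cube p.1 p.2) := by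
    intro p
    simp only [hv]
    split_ifs
    exacts [faces_compl _ _, rfl]
  have hpos : ∀ p ∈ Q.image key, 0 < p.2 := by
    intro p hp
    obtain ⟨x, hx, rfl⟩ := Finset.mem_image.1 hp
    have := mem_cube.1 (h.self_mem x hx) 0
    lia
  set T : Finset (Fin (d + 1) → ℤ) := (Q.image key).biUnion fun p =>
    layer (v p) (cube p.1 p.2) i (p.1 i + p.2 - 1)
  set B : Finset (Fin (d + 1) → ℤ) := (Q.image key).biUnion fun p =>
    layer (v p) (cube p.1 p.2) i (p.1 i)
  have hT : T.card ≤ 3 * (faces u Q).card := by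
    refine Finset.card_biUnion_le.trans ((Finset.sum_le_sum fun p hp =>
      card_layer_le_of_minority (hpos p hp) (hvmin p) i _).trans ?_)
    rw [← Finset.mul_sum]
    simp only [hvf]
    exact Nat.mul_le_mul_left _ (h.sum_faces_le u)
  have hB : B.card ≤ 3 * (faces u Q).card := by
    refine Finset.card_biUnion_le.trans ((Finset.sum_le_sum fun p hp =>
      card_layer_le_of_minority (hpos p hp) (hvmin p) i _).trans ?_)
    rw [← Finset.mul_sum]
    simp only [hvf]
    exact Nat.mul_le_mul_left _ (h.sum_faces_le u)
  refine (Finset.card_le_card (t := (faces u Q).image Prod.fst ∪ (T ∪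
    B.image fun x => x - Pi.single i 1)) ?_).trans ?_
  · intro x hx
    obtain ⟨hxQ, hxQ', hmaj⟩ := Finset.mem_filter.1 hx
    by_cases hbd : IsBdry u x i
    · exact Finset.mem_union_left _ (Finset.mem_image.2 ⟨(x, i), mem_faces.2 ⟨hxQ, hxQ', hbd⟩, rfl⟩)
    refine Finset.mem_union_right _ ?_
    have hkey : key x ≠ key (x + Pi.single i 1) := fun hcon => hmaj (by rw [hcon])
    have hvx : x ∈ v (key x) ∨ x + Pi.single i 1 ∈ v (key (x + Pi.single i 1)) := by
      simp only [IsBdry, not_not] at hbd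
      have hv₁ : ∀ p : (Fin (d + 1) → ℤ) × ℕ, IsMajority u (cube p.1 p.2) → v p = uᶜ :=
        fun p hp => if_pos hp
      have hv₂ : ∀ p : (Fin (d + 1) → ℤ) × ℕ, ¬ IsMajority u (cube p.1 p.2) → v p = u :=
        fun p hp => if_neg hp
      by_cases hx₁ : IsMajority u (cube (key x).1 (key x).2)
      · rw [hv₁ _ hx₁, hv₂ _ fun hcon => hmaj (iff_of_true hx₁ hcon), Set.mem_compl_iff, ← hbd]
        exact (Classical.em _).symm
      · rw [hv₂ _ hx₁, hv₁ (key (x + Pi.single i 1)) (by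
          by_contra hcon
          exact hmaj (iff_of_false hx₁ hcon)), Set.mem_compl_iff, ← hbd]
        exact Classical.em _
    have h₁ := h.self_mem x hxQ
    have h₂ := h.self_mem _ hxQ'
    rcases hvx with hvx | hvx
    · refine Finset.mem_union_left _ (Finset.mem_biUnion.2
        ⟨key x, Finset.mem_image_of_mem _ hxQ, ?_⟩)
      simp only [layer, Finset.mem_filter]
      refine ⟨h₁, ?_, hvx⟩
      by_contra hne
      refine hkey (h.eq_of_mem x hxQ _ (mem_cube.2 fun l => ?_)).symm
      have h₃ := mem_cube.1 h₁ l
      rcases eq_or_ne l i with rfl | hl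
      · simp only [Pi.add_apply, Pi.single_eq_same]
        lia
      · simpa [hl] using h₃
    · refine Finset.mem_union_right _ (Finset.mem_image.2 ⟨x + Pi.single i 1,
        Finset.mem_biUnion.2 ⟨key (x + Pi.single i 1), Finset.mem_image_of_mem _ hxQ', ?_⟩,
        by simp⟩)
      simp only [layer, Finset.mem_filter]
      refine ⟨h₂, ?_, hvx⟩
      by_contra hne
      refine hkey (h.eq_of_mem _ hxQ' _ (mem_cube.2 fun l => ?_))
      have h₃ := mem_cube.1 h₂ l
      rcases eq_or_ne l i with rfl | hl
      · simp only [Pi.add_apply, Pi.single_eq_same] at h₃ hne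
        lia
      · simpa [hl] using h₃
  · refine (Finset.card_union_le _ _).trans ((add_le_add Finset.card_image_le
      ((Finset.card_union_le _ _).trans (add_le_add hT (Finset.card_image_le.trans hB)))).trans ?_)
    lia

/-- The signed `ν`-weight of the column over `y` between the graph of `F` and the height `τ`. -/
noncomputable def column (ν : (Fin (d + 1) → ℤ) → ℝ) (i : Fin (d + 1)) (F : (Fin d → ℤ) → ℤ)
    (y : Fin d → ℤ) (τ : ℤ) : ℝ :=
  ∑ t ∈ Finset.Ico (F y) τ, ν (i.insertNth t y) - ∑ t ∈ Finset.Ico τ (F y), ν (i.insertNth t y)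

/-- The weight of the region between a Lipschitz graph and a nearby horizontal plane over a cube
is controlled by the area of the cube. -/
def ColumnBound (ν : (Fin (d + 1) → ℤ) → ℝ) (L : ℕ) (C : ℝ) : Prop :=
  ∀ (i : Fin (d + 1)) (c : Fin d → ℤ) (s : ℕ), 0 < s → ∀ F, IsLip L F → ∀ τ : ℤ,
    (∀ y ∈ cube c s, |τ - F y| ≤ L * s) → |∑ y ∈ cube c s, column ν i F y τ| ≤ C * s ^ d

lemma column_succ_sub (ν : (Fin (d + 1) → ℤ) → ℝ) (i : Fin (d + 1)) (F : (Fin d → ℤ) → ℤ)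
    (y : Fin d → ℤ) (τ : ℤ) :
    column ν i F y (τ + 1) - column ν i F y τ = ν (i.insertNth τ y) := by
  rcases le_or_gt (F y) τ with h | h
  · simp only [column, Finset.Ico_eq_empty_of_le h,
      Finset.Ico_eq_empty_of_le (h.trans (by lia : τ ≤ τ + 1))]
    rw [← Finset.insert_Ico_right_eq_Ico_add_one h, Finset.sum_insert (by simp)]
    simp
  · simp only [column, Finset.Ico_eq_empty_of_le h.le,
      Finset.Ico_eq_empty_of_le (Int.add_one_le_iff.2 h)]
    rw [← Finset.insert_Ico_add_one_left_eq_Ico h, Finset.sum_insert (by simp)]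
    simp

lemma sum_mul_sub_eq (w N : ℤ → ℝ) (b : ℤ) (m : ℕ) :
    ∑ t ∈ Finset.Ico b (b + m), w t * (N (t + 1) - N t) =
      ∑ t ∈ Finset.Ico b (b + m), N t * (w (t - 1) - w t) + N (b + m) * w (b + m - 1) -
        N b * w (b - 1) := by
  induction m with
  | zero => simp
  | succ m ih =>
    have h : Finset.Ico b (b + (m + 1 : ℕ)) = insert (b + m : ℤ) (Finset.Ico b (b + m)) := by
      ext t
      simp only [Finset.mem_insert, Finset.mem_Ico]
      push_cast
      lia
    rw [h, Finset.sum_insert (by simp), Finset.sum_insert (by simp), ih]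
    push_cast
    have h₁ : (b : ℤ) + (m + 1) = b + m + 1 := by ring
    rw [h₁, add_sub_cancel_right]
    ring

lemma gridCorner_insertNth (i : Fin (d + 1)) (a : Fin (d + 1) → ℤ) (s : ℕ) (t : ℤ)
    {x y : Fin d → ℤ} (h : gridCorner (i.removeNth a) s x = gridCorner (i.removeNth a) s y) :
    gridCorner a s (i.insertNth t x) = gridCorner a s (i.insertNth t y) := by
  funext l
  rcases Fin.eq_self_or_eq_succAbove i l with rfl | ⟨m, rfl⟩
  · simp [gridCorner]
  · have := congrFun h m
    simp only [gridCorner, Fin.removeNth] at this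
    simpa [gridCorner] using this

section Whitney

variable {i : Fin (d + 1)} {F : (Fin d → ℤ) → ℤ} {a : Fin (d + 1) → ℤ} {j : ℕ}

variable (i F a j) in
/-- The Whitney cube containing `x`. -/
noncomputable def whitneyCube (x : Fin (d + 1) → ℤ) : Finset (Fin (d + 1) → ℤ) :=
  cube (gridCorner a (2 ^ scale i F a j x) x) (2 ^ scale i F a j x)

open Classical in
variable (i F a j) in
/-- `scale`, extended by `j` outside the cube. -/
noncomputable def scaleExt (x : Fin (d + 1) → ℤ) : ℕ :=
  if x ∈ cube a (2 ^ j) then scale i F a j x else j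

open Classical in
variable (i F a j) in
/-- The indicator function of the union of the Whitney cubes where `u` has the majority. -/
noncomputable def majorityInd (u : Set (Fin (d + 1) → ℤ)) (x : Fin (d + 1) → ℤ) : ℝ :=
  if x ∈ cube a (2 ^ j) ∧ IsMajority u (whitneyCube i F a j x) then 1 else 0

lemma majorityInd_of_notMem {u : Set (Fin (d + 1) → ℤ)} {x : Fin (d + 1) → ℤ}
    (h : x ∉ cube a (2 ^ j)) : majorityInd i F a j u x = 0 := if_neg fun h' => h h'.1

lemma scaleExt_le (x : Fin (d + 1) → ℤ) : scaleExt i F a j x ≤ j := by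
  unfold scaleExt
  split_ifs
  exacts [scale_le x, le_rfl]

lemma scaleExt_eq_of_gridCorner_eq {x y : Fin d → ℤ} {σ : ℤ} {g : ℕ}
    (hx : x ∈ cube (i.removeNth a) (2 ^ j)) (hy : y ∈ cube (i.removeNth a) (2 ^ j))
    (hg : g ≤ scaleExt i F a j (i.insertNth σ x))
    (h : gridCorner (i.removeNth a) (2 ^ g) y = gridCorner (i.removeNth a) (2 ^ g) x) :
    scaleExt i F a j (i.insertNth σ y) = scaleExt i F a j (i.insertNth σ x) ∧
      ∀ u, majorityInd i F a j u (i.insertNth σ y) = majorityInd i F a j u (i.insertNth σ x) := by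
  have hmem : (i.insertNth σ y : Fin (d + 1) → ℤ) ∈ cube a (2 ^ j) ↔
      (i.insertNth σ x : Fin (d + 1) → ℤ) ∈ cube a (2 ^ j) := by
    simp only [insertNth_mem_cube, hx, hy]
  by_cases hq : (i.insertNth σ x : Fin (d + 1) → ℤ) ∈ cube a (2 ^ j)
  · have hq' := hmem.2 hq
    simp only [scaleExt, hq, hq', if_true] at hg ⊢
    have h₁ := gridCorner_nested (by positivity) (pow_dvd_pow 2 hg)
      (gridCorner_insertNth i a (2 ^ g) σ h)
    have h₂ := scale_eq_of_mem (i := i) (F := F) (a := a) (j := j)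
      (h₁ ▸ mem_cube_gridCorner a (by positivity) (i.insertNth σ y))
    refine ⟨h₂, fun u => ?_⟩
    unfold majorityInd whitneyCube
    rw [h₂, h₁]
    classical exact if_congr (and_congr hmem Iff.rfl) rfl rfl
  · have hq' : (i.insertNth σ y : Fin (d + 1) → ℤ) ∉ cube a (2 ^ j) := fun h => hq (hmem.1 h)
    refine ⟨by rw [scaleExt, scaleExt, if_neg hq', if_neg hq], fun u => ?_⟩
    rw [majorityInd_of_notMem hq, majorityInd_of_notMem hq']

variable {L : ℕ} {ν : (Fin (d + 1) → ℤ) → ℝ} {C : ℝ}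

lemma abs_sub_le_scaleExt (hF : IsLip L F) (hFr : ∀ y, a i ≤ F y ∧ F y ≤ a i + 2 ^ j)
    (hlt : ∀ x ∈ cube a (2 ^ j), scale i F a j x < j) {τ σ : ℤ} (hτ : a i ≤ τ ∧ τ ≤ a i + 2 ^ j)
    (hσ : |τ - σ| ≤ 1) (y : Fin d → ℤ) :
    |τ - F y| ≤ (2 * L + 5) * 2 ^ scaleExt i F a j (i.insertNth σ y) := by
  unfold scaleExt
  split_ifs with h
  · have h₁ := abs_sub_le_of_scale_lt hF (hlt _ h)
    simp only [Fin.insertNth_apply_same, Fin.removeNth_insertNth] at h₁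
    have h₂ := abs_sub_le τ σ (F y)
    have h₃ : (1 : ℤ) ≤ 2 ^ scale i F a j (i.insertNth σ y) := one_le_pow₀ (by norm_num)
    linarith
  · have h₁ := hFr y
    have h₂ : (0 : ℤ) ≤ L := by positivity
    have h₃ : (0 : ℤ) ≤ 2 ^ j := by positivity
    have h₄ : |τ - F y| ≤ 2 ^ j := by
      rw [abs_le]
      constructor <;> linarith
    nlinarith

lemma abs_sum_column_mul_le (hν : ColumnBound ν (2 * L + 5) C) (hF : IsLip L F)
    (hFr : ∀ y, a i ≤ F y ∧ F y ≤ a i + 2 ^ j)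
    (hlt : ∀ x ∈ cube a (2 ^ j), scale i F a j x < j) {τ : ℤ} (hτ : a i ≤ τ ∧ τ ≤ a i + 2 ^ j)
    (u : Set (Fin (d + 1) → ℤ)) :
    |∑ y ∈ cube (i.removeNth a) (2 ^ j), column ν i F y τ *
      (majorityInd i F a j u (i.insertNth (τ - 1) y) - majorityInd i F a j u (i.insertNth τ y))| ≤
    C * ∑ y ∈ cube (i.removeNth a) (2 ^ j),
      |majorityInd i F a j u (i.insertNth (τ - 1) y) - majorityInd i F a j u (i.insertNth τ y)| := by
  classical
  set Δ : (Fin d → ℤ) → ℝ := fun y =>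
    majorityInd i F a j u (i.insertNth (τ - 1) y) - majorityInd i F a j u (i.insertNth τ y) with hΔ
  set g : (Fin d → ℤ) → ℕ := fun y => min (scaleExt i F a j (i.insertNth (τ - 1) y))
    (scaleExt i F a j (i.insertNth τ y)) with hg
  set Q := cube (i.removeNth a) (2 ^ j) with hQ
  have hgj : ∀ y, g y ≤ j := fun y => (min_le_left _ _).trans (scaleExt_le _)
  have hsub : ∀ x ∈ Q, cube (gridCorner (i.removeNth a) (2 ^ g x) x) (2 ^ g x) ⊆ Q :=
    fun x hx => cube_gridCorner_subset (by positivity) (pow_dvd_pow 2 (hgj x)) hx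
  have hinv : ∀ x ∈ Q, ∀ y ∈ cube (gridCorner (i.removeNth a) (2 ^ g x) x) (2 ^ g x),
      g y = g x ∧ Δ y = Δ x := by
    intro x hx y hy
    have h₁ := scaleExt_eq_of_gridCorner_eq (i := i) (F := F) (a := a) (σ := τ - 1) hx
      (hsub x hx hy) (min_le_left _ _) (gridCorner_eq_of_mem hy)
    have h₂ := scaleExt_eq_of_gridCorner_eq (i := i) (F := F) (a := a) (σ := τ) hx
      (hsub x hx hy) (min_le_right _ _) (gridCorner_eq_of_mem hy)
    simp only [hg, hΔ, h₁.1, h₁.2 u, h₂.1, h₂.2 u, and_self]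
  have hpart : IsPartition Q fun y => (gridCorner (i.removeNth a) (2 ^ g y) y, 2 ^ g y) :=
    { self_mem := fun x _ => mem_cube_gridCorner _ (by positivity) x
      subset := hsub
      eq_of_mem := fun x hx y hy => by rw [(hinv x hx y hy).1, gridCorner_eq_of_mem hy] }
  rw [hpart.sum_eq, hpart.sum_eq, Finset.mul_sum]
  refine (Finset.abs_sum_le_sum_abs _ _).trans (Finset.sum_le_sum fun p hp => ?_)
  obtain ⟨x, hx, rfl⟩ := Finset.mem_image.1 hp
  have h₁ : ∀ y ∈ cube (gridCorner (i.removeNth a) (2 ^ g x) x) (2 ^ g x),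
      |τ - F y| ≤ ((2 * L + 5 : ℕ) : ℤ) * ((2 ^ g x : ℕ) : ℤ) := by
    intro y hy
    rw [← (hinv x hx y hy).1]
    push_cast
    rcases min_choice (scaleExt i F a j (i.insertNth (τ - 1) y))
      (scaleExt i F a j (i.insertNth τ y)) with h | h
    · simp only [hg, h]
      exact abs_sub_le_scaleExt hF hFr hlt hτ (by simp) y
    · simp only [hg, h]
      exact abs_sub_le_scaleExt hF hFr hlt hτ (by simp) y
  have h₂ := hν i (gridCorner (i.removeNth a) (2 ^ g x) x) (2 ^ g x) (by positivity) F
    (fun x y D hD => (hF x y D hD).trans (by gcongr; lia)) τ h₁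
  rw [Finset.sum_congr rfl fun y hy => congrArg (column ν i F y τ * ·) (hinv x hx y hy).2,
    Finset.sum_congr rfl fun y hy => congrArg abs (hinv x hx y hy).2,
    ← Finset.sum_mul, abs_mul, Finset.sum_const, card_cube, nsmul_eq_mul, ← mul_assoc]
  refine mul_le_mul_of_nonneg_right ?_ (abs_nonneg _)
  push_cast at h₂ ⊢
  exact h₂

end Whitney

section Whitney

variable {i : Fin (d + 1)} {F : (Fin d → ℤ) → ℤ} {a : Fin (d + 1) → ℤ} {j : ℕ}
variable {L : ℕ} {ν : (Fin (d + 1) → ℤ) → ℝ} {C : ℝ}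

lemma ColumnBound.nonneg (hν : ColumnBound ν L C) : 0 ≤ C := by
  have h := hν 0 0 1 one_pos (fun _ => 0) (fun x y D _ => by simp; positivity) 0
    (fun y _ => by simp)
  simpa using (abs_nonneg _).trans h

open Classical in
lemma sum_abs_majorityInd_sub_le (u : Set (Fin (d + 1) → ℤ)) :
    ∑ τ ∈ Finset.Ico (a i) (a i + (2 ^ j + 1 : ℕ)), ∑ y ∈ cube (i.removeNth a) (2 ^ j),
      |majorityInd i F a j u (i.insertNth (τ - 1) y) - majorityInd i F a j u (i.insertNth τ y)| ≤
    7 * (faces u (cube a (2 ^ j))).card + 2 * 2 ^ (j * d) := by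
  set Q := cube (i.removeNth a) (2 ^ j) with hQ
  set Δ : ℤ × (Fin d → ℤ) → ℝ := fun p => majorityInd i F a j u (i.insertNth (p.1 - 1) p.2) -
    majorityInd i F a j u (i.insertNth p.1 p.2) with hΔ
  have hΔ₁ : ∀ p, |Δ p| ≤ 1 := by
    intro p
    simp only [hΔ, majorityInd]
    split_ifs <;> simp
  rw [← Finset.sum_product' (f := fun τ y => |Δ (τ, y)|)]
  set P := Finset.Ico (a i) (a i + (2 ^ j + 1 : ℕ)) ×ˢ Q with hP
  have h₁ : ∑ p ∈ P, |Δ p| ≤ (P.filter fun p => Δ p ≠ 0).card := by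
    rw [Finset.card_filter, Nat.cast_sum]
    refine Finset.sum_le_sum fun p _ => ?_
    split_ifs with h
    · simpa using hΔ₁ p
    · push Not at h
      simp [h]
  refine h₁.trans ?_
  have h₂ := isPartition_scale (F := F) (a := a) (j := j) (i := i) |>.card_jumps_le (u := u) i
  set J := (cube a (2 ^ j)).filter fun x => x + Pi.single i 1 ∈ cube a (2 ^ j) ∧
    ¬ (IsMajority u (whitneyCube i F a j x) ↔
      IsMajority u (whitneyCube i F a j (x + Pi.single i 1))) with hJ
  have h₃ : J.card ≤ 7 * (faces u (cube a (2 ^ j))).card := h₂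
  have h₄ : (P.filter fun p => Δ p ≠ 0) ⊆ J.image (fun x => (x i + 1, i.removeNth x)) ∪
      (({a i, a i + 2 ^ j} : Finset ℤ) ×ˢ Q) := by
    rintro ⟨τ, y⟩ hp
    obtain ⟨hp, hne⟩ := Finset.mem_filter.1 hp
    obtain ⟨hτ, hy⟩ := Finset.mem_product.1 hp
    rw [Finset.mem_Ico] at hτ
    push_cast at hτ
    dsimp only at hτ hy
    by_cases hb : τ = a i ∨ τ = a i + 2 ^ j
    · exact Finset.mem_union_right _ (Finset.mem_product.2 ⟨by simpa using hb, hy⟩)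
    refine Finset.mem_union_left _ (Finset.mem_image.2 ⟨i.insertNth (τ - 1) y, ?_, by simp⟩)
    have hadd : (i.insertNth (τ - 1) y : Fin (d + 1) → ℤ) + Pi.single i 1 = i.insertNth τ y := by
      rw [insertNth_add_single_self, sub_add_cancel]
    have hm₁ : (i.insertNth (τ - 1) y : Fin (d + 1) → ℤ) ∈ cube a (2 ^ j) := by
      rw [insertNth_mem_cube]
      push_cast
      exact ⟨by lia, hy⟩
    have hm₂ : (i.insertNth τ y : Fin (d + 1) → ℤ) ∈ cube a (2 ^ j) := by
      rw [insertNth_mem_cube]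
      push_cast
      exact ⟨by lia, hy⟩
    rw [hJ, Finset.mem_filter, hadd]
    refine ⟨hm₁, hm₂, fun hiff => hne ?_⟩
    simp only [hΔ]
    rw [sub_eq_zero, majorityInd, majorityInd]
    exact if_congr (and_congr (iff_of_true hm₁ hm₂) hiff) rfl rfl
  have h₅ := (Finset.card_le_card h₄).trans ((Finset.card_union_le _ _).trans
    (add_le_add Finset.card_image_le le_rfl))
  have h₆ : (({a i, a i + 2 ^ j} : Finset ℤ) ×ˢ Q).card ≤ 2 * 2 ^ (j * d) := by
    rw [Finset.card_product, hQ, card_cube, ← pow_mul]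
    exact Nat.mul_le_mul_right _ Finset.card_le_two
  exact_mod_cast h₅.trans (add_le_add h₃ h₆)

open Classical in
lemma abs_sum_majorityInd_mul_le (hν : ColumnBound ν (2 * L + 5) C) (hF : IsLip L F)
    (hFr : ∀ y, a i ≤ F y ∧ F y ≤ a i + 2 ^ j)
    (hlt : ∀ x ∈ cube a (2 ^ j), scale i F a j x < j) (u : Set (Fin (d + 1) → ℤ)) :
    |∑ x ∈ cube a (2 ^ j), majorityInd i F a j u x * ν x| ≤
      C * (7 * (faces u (cube a (2 ^ j))).card + 2 * 2 ^ (j * d)) := by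
  have hout : ∀ (t : ℤ) (y : Fin d → ℤ), ¬ (a i ≤ t ∧ t < a i + 2 ^ j) →
      majorityInd i F a j u (i.insertNth t y) = 0 := by
    intro t y ht
    refine majorityInd_of_notMem fun h => ht ?_
    have := (insertNth_mem_cube.1 h).1
    push_cast at this
    exact this
  have h₁ : ∑ x ∈ cube a (2 ^ j), majorityInd i F a j u x * ν x =
      ∑ τ ∈ Finset.Ico (a i) (a i + (2 ^ j + 1 : ℕ)), ∑ y ∈ cube (i.removeNth a) (2 ^ j),
        column ν i F y τ * (majorityInd i F a j u (i.insertNth (τ - 1) y) -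
          majorityInd i F a j u (i.insertNth τ y)) := by
    rw [sum_cube_eq_sum_lines i, Finset.sum_comm (s := Finset.Ico _ _)]
    refine Finset.sum_congr rfl fun y _ => ?_
    have h₂ := sum_mul_sub_eq (fun t => majorityInd i F a j u (i.insertNth t y))
      (column ν i F y) (a i) (2 ^ j + 1)
    rw [hout (a i - 1) y (by lia), hout (a i + (2 ^ j + 1 : ℕ) - 1) y (by push_cast; lia), mul_zero,
      mul_zero, add_zero, sub_zero] at h₂
    rw [← h₂]
    simp only [column_succ_sub]
    refine Finset.sum_subset (Finset.Ico_subset_Ico_right (by push_cast; lia)) fun t ht ht' => ?_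
    rw [hout t y, zero_mul]
    simpa using ht'
  rw [h₁]
  refine (Finset.abs_sum_le_sum_abs _ _).trans ((Finset.sum_le_sum fun τ hτ =>
    abs_sum_column_mul_le hν hF hFr hlt (τ := τ) ?_ u).trans ?_)
  · have := Finset.mem_Ico.1 hτ
    push_cast at this
    lia
  · rw [← Finset.mul_sum]
    exact mul_le_mul_of_nonneg_left (sum_abs_majorityInd_sub_le u) hν.nonneg

end Whitney

section Whitney

variable {i : Fin (d + 1)} {F : (Fin d → ℤ) → ℤ} {a : Fin (d + 1) → ℤ} {j : ℕ}
variable {L : ℕ} {ν : (Fin (d + 1) → ℤ) → ℝ} {C C' : ℝ}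

open Classical in
lemma abs_wt_sub_le_of_pieces (hC' : 0 ≤ C') {u : Set (Fin (d + 1) → ℤ)}
    (hlt : ∀ x ∈ cube a (2 ^ j), scale i F a j x < j)
    (ih : ∀ j' < j, ∀ a' : Fin (d + 1) → ℤ, ∀ v, v = u ∨ v = uᶜ →
      2 * cnt v (cube a' (2 ^ j')) ≤ (cube a' (2 ^ j')).card →
      |wt ν v (cube a' (2 ^ j'))| ≤ C' * (faces u (cube a' (2 ^ j'))).card)
    {S : Finset (Fin d → ℤ)} (hS : S ⊆ cube (i.removeNth a) (2 ^ j))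
    (hSF : ∀ y ∈ S, a i ≤ F y - 1 ∧ F y < a i + 2 ^ j ∧
      IsBdry u (i.insertNth (F y - 1) y) i) :
    |wt ν u (cube a (2 ^ j)) - ∑ x ∈ cube a (2 ^ j), majorityInd i F a j u x * ν x| ≤
      C' * ((faces u (cube a (2 ^ j))).card - S.card) := by
  have hpart := isPartition_scale (i := i) (F := F) (a := a) (j := j)
  set key : (Fin (d + 1) → ℤ) → (Fin (d + 1) → ℤ) × ℕ := fun x =>
    (gridCorner a (2 ^ scale i F a j x) x, 2 ^ scale i F a j x) with hkey
  have hE := hpart.sum_faces_add_le u (E := S.image fun y => (i.insertNth (F y - 1) y, i)) (by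
      intro p hp
      obtain ⟨y, hy, rfl⟩ := Finset.mem_image.1 hp
      obtain ⟨h₁, h₂, h₃⟩ := hSF y hy
      rw [mem_faces]
      refine ⟨insertNth_mem_cube.2 ⟨?_, hS hy⟩, ?_, h₃⟩
      · push_cast; lia
      · rw [insertNth_add_single_self]
        refine insertNth_mem_cube.2 ⟨?_, hS hy⟩
        push_cast; lia) (by
      intro p hp
      obtain ⟨y, hy, rfl⟩ := Finset.mem_image.1 hp
      have h₁ : scale i F a j (i.insertNth (F y - 1) y) = 0 := scale_eq_zero (by simp)
      have h₂ : scale i F a j (i.insertNth (F y) y) = 0 := scale_eq_zero (by simp)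
      simp only [hkey, insertNth_add_single_self, sub_add_cancel, h₁, h₂, pow_zero, gridCorner_one]
      intro h
      have := congrFun (congrArg Prod.fst h) i
      simp at this)
  rw [Finset.card_image_of_injective _ (fun y y' h => by
    have := congrArg (fun p => i.removeNth p.1) h
    simpa using this)] at hE
  rw [hpart.wt_eq, hpart.sum_eq, ← Finset.sum_sub_distrib]
  refine (Finset.abs_sum_le_sum_abs _ _).trans
    ((Finset.sum_le_sum (g := fun p => C' * ((faces u (cube p.1 p.2)).card : ℝ)) ?_).trans ?_)
  · intro p hp
    obtain ⟨x, hx, rfl⟩ := Finset.mem_image.1 hp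
    have hcongr : ∀ y ∈ cube (key x).1 (key x).2, majorityInd i F a j u y =
        if IsMajority u (cube (key x).1 (key x).2) then 1 else 0 := by
      intro y hy
      have h₁ := hpart.eq_of_mem x hx y hy
      have h₂ := hpart.subset x hx hy
      have h₃ : whitneyCube i F a j y = cube (key x).1 (key x).2 := by rw [← h₁]; rfl
      rw [majorityInd, h₃]
      exact if_congr (and_iff_right h₂) rfl rfl
    rw [Finset.sum_congr rfl fun y hy => congrArg (· * ν y) (hcongr y hy)]
    split_ifs with hm
    · have h₁ := wt_add_wt_compl ν u (cube (key x).1 (key x).2)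
      simp only [one_mul]
      rw [← h₁, sub_add_cancel_left, abs_neg]
      exact ih _ (hlt x hx) _ _ (Or.inr rfl) hm
    · simp only [zero_mul, Finset.sum_const_zero, sub_zero]
      exact ih _ (hlt x hx) _ _ (Or.inl rfl) (two_mul_cnt_le_of_not_isMajority hm)
  · rw [← Finset.mul_sum]
    refine mul_le_mul_of_nonneg_left ?_ hC'
    rw [le_sub_iff_add_le]
    exact_mod_cast hE

end Whitney

lemma NoProfit.card_faces_le_real {u : Set (Fin (d + 1) → ℤ)} {k j : ℕ} (h : NoProfit u k)
    (hj : j ≤ k) (a : Fin (d + 1) → ℤ) :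
    ((faces u (cube a (2 ^ j))).card : ℝ) ≤ 4 * (d + 1) * 2 ^ (j * d) := by
  have := h.card_faces_le hj a
  rw [← pow_mul] at this
  exact_mod_cast this

/-- A set without profitable cubes has small weight on the cubes in which it is a minority. -/
lemma exists_abs_wt_le_of_minority {ν : (Fin (d + 1) → ℤ) → ℝ} {c : ℝ} (hc : ∀ x, |ν x| ≤ c)
    (hν : ∀ L, ∃ C, ColumnBound ν L C) :
    ∃ C' : ℝ, 0 ≤ C' ∧ ∀ u k, NoProfit u k → ∀ j ≤ k, ∀ a : Fin (d + 1) → ℤ,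
      2 * cnt u (cube a (2 ^ j)) ≤ (cube a (2 ^ j)).card →
      |wt ν u (cube a (2 ^ j))| ≤ C' * (faces u (cube a (2 ^ j))).card := by
  obtain ⟨Θ, hΘ⟩ : ∃ Θ, Θ = 2 ^ (d + 3) := ⟨_, rfl⟩
  obtain ⟨L, K, hLK⟩ := exists_lipschitz_graph d Θ
  obtain ⟨C, hC⟩ := hν (2 * L + 5)
  have hC₀ := hC.nonneg
  have hc₀ : 0 ≤ c := (abs_nonneg _).trans (hc 0)
  obtain ⟨C', hC'⟩ : ∃ C', C' = max (8 * c) (C * (28 * (d + 1) + 2) * K) := ⟨_, rfl⟩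
  have hC'₁ : 8 * c ≤ C' := hC' ▸ le_max_left _ _
  have hC'₂ : C * (28 * (d + 1) + 2) * K ≤ C' := hC' ▸ le_max_right _ _
  have hC'₀ : 0 ≤ C' := by linarith
  clear hC'
  refine ⟨C', hC'₀, fun u k hu j => ?_⟩
  induction j using Nat.strong_induction_on generalizing u with
  | _ j ih =>
  intro hj a hmin
  rw [card_cube] at hmin
  rcases lt_or_ge j 2 with hj₂ | hj₂
  · have h₁ := cnt_le_of_minority (a := a) (u := u) (s := 2 ^ j) (by positivity) hmin
    have h₂ : 2 ^ j ≤ 2 := by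
      calc 2 ^ j ≤ 2 ^ 1 := Nat.pow_le_pow_right (by norm_num) (by lia)
        _ = 2 := by norm_num
    have h₃ : cnt u (cube a (2 ^ j)) ≤ 8 * (faces u (cube a (2 ^ j))).card := by
      refine h₁.trans (Nat.mul_le_mul_right _ (by lia))
    calc |wt ν u (cube a (2 ^ j))| ≤ c * cnt u (cube a (2 ^ j)) := abs_wt_le hc _ _
      _ ≤ c * (8 * (faces u (cube a (2 ^ j))).card) := by
        gcongr
        exact_mod_cast h₃
      _ = 8 * c * (faces u (cube a (2 ^ j))).card := by ring
      _ ≤ _ := by gcongr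
  have hcompl := cnt_add_cnt_compl u (cube a (2 ^ j))
  rw [card_cube] at hcompl
  by_cases hbal : (2 ^ j) ^ (2 * d + 2) ≤ Θ * (cnt u (cube a (2 ^ j)) * cnt uᶜ (cube a (2 ^ j)))
  · obtain ⟨i, S, F, hS, hSne, hF, hFr, hSc, hSF⟩ := hLK u k j hu hj₂ hj a hbal
    obtain ⟨y, hy⟩ := hSne
    have hlt : ∀ x ∈ cube a (2 ^ j), scale i F a j x < j := by
      intro x hx
      obtain ⟨h₁, h₂, -⟩ := hSF y hy
      refine scale_lt_of_mem (z := i.insertNth (F y) y) (by lia) hx ?_ (by simp)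
      refine insertNth_mem_cube.2 ⟨?_, hS hy⟩
      push_cast; lia
    have h₁ := abs_sum_majorityInd_mul_le hC hF hFr hlt u
    have h₂ := abs_wt_sub_le_of_pieces (ν := ν) hC'₀ (u := u) hlt (fun j' hj' a' v hv hm => by
      rcases hv with rfl | rfl
      · exact ih j' hj' _ hu (by lia) a' hm
      · rw [← faces_compl]
        exact ih j' hj' _ hu.compl (by lia) a' hm) hS hSF
    have h₃ := hu.card_faces_le_real hj a
    have h₄ : (2 : ℝ) ^ (j * d) ≤ K * S.card := by
      rw [pow_mul]
      exact_mod_cast hSc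
    have h₅ : C * (7 * (faces u (cube a (2 ^ j))).card + 2 * 2 ^ (j * d)) ≤ C' * S.card := by
      calc C * (7 * (faces u (cube a (2 ^ j))).card + 2 * 2 ^ (j * d))
          ≤ C * (7 * (4 * (d + 1) * 2 ^ (j * d)) + 2 * 2 ^ (j * d)) := by gcongr
        _ = C * (28 * (d + 1) + 2) * 2 ^ (j * d) := by ring
        _ ≤ C * (28 * (d + 1) + 2) * (K * S.card) := by gcongr
        _ = C * (28 * (d + 1) + 2) * K * S.card := by ring
        _ ≤ _ := by gcongr
    have h₆ := abs_sub_abs_le_abs_sub (wt ν u (cube a (2 ^ j)))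
      (∑ x ∈ cube a (2 ^ j), majorityInd i F a j u x * ν x)
    linarith
  · push Not at hbal
    have hpart := isPartition_grid a (s := 2 ^ (j - 1)) (t := 2 ^ j) (by positivity)
      (pow_dvd_pow 2 (by lia))
    have hsmall : 2 * cnt u (cube a (2 ^ j)) ≤ (2 ^ (j - 1)) ^ (d + 1) := by
      by_contra hcon
      push Not at hcon
      refine hbal.not_ge ?_
      have h₁ : (2 ^ j) ^ (d + 1) ≤ 2 * cnt uᶜ (cube a (2 ^ j)) := by lia
      have h₂ : (2 ^ j) ^ (d + 1) = 2 ^ (d + 1) * (2 ^ (j - 1)) ^ (d + 1) := by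
        rw [← mul_pow, ← pow_succ', show j - 1 + 1 = j by lia]
      calc (2 ^ j) ^ (2 * d + 2) = (2 ^ j) ^ (d + 1) * (2 ^ j) ^ (d + 1) := by
            rw [← pow_add]; congr 1; ring
        _ ≤ (2 ^ (d + 1) * (2 * cnt u (cube a (2 ^ j)))) * (2 * cnt uᶜ (cube a (2 ^ j))) := by
            refine Nat.mul_le_mul ?_ h₁
            rw [h₂]
            exact Nat.mul_le_mul_left _ hcon.le
        _ = _ := by rw [hΘ, pow_add 2 d 3, pow_succ]; ring
    rw [hpart.wt_eq]
    refine (Finset.abs_sum_le_sum_abs _ _).trans ((Finset.sum_le_sum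
      (g := fun p => C' * ((faces u (cube p.1 p.2)).card : ℝ)) ?_).trans ?_)
    · intro p hp
      obtain ⟨x, hx, rfl⟩ := Finset.mem_image.1 hp
      refine ih (j - 1) (by lia) u hu (by lia) _ ?_
      rw [card_cube]
      exact (Nat.mul_le_mul_left _ (cnt_mono (hpart.subset x hx))).trans hsmall
    · rw [← Finset.mul_sum]
      refine mul_le_mul_of_nonneg_left ?_ hC'₀
      exact_mod_cast hpart.sum_faces_le u

lemma cnt_le_mul_faces_add_slice (u : Set (Fin (d + 1) → ℤ)) (a : Fin (d + 1) → ℤ) (s : ℕ) :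
    cnt u (cube a s) ≤ s * ((faces u (cube a s)).card + slice u (cube a s)) := by
  classical
  set T := ((cube a s).filter (· ∈ u)).image (fun x => (0 : Fin (d + 1)).removeNth x) with hT
  have h₁ : cnt u (cube a s) ≤ s * T.card := by
    refine Finset.card_le_mul_card_image _ _ fun y _ => ?_
    have : s = (Finset.Ico (a 0) (a 0 + s)).card := by simp
    conv_rhs => rw [this]
    refine Finset.card_le_card_of_injOn (fun x => x 0) ?_ ?_
    · intro x hx
      have := mem_cube.1 (Finset.mem_filter.1 (Finset.mem_filter.1 hx).1).1 0
      simpa using this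
    · intro x hx x' hx' h
      have h₁ := (Finset.mem_filter.1 hx).2
      have h₂ := (Finset.mem_filter.1 hx').2
      dsimp only at h h₁ h₂
      rw [← Fin.insertNth_self_removeNth 0 x, ← Fin.insertNth_self_removeNth 0 x', h, h₁, h₂]
  refine h₁.trans (Nat.mul_le_mul_left _ ?_)
  have h₂ : T ⊆ (faces u (cube a s) ∪ sliceUp u (cube a s)).image
      (fun p => (0 : Fin (d + 1)).removeNth p.1) := by
    intro y hy
    obtain ⟨x, hx, rfl⟩ := Finset.mem_image.1 hy
    obtain ⟨hx, hxu⟩ := Finset.mem_filter.1 hx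
    obtain ⟨z, hz, hmax⟩ := Finset.exists_max_image ((cube a s).filter fun z =>
      z ∈ u ∧ (0 : Fin (d + 1)).removeNth z = (0 : Fin (d + 1)).removeNth x) (fun z => z 0)
      ⟨x, by simp [hx, hxu]⟩
    obtain ⟨hz, hzu, hzx⟩ := Finset.mem_filter.1 hz
    have hrem : (0 : Fin (d + 1)).removeNth (z + Pi.single 0 1) =
        (0 : Fin (d + 1)).removeNth z := by
      funext l
      simp [Fin.removeNth]
    refine Finset.mem_image.2 ⟨(z, 0), ?_, hzx⟩
    by_cases hz' : z + Pi.single 0 1 ∈ cube a s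
    · refine Finset.mem_union_left _ (mem_faces.2 ⟨hz, hz', fun hcon => ?_⟩)
      have := hmax (z + Pi.single 0 1) (Finset.mem_filter.2 ⟨hz', hcon.1 hzu, hrem.trans hzx⟩)
      simp at this
    · refine Finset.mem_union_right _ ?_
      simp [sliceUp, hz, hz', hzu]
  refine (Finset.card_le_card h₂).trans (Finset.card_image_le.trans
    ((Finset.card_union_le _ _).trans ?_))
  rw [slice]
  lia

lemma ColumnBound.abs_sum_cube_le {ν : (Fin (d + 1) → ℤ) → ℝ} {C : ℝ} (h : ColumnBound ν 1 C)
    (a : Fin (d + 1) → ℤ) {s : ℕ} (hs : 0 < s) : |∑ x ∈ cube a s, ν x| ≤ C * s ^ d := by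
  have h₁ := h 0 ((0 : Fin (d + 1)).removeNth a) s hs (fun _ => a 0)
    (fun x y D _ => by simp) (a 0 + s) (fun y _ => by simp)
  rw [sum_cube_eq_sum_lines 0]
  simpa [column] using h₁

lemma exists_abs_wt_le_of_slice_le {ν : (Fin (d + 1) → ℤ) → ℝ} {c : ℝ} (hc : ∀ x, |ν x| ≤ c)
    (hν : ∀ L, ∃ C, ColumnBound ν L C) :
    ∃ C : ℝ, 0 ≤ C ∧ ∀ u k, NoProfit u k → ∀ a : Fin (d + 1) → ℤ,
      2 * slice u (cube a (2 ^ (k + 1))) ≤ (faces u (cube a (2 ^ (k + 1)))).card →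
      |wt ν u (cube a (2 ^ (k + 1)))| ≤ C * (faces u (cube a (2 ^ (k + 1)))).card := by
  obtain ⟨C', hC'₀, hC'⟩ := exists_abs_wt_le_of_minority hc hν
  obtain ⟨C₀, hC₀⟩ := hν 1
  have hC₀' := hC₀.nonneg
  refine ⟨C' + 6 * C₀, by positivity, fun u k hu a hsl => ?_⟩
  have hs : (0 : ℝ) < 2 ^ k := by positivity
  have hpart := isPartition_grid a (s := 2 ^ k) (t := 2 ^ (k + 1)) (by positivity)
    (pow_dvd_pow 2 (by lia))
  have hcnt := cnt_le_mul_faces_add_slice u a (2 ^ (k + 1))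
  have hcnt' : (cnt u (cube a (2 ^ (k + 1))) : ℝ) ≤
      3 * 2 ^ k * (faces u (cube a (2 ^ (k + 1)))).card := by
    have : cnt u (cube a (2 ^ (k + 1))) ≤ 3 * 2 ^ k * (faces u (cube a (2 ^ (k + 1)))).card := by
      calc _ ≤ _ := hcnt
        _ = 2 ^ k * (2 * (faces u (cube a (2 ^ (k + 1)))).card +
            2 * slice u (cube a (2 ^ (k + 1)))) := by ring
        _ ≤ 2 ^ k * (2 * (faces u (cube a (2 ^ (k + 1)))).card +
            (faces u (cube a (2 ^ (k + 1)))).card) := by gcongr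
        _ = _ := by ring
    exact_mod_cast this
  have hpiece : ∀ p ∈ (cube a (2 ^ (k + 1))).image fun x => (gridCorner a (2 ^ k) x, 2 ^ k),
      |wt ν u (cube p.1 p.2)| ≤ C' * (faces u (cube p.1 p.2)).card +
        2 * C₀ / 2 ^ k * cnt u (cube p.1 p.2) := by
    intro p hp
    obtain ⟨x, -, rfl⟩ := Finset.mem_image.1 hp
    dsimp only
    set q := cube (gridCorner a (2 ^ k) x) (2 ^ k) with hq
    by_cases hm : IsMajority u q
    · have h₁ := hC' uᶜ k hu.compl k le_rfl _ hm
      rw [← hq, faces_compl] at h₁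
      have h₂ := hC₀.abs_sum_cube_le (gridCorner a (2 ^ k) x) (s := 2 ^ k) (by positivity)
      rw [← hq, ← wt_add_wt_compl ν u q] at h₂
      have h₃ := cnt_add_cnt_compl u q
      have h₄ : q.card ≤ 2 * cnt u q := by
        rw [IsMajority] at hm
        lia
      rw [hq, card_cube, ← hq] at h₄
      have h₅ : ((2 : ℝ) ^ k) ^ (d + 1) ≤ 2 * cnt u q := by exact_mod_cast h₄
      have h₆ : C₀ * ((2 ^ k : ℕ) : ℝ) ^ d ≤ 2 * C₀ / 2 ^ k * cnt u q := by
        rw [div_mul_eq_mul_div, le_div_iff₀ hs]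
        push_cast
        calc C₀ * ((2 : ℝ) ^ k) ^ d * 2 ^ k = C₀ * ((2 : ℝ) ^ k) ^ (d + 1) := by ring
          _ ≤ C₀ * (2 * cnt u q) := by gcongr
          _ = _ := by ring
      have h₇ := abs_sub_abs_le_abs_sub (wt ν u q) (-wt ν uᶜ q)
      rw [sub_neg_eq_add, abs_neg] at h₇
      linarith
    · have h₁ := hC' u k hu k le_rfl _ (two_mul_cnt_le_of_not_isMajority hm)
      refine h₁.trans (le_add_of_nonneg_right (by positivity))
  rw [hpart.wt_eq]
  have h₁ : (∑ p ∈ (cube a (2 ^ (k + 1))).image fun x => (gridCorner a (2 ^ k) x, 2 ^ k),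
      ((faces u (cube p.1 p.2)).card : ℝ)) ≤ (faces u (cube a (2 ^ (k + 1)))).card := by
    exact_mod_cast hpart.sum_faces_le u
  have h₂ : (∑ p ∈ (cube a (2 ^ (k + 1))).image fun x => (gridCorner a (2 ^ k) x, 2 ^ k),
      (cnt u (cube p.1 p.2) : ℝ)) = cnt u (cube a (2 ^ (k + 1))) := by
    exact_mod_cast (hpart.cnt_eq u).symm
  calc _ ≤ _ := Finset.abs_sum_le_sum_abs _ _
    _ ≤ _ := Finset.sum_le_sum hpiece
    _ = C' * (∑ p ∈ (cube a (2 ^ (k + 1))).image fun x => (gridCorner a (2 ^ k) x, 2 ^ k),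
      ((faces u (cube p.1 p.2)).card : ℝ)) + 2 * C₀ / 2 ^ k * cnt u (cube a (2 ^ (k + 1))) := by
        rw [Finset.sum_add_distrib, ← Finset.mul_sum, ← Finset.mul_sum, h₂]
    _ ≤ C' * (faces u (cube a (2 ^ (k + 1)))).card + 2 * C₀ / 2 ^ k *
        (3 * 2 ^ k * (faces u (cube a (2 ^ (k + 1)))).card) := by gcongr
    _ = _ := by field_simp; ring

lemma bdrySet_finite {u : Set (Fin n → ℤ)} (hu : u.Finite) : (bdrySet u).Finite := by
  refine ((hu.prod (Set.finite_univ (α := Fin n))).union ((hu.prod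
    (Set.finite_univ (α := Fin n))).image fun p => (p.1 - Pi.single p.2 1, p.2))).subset ?_
  rintro ⟨x, i⟩ hx
  by_cases h : x ∈ u
  · exact Or.inl ⟨h, Set.mem_univ _⟩
  · refine Or.inr ⟨(x + Pi.single i 1, i), ⟨?_, Set.mem_univ _⟩, by simp⟩
    by_contra h'
    exact hx (iff_of_false h h')

lemma exists_not_noProfit {U : Finset (Fin (d + 1) → ℤ)} (hU : U.Nonempty) :
    ∃ k, ¬ NoProfit (U : Set (Fin (d + 1) → ℤ)) k := by
  obtain ⟨N, hN⟩ : ∃ N : ℕ, ∀ x ∈ U, ∀ l, |x l| < N := by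
    obtain ⟨N, hN⟩ := (U.image fun x => ∑ l, (x l).natAbs).bddAbove
    refine ⟨N + 1, fun x hx l => ?_⟩
    have h₁ := hN (Finset.mem_coe.2 (Finset.mem_image_of_mem _ hx))
    have h₂ := Finset.single_le_sum (f := fun l => (x l).natAbs) (fun _ _ => Nat.zero_le _)
      (Finset.mem_univ l)
    rw [Int.abs_eq_natAbs]
    exact_mod_cast Nat.lt_succ_of_le (h₂.trans h₁)
  have hN2 : (N : ℤ) < 2 ^ N := by exact_mod_cast Nat.lt_two_pow_self
  refine ⟨N + 1, fun hP => ?_⟩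
  obtain ⟨x, hx, hmax⟩ := Finset.exists_max_image U (fun x => x 0) hU
  have hin : ∀ x ∈ U, ∀ l, -2 ^ N < x l ∧ x l < 2 ^ N - 1 := by
    intro x hx l
    have := abs_lt.1 (hN x hx l)
    lia
  set Q : Finset (Fin (d + 1) → ℤ) := cube (fun _ => -2 ^ N) (2 ^ (N + 1)) with hQ
  have hmem : ∀ z, (∀ l, -2 ^ N ≤ z l ∧ z l < 2 ^ N) → z ∈ Q := fun z hz => mem_cube.2 fun l => by
    have := hz l
    push_cast
    rw [pow_succ]
    lia
  have hup : ∀ x ∈ U, ∀ i, x + Pi.single i 1 ∈ Q := fun x hx i => hmem _ fun l => by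
    have := hin x hx l
    rcases eq_or_ne l i with rfl | hl
    · simp only [Pi.add_apply, Pi.single_eq_same]; lia
    · simp only [Pi.add_apply, Pi.single_eq_of_ne hl]; lia
  have hpos : 0 < (faces (U : Set (Fin (d + 1) → ℤ)) Q).card := by
    refine Finset.card_pos.2 ⟨(x, 0), mem_faces.2 ⟨hmem x fun l => ?_, hup x hx 0, fun h => ?_⟩⟩
    · have := hin x hx l
      lia
    · have := hmax _ (Finset.mem_coe.1 (h.1 hx))
      simp at this
  have h := (hP (N + 1) le_rfl (fun _ => -2 ^ N) hpos).1
  have h₁ : sliceUp (U : Set (Fin (d + 1) → ℤ)) Q = ∅ := by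
    refine Finset.eq_empty_of_forall_notMem fun p hp => ?_
    obtain ⟨-, h₁, h₂⟩ := coord_of_mem_sliceUp hp
    have := hin _ (Finset.mem_coe.1 h₁) p.2
    push_cast at h₂
    rw [pow_succ] at h₂
    lia
  have h₂ : sliceDown (U : Set (Fin (d + 1) → ℤ)) Q = ∅ := by
    refine Finset.eq_empty_of_forall_notMem fun p hp => ?_
    obtain ⟨-, h₁, h₂⟩ := coord_of_mem_sliceDown hp
    have := hin _ (Finset.mem_coe.1 h₁) p.2
    lia
  rw [← hQ, slice, h₁, h₂] at h
  simp at h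

/-- If the weight `ν` has bounded column sums, then the weight of every finite set of cells is
bounded by its perimeter. -/
theorem exists_abs_sum_le_ncard_bdrySet {ν : (Fin (d + 1) → ℤ) → ℝ} {c : ℝ}
    (hc : ∀ x, |ν x| ≤ c) (hν : ∀ L, ∃ C, ColumnBound ν L C) :
    ∃ B : ℝ, 0 ≤ B ∧ ∀ U : Finset (Fin (d + 1) → ℤ),
      |∑ x ∈ U, ν x| ≤ B * (bdrySet (U : Set (Fin (d + 1) → ℤ))).ncard := by
  classical
  obtain ⟨C, hC₀, hC⟩ := exists_abs_wt_le_of_slice_le hc hν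
  refine ⟨2 * C, by positivity, fun U => ?_⟩
  induction hP : (bdrySet (U : Set (Fin (d + 1) → ℤ))).ncard using Nat.strong_induction_on
    generalizing U with
  | _ P ih =>
  rcases U.eq_empty_or_nonempty with rfl | hU
  · simp; positivity
  obtain ⟨k, hk, hkmin⟩ : ∃ k, ¬ NoProfit (U : Set (Fin (d + 1) → ℤ)) k ∧
      ∀ j < k, NoProfit (U : Set (Fin (d + 1) → ℤ)) j := by
    have h := exists_not_noProfit hU
    exact ⟨Nat.find h, Nat.find_spec h, fun j hj => not_not.1 (Nat.find_min h hj)⟩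
  have hk' := hk
  rw [NoProfit] at hk'
  push Not at hk'
  obtain ⟨j, hjk, a, hpos, hprof⟩ := hk'
  obtain rfl : j = k := by
    by_contra hne
    have h := hkmin j (by lia) j le_rfl a hpos
    have := hprof h.1
    lia
  obtain ⟨k, rfl⟩ : ∃ k, j = k + 1 := by
    refine ⟨j - 1, ?_⟩
    have : j ≠ 0 := by
      rintro rfl
      obtain ⟨⟨x, i⟩, hp⟩ := Finset.card_pos.1 hpos
      obtain ⟨h₁, h₂, -⟩ := mem_faces.1 hp
      have h₁ := mem_cube.1 h₁ i
      have h₂ := mem_cube.1 h₂ i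
      simp only [Pi.add_apply, Pi.single_eq_same, pow_zero] at h₁ h₂
      lia
    lia
  have hnp := hkmin k (by lia)
  set Q := cube a (2 ^ (k + 1)) with hQ
  set m := (faces (U : Set (Fin (d + 1) → ℤ)) Q).card with hm
  have key : ∀ (V : Finset (Fin (d + 1) → ℤ)) (w : ℝ),
      2 * (bdrySet (V : Set (Fin (d + 1) → ℤ))).ncard + m ≤ 2 * P → |w| ≤ C * m →
      ∑ x ∈ U, ν x = ∑ x ∈ V, ν x + w → |∑ x ∈ U, ν x| ≤ 2 * C * P := by
    intro V w h₁ h₂ h₃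
    have h₄ := ih _ (by lia) V rfl
    have h₅ : (2 * (bdrySet (V : Set (Fin (d + 1) → ℤ))).ncard + m : ℝ) ≤ 2 * P := by
      exact_mod_cast h₁
    rw [h₃]
    refine (abs_add_le _ _).trans ((add_le_add h₄ h₂).trans ?_)
    nlinarith
  have hfin := bdrySet_finite U.finite_toSet
  by_cases hcase : m < 2 * slice (U : Set (Fin (d + 1) → ℤ)) Q
  · have hsl := hprof hcase
    have h₁ := ncard_bdrySet_diff_add_le (u := (U : Set (Fin (d + 1) → ℤ))ᶜ)
      (by rwa [bdrySet_compl]) Q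
    have h₂ := hC _ k hnp.compl a (by rwa [faces_compl])
    rw [faces_compl] at h₁ h₂
    rw [bdrySet_compl (U : Set (Fin (d + 1) → ℤ))] at h₁
    rw [← bdrySet_compl (_ \ _), show ((U : Set (Fin (d + 1) → ℤ))ᶜ \ (Q : Set _))ᶜ =
      ((U ∪ Q : Finset _) : Set (Fin (d + 1) → ℤ)) by
        ext x
        simp only [Set.mem_compl_iff, Set.mem_sdiff, Finset.mem_coe, Finset.mem_union]
        tauto] at h₁
    refine key (U ∪ Q) (-wt ν (U : Set (Fin (d + 1) → ℤ))ᶜ Q) (by lia) (by rwa [abs_neg]) ?_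
    have h₃ : wt ν (U : Set (Fin (d + 1) → ℤ))ᶜ Q = ∑ x ∈ Q \ U, ν x :=
      Finset.sum_congr (by ext x; simp) fun _ _ => rfl
    rw [← Finset.union_sdiff_self_eq_union, Finset.sum_union Finset.disjoint_sdiff, h₃]
    ring
  · push Not at hcase
    have h₁ := ncard_bdrySet_diff_add_le hfin Q
    have h₂ := hC _ k hnp a hcase
    rw [← Finset.coe_sdiff] at h₁
    refine key (U \ Q) (wt ν (U : Set (Fin (d + 1) → ℤ)) Q) (by lia) h₂ ?_
    have h₃ : wt ν (U : Set (Fin (d + 1) → ℤ)) Q = ∑ x ∈ U ∩ Q, ν x :=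
      Finset.sum_congr (by ext x; simp [and_comm]) fun _ _ => rfl
    linarith [Finset.sum_inter_add_sum_sdiff U Q ν]

lemma exists_homeomorph_box {u v : Fin n → ℝ} (huv : ∀ l, u l < v l) :
    ∃ h : EuclideanSpace ℝ (Fin n) ≃ₜ EuclideanSpace ℝ (Fin n),
      h '' {z | ∀ l, u l ≤ z l ∧ z l ≤ v l} = Metric.closedBall 0 1 := by
  let e := PiLp.continuousLinearEquiv 2 ℝ (fun _ : Fin n => ℝ)
  have hbox : {z : EuclideanSpace ℝ (Fin n) | ∀ l, u l ≤ z l ∧ z l ≤ v l} =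
      e ⁻¹' Set.Icc u v := by
    ext z
    simp only [Set.mem_ofPred_eq, Set.mem_preimage, Set.mem_Icc, Pi.le_def, ← forall_and]
    rfl
  have hcomp : IsCompact (e ⁻¹' Set.Icc u v) :=
    e.toHomeomorph.isCompact_preimage.2 isCompact_Icc
  have hne : (interior (e ⁻¹' Set.Icc u v)).Nonempty := by
    refine ⟨e.symm fun l => (u l + v l) / 2, ?_⟩
    refine interior_maximal (t := e ⁻¹' Set.univ.pi fun l => Set.Ioo (u l) (v l)) ?_
      ((isOpen_set_pi Set.finite_univ fun l _ => isOpen_Ioo).preimage e.continuous) ?_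
    · intro z hz
      exact ⟨fun l => (hz l trivial).1.le, fun l => (hz l trivial).2.le⟩
    · simp only [Set.mem_preimage, ContinuousLinearEquiv.apply_symm_apply, Set.mem_univ_pi,
        Set.mem_Ioo]
      intro l
      have := huv l
      constructor <;> linarith
  obtain ⟨h, -, hc, -⟩ := exists_homeomorph_image_interior_closure_frontier_eq_unitBall
    ((convex_Icc u v).linear_preimage (e : EuclideanSpace ℝ (Fin n) →ₗ[ℝ] Fin n → ℝ)) hne
    hcomp.isBounded
  refine ⟨h, ?_⟩
  rw [hbox, ← hc]
  congr 1
  exact hcomp.isClosed.closure_eq.symm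

/-- The points of `ℝᵈ⁺¹` over a box in the coordinate hyperplane orthogonal to `i`, between
height `σ` and the graph of `G`. -/
def undergraph (i : Fin (d + 1)) (u v : Fin d → ℝ) (σ : ℝ) (G : (Fin d → ℝ) → ℝ) :
    Set (EuclideanSpace ℝ (Fin (d + 1))) :=
  {z | (∀ l, u l ≤ z (i.succAbove l) ∧ z (i.succAbove l) ≤ v l) ∧
    σ ≤ z i ∧ z i ≤ G fun l => z (i.succAbove l)}

/-- The homeomorphism rescaling the last coordinate by a positive function of the others. -/
noncomputable def verticalScale (i : Fin (d + 1)) (σ : ℝ) (g : (Fin d → ℝ) → ℝ)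
    (hg : Continuous g) (hpos : ∀ w, 0 < g w) :
    EuclideanSpace ℝ (Fin (d + 1)) ≃ₜ EuclideanSpace ℝ (Fin (d + 1)) where
  toFun z := WithLp.toLp 2 (Function.update z i (σ + (z i - σ) * g fun l => z (i.succAbove l)))
  invFun z := WithLp.toLp 2 (Function.update z i (σ + (z i - σ) / g fun l => z (i.succAbove l)))
  left_inv z := by
    ext l
    have := (hpos fun l => z (i.succAbove l)).ne'
    rcases Fin.eq_self_or_eq_succAbove i l with rfl | ⟨m, rfl⟩
    · simp [this]
    · simp
  right_inv z := by
    ext l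
    have := (hpos fun l => z (i.succAbove l)).ne'
    rcases Fin.eq_self_or_eq_succAbove i l with rfl | ⟨m, rfl⟩
    · simp [this]
    · simp
  continuous_toFun := by
    have h : Continuous fun z : EuclideanSpace ℝ (Fin (d + 1)) =>
      g fun l => z (i.succAbove l) := hg.comp (by fun_prop)
    exact (PiLp.continuous_toLp 2 _).comp ((PiLp.continuous_ofLp 2 _).update i (by fun_prop))
  continuous_invFun := by
    have h : Continuous fun z : EuclideanSpace ℝ (Fin (d + 1)) =>
      g fun l => z (i.succAbove l) := hg.comp (by fun_prop)
    exact (PiLp.continuous_toLp 2 _).comp ((PiLp.continuous_ofLp 2 _).update i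
      (continuous_const.add (Continuous.div (by fun_prop) h fun z => (hpos _).ne.symm)))

/-- The undergraph of a continuous function over a box is a topological ball. -/
lemma undergraph_isCompact_and_homeomorph (i : Fin (d + 1)) {u v : Fin d → ℝ} (huv : ∀ l, u l < v l)
    {σ : ℝ} {G : (Fin d → ℝ) → ℝ} (hG : Continuous G) (hσ : ∀ w, σ < G w) :
    IsCompact (undergraph i u v σ G) ∧ Nonempty (undergraph i u v σ G ≃ₜ
      (Metric.closedBall (0 : EuclideanSpace ℝ (Fin (d + 1))) 1 : Set _)) := by
  have hpos : ∀ w, 0 < G w - σ := fun w => sub_pos.2 (hσ w)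
  let Φ := verticalScale i σ (fun w => G w - σ) (by fun_prop) hpos
  obtain ⟨h, hh⟩ := exists_homeomorph_box (n := d + 1) (u := i.insertNth σ u)
    (v := i.insertNth (σ + 1) v) (by
      intro l
      rcases Fin.eq_self_or_eq_succAbove i l with rfl | ⟨m, rfl⟩
      · simp
      · simpa using huv m)
  let Ψ := Φ.symm.trans h
  have himg : Ψ '' undergraph i u v σ G = Metric.closedBall 0 1 := by
    rw [← hh]
    change (h ∘ Φ.symm) '' _ = _
    rw [Set.image_comp, Homeomorph.image_symm]
    congr 1
    ext z
    simp only [Set.mem_preimage, undergraph, Set.mem_ofPred_eq]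
    rw [Fin.forall_iff_succAbove i]
    have := hpos fun l => z (i.succAbove l)
    have hi : Φ z i = σ + (z i - σ) * (G (fun l => z (i.succAbove l)) - σ) := by
      simp [Φ, verticalScale]
    have hl : ∀ l, Φ z (i.succAbove l) = z (i.succAbove l) := by
      simp [Φ, verticalScale]
    simp only [hi, hl, Fin.insertNth_apply_same, Fin.insertNth_apply_succAbove]
    rw [and_comm]
    refine and_congr (and_congr ?_ ?_) Iff.rfl
    · constructor
      · intro h'
        by_contra hc
        nlinarith
      · intro h'
        nlinarith
    · constructor
      · intro h'
        by_contra hc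
        nlinarith
      · intro h'
        nlinarith
  constructor
  · rw [← Ψ.isCompact_image, himg]
    exact isCompact_closedBall 0 1
  · rw [← himg]
    exact ⟨Ψ.image _⟩

/-- The half-open unit cell with lower corner `x`. -/
def cell (x : Fin n → ℤ) : Set (EuclideanSpace ℝ (Fin n)) := {z | ∀ l, ⌊z l⌋ = x l}

lemma mem_cell_floor (z : EuclideanSpace ℝ (Fin n)) : z ∈ cell fun l => ⌊z l⌋ := fun _ => rfl

lemma cell_eq_preimage (x : Fin n → ℤ) : cell x =
    (WithLp.ofLp : EuclideanSpace ℝ (Fin n) → (Fin n → ℝ)) ⁻¹'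
      Set.univ.pi fun l => Set.Ico (x l : ℝ) (x l + 1) := by
  ext z
  simp [cell, Int.floor_eq_iff]

lemma measurableSet_cell (x : Fin n → ℤ) : MeasurableSet (cell x) := by
  rw [cell_eq_preimage]
  exact (PiLp.volume_preserving_ofLp (Fin n)).measurable
    (MeasurableSet.univ_pi fun _ => measurableSet_Ico)

lemma volume_cell (x : Fin n → ℤ) : volume (cell x) = 1 := by
  rw [cell_eq_preimage, (PiLp.volume_preserving_ofLp (Fin n)).measure_preimage
    (MeasurableSet.univ_pi fun _ => measurableSet_Ico).nullMeasurableSet, Real.volume_pi_Ico]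
  simp

lemma disjoint_cell {x y : Fin n → ℤ} (h : x ≠ y) : Disjoint (cell x) (cell y) :=
  Set.disjoint_left.2 fun _ hx hy => h (funext fun l => (hx l).symm.trans (hy l))

lemma measureReal_biUnion_cell {m : Measure (EuclideanSpace ℝ (Fin n))}
    (hm : ∀ x, m (cell x) ≠ ⊤) (A : Finset (Fin n → ℤ)) :
    m.real (⋃ x ∈ A, cell x) = ∑ x ∈ A, m.real (cell x) :=
  measureReal_biUnion_finset (fun _ _ _ _ h => disjoint_cell h)
    (fun x _ => measurableSet_cell x) fun x _ => hm x

lemma measure_biUnion_cell_ne_top {m : Measure (EuclideanSpace ℝ (Fin n))}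
    (hm : ∀ x, m (cell x) ≠ ⊤) (A : Finset (Fin n → ℤ)) : m (⋃ x ∈ A, cell x) ≠ ⊤ :=
  (measure_biUnion_lt_top A.finite_toSet fun x _ => (hm x).lt_top).ne

/-- A set agreeing with a union of cells off the cells in `Z` has almost the same measure. -/
lemma abs_measureReal_sub_sum_le {m : Measure (EuclideanSpace ℝ (Fin n))} {N : ℝ}
    (hm : ∀ x, m (cell x) ≠ ⊤) (hN : ∀ x, m.real (cell x) ≤ N) {A Z : Finset (Fin n → ℤ)}
    {U : Set (EuclideanSpace ℝ (Fin n))} (hU : m U ≠ ⊤)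
    (h : ∀ z, (fun l => ⌊z l⌋) ∉ Z → ((fun l => ⌊z l⌋) ∈ A ↔ z ∈ U)) :
    |m.real U - ∑ x ∈ A, m.real (cell x)| ≤ N * Z.card := by
  have hZ : m.real (⋃ x ∈ Z, cell x) ≤ N * Z.card := by
    rw [measureReal_biUnion_cell hm, mul_comm, ← nsmul_eq_mul]
    exact Finset.sum_le_card_nsmul _ _ _ fun x _ => hN x
  have hZt := measure_biUnion_cell_ne_top hm Z
  have hAt := measure_biUnion_cell_ne_top hm A
  rw [← measureReal_biUnion_cell hm A, abs_le]
  have h₁ : U ⊆ (⋃ x ∈ A, cell x) ∪ ⋃ x ∈ Z, cell x := by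
    intro z hz
    by_cases hzZ : (fun l => ⌊z l⌋) ∈ Z
    · exact Or.inr (Set.mem_iUnion₂.2 ⟨_, hzZ, mem_cell_floor z⟩)
    · exact Or.inl (Set.mem_iUnion₂.2 ⟨_, (h z hzZ).2 hz, mem_cell_floor z⟩)
  have h₂ : (⋃ x ∈ A, cell x) ⊆ U ∪ ⋃ x ∈ Z, cell x := by
    intro z hz
    obtain ⟨x, hx, hzx⟩ := Set.mem_iUnion₂.1 hz
    obtain rfl : (fun l => ⌊z l⌋) = x := funext hzx
    by_cases hzZ : (fun l => ⌊z l⌋) ∈ Z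
    · exact Or.inr (Set.mem_iUnion₂.2 ⟨_, hzZ, mem_cell_floor z⟩)
    · exact Or.inl ((h z hzZ).1 hx)
  have h₃ := (measureReal_mono h₁ (measure_union_ne_top hAt hZt)).trans (measureReal_union_le _ _)
  have h₄ := (measureReal_mono h₂ (measure_union_ne_top hU hZt)).trans (measureReal_union_le _ _)
  constructor <;> linarith

/-- The number of points of a uniformly discrete set in a unit cell is bounded. -/
lemma exists_ncard_inter_cell_le {X : Set (EuclideanSpace ℝ (Fin n))}
    (hud : ∃ δ > 0, ∀ x ∈ X, ∀ y ∈ X, x ≠ y → δ ≤ dist x y) :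
    ∃ N : ℕ, ∀ x, (X ∩ cell x).Finite ∧ (X ∩ cell x).ncard ≤ N := by
  obtain ⟨δ, hδ, hud⟩ := hud
  obtain ⟨K, hK⟩ := exists_nat_gt ((√n + 1) / δ)
  have hK0 : 0 < (K : ℝ) := lt_of_le_of_lt (by positivity) hK
  refine ⟨K ^ n, fun x => ?_⟩
  have hmaps : ∀ z ∈ X ∩ cell x, (fun l => ⌊(K : ℝ) * z l⌋) ∈
      ((cube (fun l => K * x l) K : Finset _) : Set (Fin n → ℤ)) := by
    rintro z ⟨-, hz⟩
    refine mem_cube.2 fun l => ?_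
    obtain ⟨h₁, h₂⟩ := Int.floor_eq_iff.1 (hz l)
    constructor
    · rw [Int.le_floor]
      push_cast
      gcongr
    · rw [Int.floor_lt]
      push_cast
      nlinarith
  have hinj : Set.InjOn (fun (z : EuclideanSpace ℝ (Fin n)) l => ⌊(K : ℝ) * z l⌋)
      (X ∩ cell x) := by
    rintro z ⟨hz, -⟩ w ⟨hw, -⟩ hzw
    by_contra hne
    have h := hud z hz w hw hne
    have hl : ∀ l, dist (z l) (w l) ≤ 1 / K := by
      intro l
      have := Int.abs_sub_lt_one_of_floor_eq_floor (congrFun hzw l)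
      rw [← mul_sub, abs_mul, abs_of_pos hK0] at this
      rw [Real.dist_eq, le_div_iff₀ hK0]
      linarith
    have hd : dist z w ≤ √n * (1 / K) := by
      rw [EuclideanSpace.dist_eq, ← Real.sqrt_sq (by positivity : (0 : ℝ) ≤ 1 / K),
        ← Real.sqrt_mul (by positivity)]
      refine Real.sqrt_le_sqrt ?_
      calc ∑ l, dist (z l) (w l) ^ 2 ≤ ∑ _l : Fin n, (1 / K : ℝ) ^ 2 := by
            gcongr with l
            exact hl l
        _ = n * (1 / K : ℝ) ^ 2 := by simp
    rw [div_lt_iff₀ hδ] at hK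
    have : √n * (1 / K) * K = √n := by field_simp
    nlinarith
  refine ⟨Set.Finite.of_injOn hmaps hinj (Finset.finite_toSet _), ?_⟩
  have := Set.ncard_le_ncard_of_injOn _ hmaps hinj (Finset.finite_toSet _)
  rwa [Set.ncard_coe_finset, card_cube] at this

/-- The signed deviation of the number of points of `X` in a cell from `ρ`. -/
noncomputable def cellDev (X : Set (EuclideanSpace ℝ (Fin n))) (ρ : ℝ) (x : Fin n → ℤ) : ℝ :=
  (X ∩ cell x).ncard - ρ

/-- The number of points in a topological ball deviates from its expected value by at most
a multiple of the volume of its collar. -/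
def BallDiscrepancy (X : Set (EuclideanSpace ℝ (Fin n))) (ρ c₁ c₂ : ℝ) : Prop :=
  ∀ U : Set (EuclideanSpace ℝ (Fin n)), IsCompact U →
    Nonempty (U ≃ₜ (Metric.closedBall (0 : EuclideanSpace ℝ (Fin n)) 1 : Set _)) →
    |((X ∩ U).ncard : ℝ) - ρ * (volume U).toReal| ≤
      c₁ + c₂ * ((volume (Metric.cthickening 1 U)).toReal -
        (volume {x ∈ U | 1 ≤ Metric.infDist x Uᶜ}).toReal)

lemma measureReal_count_restrict {X : Set (EuclideanSpace ℝ (Fin n))} (hX : X.Countable)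
    {U : Set (EuclideanSpace ℝ (Fin n))} (hU : MeasurableSet U) :
    (Measure.count.restrict X).real U = (X ∩ U).ncard := by
  rw [measureReal_restrict_apply hU, Measure.real, Measure.count_apply
    (hU.inter hX.measurableSet), Set.inter_comm, Set.ncard]
  generalize (X ∩ U).encard = k
  cases k <;> simp

lemma abs_sum_cellDev_le {X : Set (EuclideanSpace ℝ (Fin (d + 1)))} (hX : X.Countable)
    {N : ℕ} (hN : ∀ x, (X ∩ cell x).Finite ∧ (X ∩ cell x).ncard ≤ N) {ρ c₁ c₂ : ℝ} (hρ : 0 ≤ ρ)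
    (hc₂ : 0 ≤ c₂) (hball : BallDiscrepancy X ρ c₁ c₂) {A Z : Finset (Fin (d + 1) → ℤ)}
    {U : Set (EuclideanSpace ℝ (Fin (d + 1)))} (hU : IsCompact U) (hXU : (X ∩ U).Finite)
    (hUb : Nonempty (U ≃ₜ (Metric.closedBall (0 : EuclideanSpace ℝ (Fin (d + 1))) 1 : Set _)))
    (hin : ∀ z, (fun l => ⌊z l⌋) ∉ Z → (fun l => ⌊z l⌋) ∈ A → Metric.closedBall z 1 ⊆ U)
    (hout : ∀ z, (fun l => ⌊z l⌋) ∉ Z → (fun l => ⌊z l⌋) ∉ A → ∀ u ∈ U, 1 < dist z u) :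
    |∑ x ∈ A, cellDev X ρ x| ≤ c₁ + (c₂ + N + ρ) * Z.card := by
  have hiff : ∀ z, (fun l => ⌊z l⌋) ∉ Z → ((fun l => ⌊z l⌋) ∈ A ↔ z ∈ U) := by
    intro z hz
    refine ⟨fun hA => hin z hz hA (Metric.mem_closedBall_self zero_le_one), fun hzU => ?_⟩
    by_contra hA
    have := hout z hz hA z hzU
    simp at this
    linarith
  have hcellX : ∀ x, (Measure.count.restrict X) (cell x) ≠ ⊤ := by
    intro x
    rw [Measure.restrict_apply (measurableSet_cell x), Set.inter_comm]
    exact (Measure.count_apply_lt_top.2 (hN x).1).ne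
  have h₁ := abs_measureReal_sub_sum_le (m := Measure.count.restrict X) (N := N) (A := A) hcellX
    (fun x => by
      rw [measureReal_count_restrict hX (measurableSet_cell x)]
      exact_mod_cast (hN x).2) (U := U) (by
      rw [Measure.restrict_apply hU.measurableSet, Set.inter_comm]
      exact (Measure.count_apply_lt_top.2 hXU).ne) hiff
  have h₂ := abs_measureReal_sub_sum_le (m := volume) (N := 1) (A := A)
    (fun x => by simp [volume_cell]) (fun x => by simp [Measure.real, volume_cell])
    hU.measure_lt_top.ne hiff
  rw [measureReal_count_restrict hX hU.measurableSet,
    Finset.sum_congr rfl fun x _ => measureReal_count_restrict hX (measurableSet_cell x)] at h₁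
  simp only [Measure.real, volume_cell, ENNReal.toReal_one, Finset.sum_const, nsmul_eq_mul,
    mul_one, one_mul] at h₂
  have hcollar : (volume (Metric.cthickening 1 U)).toReal -
      (volume {x ∈ U | 1 ≤ Metric.infDist x Uᶜ}).toReal ≤ Z.card := by
    have hsub : Metric.cthickening 1 U \ {x ∈ U | 1 ≤ Metric.infDist x Uᶜ} ⊆
        ⋃ x ∈ Z, cell x := by
      rintro z ⟨hz, hz'⟩
      by_cases hzZ : (fun l => ⌊z l⌋) ∈ Z
      · exact Set.mem_iUnion₂.2 ⟨_, hzZ, mem_cell_floor z⟩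
      exfalso
      by_cases hA : (fun l => ⌊z l⌋) ∈ A
      · refine hz' ⟨hin z hzZ hA (Metric.mem_closedBall_self zero_le_one), ?_⟩
        rw [Metric.le_infDist (Set.nonempty_compl.2 hU.ne_univ)]
        intro y hy
        by_contra hlt
        refine hy (hin z hzZ hA ?_)
        rw [Metric.mem_closedBall, dist_comm]
        exact (not_le.1 hlt).le
      · rw [hU.cthickening_eq_biUnion_closedBall zero_le_one] at hz
        obtain ⟨u, hu, hzu⟩ := Set.mem_iUnion₂.1 hz
        exact absurd (Metric.mem_closedBall.1 hzu) (not_le.2 (hout z hzZ hA u hu))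
    have ht : volume {x ∈ U | 1 ≤ Metric.infDist x Uᶜ} ≠ ⊤ :=
      ne_top_of_le_ne_top hU.measure_lt_top.ne (measure_mono (Set.sep_subset _ _))
    have hZt := measure_biUnion_cell_ne_top (m := volume) (fun x => by simp [volume_cell]) Z
    refine ((le_measureReal_sdiff (μ := volume) ht).trans (measureReal_mono hsub hZt)).trans
      (le_of_eq ?_)
    rw [measureReal_biUnion_cell fun x => by simp [volume_cell]]
    simp [Measure.real, volume_cell]
  have h₃ := (hball U hU hUb).trans (add_le_add_right (mul_le_mul_of_nonneg_left hcollar hc₂) c₁)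
  have hsum : ∑ x ∈ A, cellDev X ρ x = ∑ x ∈ A, ((X ∩ cell x).ncard : ℝ) - ρ * A.card := by
    simp [cellDev, Finset.sum_sub_distrib, mul_comm]
  rw [hsum]
  have h₄ := abs_le.1 h₁
  have h₅ := abs_le.1 h₂
  have h₆ := abs_le.1 h₃
  have h₇ := mul_le_mul_of_nonneg_left h₅.1 hρ
  have h₈ := mul_le_mul_of_nonneg_left h₅.2 hρ
  rw [abs_le]
  constructor <;> nlinarith

lemma IsLip.exists_lipschitzWith {L : ℕ} {F : (Fin d → ℤ) → ℤ} (hF : IsLip L F) {m : ℤ}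
    (hm : ∀ y, m ≤ F y) : ∃ G : (Fin d → ℝ) → ℝ, LipschitzWith L G ∧ (∀ w, (m : ℝ) ≤ G w) ∧
      ∀ w, |G w - F fun l => ⌊w l⌋| ≤ L := by
  let ι : (Fin d → ℤ) → (Fin d → ℝ) := fun y l => y l
  have hf : LipschitzOnWith L (fun w : Fin d → ℝ => (F fun l => ⌊w l⌋ : ℝ)) (Set.range ι) := by
    refine LipschitzOnWith.of_dist_le_mul ?_
    rintro _ ⟨x, rfl⟩ _ ⟨y, rfl⟩
    have h := hF x y ⌊dist (ι x) (ι y)⌋₊ fun l => by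
      have h₁ := dist_le_pi_dist (ι x) (ι y) l
      rw [Real.dist_eq] at h₁
      have h₂ : ((x l - y l).natAbs : ℝ) ≤ dist (ι x) (ι y) := by
        rw [Nat.cast_natAbs]
        push_cast
        exact h₁
      rw [Int.abs_eq_natAbs]
      exact_mod_cast Nat.le_floor h₂
    have h₁ : (⌊dist (ι x) (ι y)⌋₊ : ℝ) ≤ dist (ι x) (ι y) := Nat.floor_le dist_nonneg
    have h₂ : |(F x : ℝ) - F y| ≤ L * (⌊dist (ι x) (ι y)⌋₊ : ℝ) := by exact_mod_cast h
    simp only [ι, Int.floor_intCast, Real.dist_eq]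
    refine h₂.trans ?_
    simp only [NNReal.coe_natCast]
    exact mul_le_mul_of_nonneg_left h₁ (Nat.cast_nonneg L)
  obtain ⟨G, hG, hGf⟩ := hf.extend_real
  refine ⟨fun w => max (m : ℝ) (G w), hG.const_max _, fun w => le_max_left _ _, fun w => ?_⟩
  have h₁ := (hG.const_max (m : ℝ)).dist_le_mul w (ι fun l => ⌊w l⌋)
  have h₂ := hGf (Set.mem_range_self fun l => ⌊w l⌋)
  simp only [ι, Int.floor_intCast] at h₁ h₂
  have h₄ : (m : ℝ) ≤ F fun l => ⌊w l⌋ := by exact_mod_cast hm _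
  rw [← h₂, max_eq_right h₄, Real.dist_eq] at h₁
  refine le_trans h₁ ?_
  have h₃ : dist w (fun l => (⌊w l⌋ : ℝ)) ≤ 1 := by
    refine (dist_pi_le_iff zero_le_one).2 fun l => ?_
    rw [Real.dist_eq, abs_of_nonneg (sub_nonneg.2 (Int.floor_le _))]
    linarith [Int.lt_floor_add_one (w l)]
  simp only [NNReal.coe_natCast]
  exact mul_le_of_le_one_right (Nat.cast_nonneg L) h₃

/-- The integer points of a cube near its boundary slabs or near the graph of `F`. -/
noncomputable def graphNbhd (i : Fin (d + 1)) (a : Fin (d + 1) → ℤ) (s W L : ℕ)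
    (F : (Fin d → ℤ) → ℤ) : Finset (Fin (d + 1) → ℤ) :=
  (({0, 1, 2, (s : ℤ) + 1, (s : ℤ) + 2, (s : ℤ) + 3} : Finset ℤ).biUnion fun k =>
    (((cube a W) ×ˢ (Finset.univ : Finset (Fin (d + 1)))).filter
      fun p => p.1 p.2 = a p.2 + k).image Prod.fst) ∪
  (Finset.Icc (-(2 * L + 1) : ℤ) (2 * L + 1)).biUnion fun k =>
    (cube a W).filter fun x => x i = F (i.removeNth x) + k

lemma card_graphNbhd_le (i : Fin (d + 1)) (a : Fin (d + 1) → ℤ) (s W L : ℕ)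
    (F : (Fin d → ℤ) → ℤ) :
    (graphNbhd i a s W L F).card ≤ (6 * (d + 1) + (4 * L + 3)) * W ^ d := by
  rw [add_mul]
  refine (Finset.card_union_le _ _).trans (add_le_add ?_ ?_)
  · rw [mul_assoc]
    refine (Finset.card_biUnion_le_card_mul _ _ ((d + 1) * W ^ d) fun k _ => ?_).trans
      (Nat.mul_le_mul_right _ Finset.card_le_six)
    refine Finset.card_image_le.trans (card_le_of_coord (a := a) (c := fun l => a l + k) ?_)
    intro p hp
    rw [Finset.mem_filter, Finset.mem_product] at hp
    exact ⟨hp.1.1, hp.2⟩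
  · refine (Finset.card_biUnion_le_card_mul _ _ (W ^ d) fun k _ => ?_).trans
      (Nat.mul_le_mul_right _ (by rw [Int.card_Icc]; lia))
    rw [← card_cube (i.removeNth a) W]
    refine Finset.card_le_card_of_injOn i.removeNth
      (fun x hx => removeNth_mem_cube i (Finset.mem_filter.1 hx).1) ?_
    intro x hx y hy hxy
    have hx' := (Finset.mem_filter.1 hx).2
    have hy' := (Finset.mem_filter.1 hy).2
    rw [← Fin.insertNth_self_removeNth i x, ← Fin.insertNth_self_removeNth i y, hx', hy', hxy]

lemma notMem_graphNbhd {i : Fin (d + 1)} {a : Fin (d + 1) → ℤ} {s W L : ℕ}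
    {F : (Fin d → ℤ) → ℤ} {x : Fin (d + 1) → ℤ} (h : x ∉ graphNbhd i a s W L F)
    (hx : x ∈ cube a W) :
    (∀ l, ¬ (a l ≤ x l ∧ x l ≤ a l + 2) ∧ ¬ (a l + s + 1 ≤ x l ∧ x l ≤ a l + s + 3)) ∧
      2 * L + 1 < |x i - F (i.removeNth x)| := by
  rw [graphNbhd, Finset.mem_union, not_or] at h
  constructor
  · intro l
    have h' : ∀ k ∈ ({0, 1, 2, (s : ℤ) + 1, (s : ℤ) + 2, (s : ℤ) + 3} : Finset ℤ), x l ≠ a l + k := by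
      intro k hk hxl
      exact h.1 (Finset.mem_biUnion.2 ⟨k, hk, Finset.mem_image.2 ⟨(x, l),
        Finset.mem_filter.2 ⟨Finset.mk_mem_product hx (Finset.mem_univ _), hxl⟩, rfl⟩⟩)
    simp only [Finset.forall_mem_insert, Finset.mem_singleton, forall_eq] at h'
    lia
  · by_contra hc
    refine h.2 (Finset.mem_biUnion.2 ⟨x i - F (i.removeNth x), Finset.mem_Icc.2 ?_,
      Finset.mem_filter.2 ⟨hx, by ring⟩⟩)
    exact abs_le.1 (not_lt.1 hc)

open Classical in
lemma exists_abs_sum_undergraph_le {X : Set (EuclideanSpace ℝ (Fin (d + 1)))} (hX : X.Countable)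
    (hud : ∃ δ > 0, ∀ x ∈ X, ∀ y ∈ X, x ≠ y → δ ≤ dist x y)
    (hfin : ∀ K, IsCompact K → (X ∩ K).Finite) {ρ c₁ c₂ : ℝ}
    (hρ : 0 ≤ ρ) (hc₁ : 0 ≤ c₁) (hc₂ : 0 ≤ c₂) (hball : BallDiscrepancy X ρ c₁ c₂) (L : ℕ) :
    ∃ C : ℝ, 0 ≤ C ∧ ∀ (i : Fin (d + 1)) (c : Fin d → ℤ) (s : ℕ), 0 < s → ∀ F, IsLip L F →
      ∀ σ : ℤ, (∀ y, σ + 1 ≤ F y ∧ F y ≤ σ + L * s) →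
        |∑ y ∈ cube c s, ∑ t ∈ Finset.Ico σ (F y), cellDev X ρ (i.insertNth t y)| ≤
          C * s ^ d := by
  obtain ⟨N, hN⟩ := exists_ncard_inter_cell_le hud
  refine ⟨c₁ + (c₂ + N + ρ) * ((6 * (d + 1) + (4 * L + 3)) * (3 * L + 5) ^ d), by positivity, ?_⟩
  intro i c s hs F hF σ hσ
  obtain ⟨G, hGL, hGσ, hGF⟩ := hF.exists_lipschitzWith fun y => (hσ y).1
  obtain ⟨W, hW⟩ : ∃ W, W = (3 * L + 5) * s := ⟨_, rfl⟩
  have hW₁ : s + 4 ≤ W := by nlinarith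
  have hW₂ : L * s + 2 * L + 4 ≤ W := by nlinarith
  let a : Fin (d + 1) → ℤ := i.insertNth (σ - 2) fun l => c l - 2
  have hai : a i = σ - 2 := by simp [a]
  have hal : ∀ l, a (i.succAbove l) = c l - 2 := by simp [a]
  let A : Finset (Fin (d + 1) → ℤ) := ((cube c s).sigma fun y => Finset.Ico σ (F y)).image
    fun p => i.insertNth p.2 p.1
  have hA : ∀ x, x ∈ A ↔ i.removeNth x ∈ cube c s ∧ σ ≤ x i ∧ x i < F (i.removeNth x) := by
    intro x
    simp only [A, Finset.mem_image, Finset.mem_sigma, Finset.mem_Ico]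
    constructor
    · rintro ⟨p, hp, rfl⟩
      simpa using hp
    · intro h
      exact ⟨⟨i.removeNth x, x i⟩, h, by simp⟩
  have hsum : ∑ y ∈ cube c s, ∑ t ∈ Finset.Ico σ (F y), cellDev X ρ (i.insertNth t y) =
      ∑ x ∈ A, cellDev X ρ x := by
    rw [Finset.sum_sigma', Finset.sum_image]
    rintro ⟨y, t⟩ - ⟨y', t'⟩ - h
    obtain ⟨rfl, rfl⟩ := Fin.insertNth_inj.1 h
    rfl
  have huv : ∀ l, (c l : ℝ) < c l + s := fun l => by
    have : (0 : ℝ) < s := by exact_mod_cast hs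
    linarith
  obtain ⟨hU, hUb⟩ := undergraph_isCompact_and_homeomorph i huv (σ := σ) hGL.continuous
    fun w => by
      have := hGσ w
      push_cast at this
      linarith
  have hdiff : ∀ z u : EuclideanSpace ℝ (Fin (d + 1)), dist z u ≤ 1 →
      (∀ l, |z l - u l| ≤ 1) ∧ |G (fun l => u (i.succAbove l)) -
        F (i.removeNth fun l => ⌊z l⌋)| ≤ 2 * L := by
    intro z u hzu
    have h : ∀ l, |z l - u l| ≤ 1 := fun l => by
      rw [← Real.dist_eq]
      exact (PiLp.dist_apply_le z u l).trans hzu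
    refine ⟨h, ?_⟩
    have h₁ := hGL.dist_le_mul (fun l => u (i.succAbove l)) fun l => z (i.succAbove l)
    have h₂ := hGF fun l => z (i.succAbove l)
    have h₃ : dist (fun l => u (i.succAbove l)) (fun l => z (i.succAbove l)) ≤ 1 := by
      refine (dist_pi_le_iff zero_le_one).2 fun l => ?_
      rw [Real.dist_eq, abs_sub_comm]
      exact h _
    rw [Real.dist_eq, NNReal.coe_natCast] at h₁
    have h₄ : (L : ℝ) * dist (fun l => u (i.succAbove l)) (fun l => z (i.succAbove l)) ≤ L :=
      mul_le_of_le_one_right (Nat.cast_nonneg L) h₃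
    have h₅ := abs_le.1 (h₁.trans h₄)
    have h₆ : |G (fun l => z (i.succAbove l)) - F (i.removeNth fun l => ⌊z l⌋)| ≤ L := h₂
    rw [abs_le] at h₆ ⊢
    constructor <;> linarith
  have hmain := abs_sum_cellDev_le hX hN hρ hc₂ hball (A := A) (Z := graphNbhd i a s W L F) hU
    (hfin _ hU) hUb ?_ ?_
  · rw [hsum]
    refine hmain.trans ?_
    have h₁ : ((graphNbhd i a s W L F).card : ℝ) ≤
        (6 * (d + 1) + (4 * L + 3)) * (3 * L + 5) ^ d * s ^ d := by
      have := (card_graphNbhd_le i a s W L F).trans_eq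
        (by rw [hW, mul_pow, ← mul_assoc] :
          _ = (6 * (d + 1) + (4 * L + 3)) * (3 * L + 5) ^ d * s ^ d)
      exact_mod_cast this
    have h₂ : (1 : ℝ) ≤ s ^ d := one_le_pow₀ (by exact_mod_cast hs)
    have h₃ : 0 ≤ c₂ + N + ρ := by positivity
    have h₄ := mul_le_mul_of_nonneg_left h₁ h₃
    have h₅ := mul_le_mul_of_nonneg_left h₂ hc₁
    linarith
  · intro z hz hzA u hu
    rw [Metric.mem_closedBall, dist_comm] at hu
    obtain ⟨hl, hG⟩ := hdiff z u hu
    obtain ⟨hx, hxσ, hxF⟩ := (hA _).1 hzA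
    have hxl := mem_cube.1 hx
    have hFσ := (hσ (i.removeNth fun l => ⌊z l⌋)).2
    have hcube : (fun l => ⌊z l⌋) ∈ cube a W := by
      rw [mem_cube, Fin.forall_iff_succAbove i]
      simp only [hai, hal]
      refine ⟨by zify at hW₂; lia, fun l => ?_⟩
      have := hxl l
      simp only [Fin.removeNth] at this
      zify at hW₁
      lia
    obtain ⟨hb, hb'⟩ := notMem_graphNbhd hz hcube
    rw [abs_le] at hG
    refine ⟨fun l => ?_, ?_, ?_⟩
    · have h₁ := hxl l
      have h₂ := hb (i.succAbove l)
      have h₃ := abs_le.1 (hl (i.succAbove l))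
      simp only [Fin.removeNth, hal] at h₁ h₂
      have h₄ : c l + 1 ≤ ⌊z (i.succAbove l)⌋ := by lia
      have h₅ : ⌊z (i.succAbove l)⌋ < c l + s - 1 := by lia
      rw [Int.le_floor] at h₄
      rw [Int.floor_lt] at h₅
      push_cast at h₄ h₅
      constructor <;> linarith
    · have h₂ := hb i
      have h₃ := abs_le.1 (hl i)
      simp only [hai] at h₂
      have h₄ : σ + 1 ≤ ⌊z i⌋ := by lia
      rw [Int.le_floor] at h₄
      push_cast at h₄
      linarith
    · have h₃ := abs_le.1 (hl i)
      have h₄ : ⌊z i⌋ < F (i.removeNth fun l => ⌊z l⌋) - 2 * L - 1 := by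
        simp only at hb' hxF
        rw [abs_of_neg (by lia)] at hb'
        lia
      rw [Int.floor_lt] at h₄
      push_cast at h₄
      linarith
  · intro z hz hzA u hu
    by_contra hc
    obtain ⟨hl, hG⟩ := hdiff z u (not_lt.1 hc)
    rw [abs_le] at hG
    obtain ⟨hul, hui, huG⟩ := hu
    have hFσ := (hσ (i.removeNth fun l => ⌊z l⌋)).2
    have hzl : ∀ l, c l - 1 ≤ ⌊z (i.succAbove l)⌋ ∧ ⌊z (i.succAbove l)⌋ ≤ c l + s + 1 := by
      intro l
      have h₁ := hul l
      have h₃ := abs_le.1 (hl (i.succAbove l))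
      rw [Int.le_floor, ← Int.lt_add_one_iff, Int.floor_lt]
      push_cast
      constructor <;> linarith
    have hzi : σ - 1 ≤ ⌊z i⌋ ∧ ⌊z i⌋ ≤ F (i.removeNth fun l => ⌊z l⌋) + 2 * L + 1 := by
      have h₃ := abs_le.1 (hl i)
      rw [Int.le_floor, ← Int.lt_add_one_iff, Int.floor_lt]
      push_cast
      constructor <;> linarith
    have hcube : (fun l => ⌊z l⌋) ∈ cube a W := by
      rw [mem_cube, Fin.forall_iff_succAbove i]
      simp only [hai, hal]
      refine ⟨by zify at hW₂; lia, fun l => ?_⟩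
      have := hzl l
      zify at hW₁
      lia
    obtain ⟨hb, hb'⟩ := notMem_graphNbhd hz hcube
    refine hzA ((hA _).2 ⟨mem_cube.2 fun l => ?_, ?_, ?_⟩)
    · have h₁ := hzl l
      have h₂ := hb (i.succAbove l)
      simp only [Fin.removeNth, hal] at h₂ ⊢
      lia
    · have h₂ := hb i
      simp only [hai] at h₂
      lia
    · simp only at hb' ⊢
      by_contra hge
      rw [abs_of_nonneg (by lia)] at hb'
      lia

/-- The discrepancy bound for topological balls controls the weights of columns. -/
lemma exists_columnBound {X : Set (EuclideanSpace ℝ (Fin (d + 1)))} (hX : X.Countable)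
    (hud : ∃ δ > 0, ∀ x ∈ X, ∀ y ∈ X, x ≠ y → δ ≤ dist x y)
    (hfin : ∀ K, IsCompact K → (X ∩ K).Finite) {ρ c₁ c₂ : ℝ}
    (hρ : 0 ≤ ρ) (hc₁ : 0 ≤ c₁) (hc₂ : 0 ≤ c₂) (hball : BallDiscrepancy X ρ c₁ c₂) (L : ℕ) :
    ∃ C, ColumnBound (cellDev X ρ) L C := by
  obtain ⟨C, -, hC⟩ := exists_abs_sum_undergraph_le hX hud hfin hρ hc₁ hc₂ hball (2 * L + 1)
  refine ⟨C + C, fun i c s hs F hF τ hτ => ?_⟩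
  obtain ⟨σ, hσ⟩ : ∃ σ : ℤ, σ = τ - (L * s + 1) := ⟨_, rfl⟩
  have hs' : (1 : ℤ) ≤ s := by exact_mod_cast hs
  have hLs : (0 : ℤ) ≤ L * s := by positivity
  have hexp : ((2 * L + 1 : ℕ) : ℤ) * s = 2 * (L * s) + s := by push_cast; ring
  let F' : (Fin d → ℤ) → ℤ := fun y => max (σ + 1) (min (F y) (τ + L * s))
  have hF' : IsLip (2 * L + 1) F' := by
    intro x y D h
    have h₁ := hF x y D h
    have h₂ : (L : ℤ) * D ≤ (2 * L + 1 : ℕ) * D := by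
      push_cast
      nlinarith [Int.natCast_nonneg D, Int.natCast_nonneg L]
    refine le_trans ?_ h₂
    simp only [F']
    rw [abs_le] at h₁ ⊢
    lia
  have h₁ := hC i c s hs F' hF' σ fun y => by
    simp only [F', hexp]
    lia
  have h₂ := hC i c s hs (fun _ => τ) (fun x y D _ => by simp) σ fun y => by
    rw [hexp]
    lia
  have hsum : ∑ y ∈ cube c s, column (cellDev X ρ) i F y τ =
      ∑ y ∈ cube c s, ∑ t ∈ Finset.Ico σ τ, cellDev X ρ (i.insertNth t y) -
        ∑ y ∈ cube c s, ∑ t ∈ Finset.Ico σ (F' y), cellDev X ρ (i.insertNth t y) := by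
    rw [← Finset.sum_sub_distrib]
    refine Finset.sum_congr rfl fun y hy => ?_
    have hy' := abs_le.1 (hτ y hy)
    have hFy : F' y = F y := by simp only [F']; lia
    rw [hFy, column]
    have hconsec : ∀ u v w : ℤ, u ≤ v → v ≤ w →
        ∑ t ∈ Finset.Ico u v, cellDev X ρ (i.insertNth t y) +
          ∑ t ∈ Finset.Ico v w, cellDev X ρ (i.insertNth t y) =
          ∑ t ∈ Finset.Ico u w, cellDev X ρ (i.insertNth t y) := by
      intro u v w huv hvw
      rw [← Finset.sum_union (Finset.disjoint_left.2 fun t h₁ h₂ => by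
        rw [Finset.mem_Ico] at h₁ h₂; lia), Finset.Ico_union_Ico_eq_Ico huv hvw]
    rcases le_total (F y) τ with h | h
    · rw [Finset.Ico_eq_empty_of_le h, ← hconsec σ (F y) τ (by lia) h]
      simp
    · rw [Finset.Ico_eq_empty_of_le h, ← hconsec σ τ (F y) (by lia) h]
      simp
  rw [hsum, add_mul]
  exact (abs_sub _ _).trans (add_le_add h₂ h₁)

lemma ncard_bdrySet_le {S : Set (Fin n → ℤ)} (T : Finset (Fin n → ℤ))
    (h : ∀ k i, IsBdry S k i → k ∈ T ∨ k + Pi.single i 1 ∈ T) :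
    (bdrySet S).ncard ≤ 2 * n * T.card := by
  classical
  have hsub : bdrySet S ⊆ ((T ×ˢ (Finset.univ : Finset (Fin n)) ∪
      (T ×ˢ (Finset.univ : Finset (Fin n))).image
        fun p => (p.1 - Pi.single p.2 1, p.2) : Finset _) : Set ((Fin n → ℤ) × Fin n)) := by
    rintro ⟨k, i⟩ hk
    rw [Finset.mem_coe, Finset.mem_union]
    rcases h k i hk with h' | h'
    · exact Or.inl (Finset.mk_mem_product h' (Finset.mem_univ _))
    · exact Or.inr (Finset.mem_image.2 ⟨(k + Pi.single i 1, i),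
        Finset.mk_mem_product h' (Finset.mem_univ _), by simp⟩)
  refine (Set.ncard_le_ncard hsub (Finset.finite_toSet _)).trans ?_
  rw [Set.ncard_coe_finset]
  refine (Finset.card_union_le _ _).trans ((add_le_add_right Finset.card_image_le _).trans ?_)
  rw [Finset.card_product, Finset.card_univ, Fintype.card_fin]
  exact le_of_eq (by ring)

open Classical in
/-- Hall's condition for two fibrations over `ℤⁿ` whose counts differ by at most the perimeter. -/
lemma exists_injective_near {α β : Type*} {p : α → Fin n → ℤ} {q : β → Fin n → ℤ}
    (hp : ∀ k, (p ⁻¹' {k}).Finite) (hq : ∀ k, (q ⁻¹' {k}).Finite) {D : ℝ} (hD : 0 ≤ D)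
    (hdiff : ∀ S : Finset (Fin n → ℤ), |∑ k ∈ S, (((p ⁻¹' {k}).ncard : ℝ) -
      (q ⁻¹' {k}).ncard)| ≤ D * (bdrySet (S : Set (Fin n → ℤ))).ncard)
    (hlow : ∀ k, 2 * n * D ≤ (q ⁻¹' {k}).ncard) :
    ∃ f : α → β, Function.Injective f ∧ ∀ x l, |q (f x) l - p x l| ≤ 1 := by
  let nb : (Fin n → ℤ) → Finset (Fin n → ℤ) := fun k => cube (fun l => k l - 1) 3
  have hnb : ∀ k k', k' ∈ nb k ↔ ∀ l, |k' l - k l| ≤ 1 := by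
    intro k k'
    simp only [nb, mem_cube]
    refine forall_congr' fun l => ?_
    rw [abs_le]
    push_cast
    constructor <;> intro h <;> constructor <;> linarith
  let fib : (Fin n → ℤ) → Finset β := fun k => (hq k).toFinset
  have hfib : ∀ k y, y ∈ fib k ↔ q y = k := by simp [fib]
  have hfibc : ∀ k, (fib k).card = (q ⁻¹' {k}).ncard := fun k =>
    (Set.ncard_eq_toFinset_card _ (hq k)).symm
  obtain ⟨f, hf, hft⟩ := (Finset.all_card_le_biUnion_card_iff_exists_injective
    fun x => (nb (p x)).biUnion fib).1 fun s => by
    let S := s.image p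
    let N := S.biUnion nb
    have hSN : S ⊆ N := fun k hk => Finset.mem_biUnion.2 ⟨k, hk, (hnb k k).2 (by simp)⟩
    have h₁ : (s.card : ℝ) ≤ ∑ k ∈ S, ((p ⁻¹' {k}).ncard : ℝ) := by
      rw [Finset.card_eq_sum_card_image p s]
      push_cast
      refine Finset.sum_le_sum fun k _ => ?_
      rw [Nat.cast_le, ← Set.ncard_coe_finset]
      refine Set.ncard_le_ncard (fun x hx => ?_) (hp k)
      simpa using (Finset.mem_filter.1 hx).2
    have h₂ : (s.biUnion fun x => (nb (p x)).biUnion fib) = N.biUnion fib := by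
      ext y
      simp only [Finset.mem_biUnion, N, S, Finset.mem_image]
      constructor
      · rintro ⟨x, hx, k, hk, hy⟩
        exact ⟨k, ⟨_, ⟨x, hx, rfl⟩, hk⟩, hy⟩
      · rintro ⟨k, ⟨_, ⟨x, hx, rfl⟩, hk⟩, hy⟩
        exact ⟨x, hx, k, hk, hy⟩
    have h₃ : ((N.biUnion fib).card : ℝ) = ∑ k ∈ N, ((q ⁻¹' {k}).ncard : ℝ) := by
      rw [Finset.card_biUnion]
      · push_cast
        exact Finset.sum_congr rfl fun k _ => by rw [hfibc]
      · intro k _ k' _ hkk'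
        exact Finset.disjoint_left.2 fun y hy hy' =>
          hkk' (((hfib k y).1 hy).symm.trans ((hfib k' y).1 hy'))
    have h₄ := ncard_bdrySet_le (S := (S : Set (Fin n → ℤ))) (N \ S) fun k i hk => by
      have hstep : ∀ l, |(k + Pi.single i 1 : Fin n → ℤ) l - k l| ≤ 1 := by
        intro l
        rcases eq_or_ne l i with rfl | hl <;> simp [*]
      simp only [IsBdry, Finset.mem_coe] at hk
      by_cases hkS : k ∈ S
      · refine Or.inr (Finset.mem_sdiff.2 ⟨Finset.mem_biUnion.2 ⟨k, hkS, (hnb _ _).2 hstep⟩, ?_⟩)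
        tauto
      · refine Or.inl (Finset.mem_sdiff.2 ⟨Finset.mem_biUnion.2 ⟨k + Pi.single i 1, by tauto,
          (hnb _ _).2 fun l => ?_⟩, hkS⟩)
        rw [abs_sub_comm]
        exact hstep l
    have h₅ : 2 * n * D * ((N \ S).card : ℝ) ≤ ∑ k ∈ N \ S, ((q ⁻¹' {k}).ncard : ℝ) := by
      rw [mul_comm, ← nsmul_eq_mul]
      exact Finset.card_nsmul_le_sum _ _ _ fun k _ => hlow k
    have h₆ := (abs_le.1 (hdiff S)).2
    rw [Finset.sum_sub_distrib] at h₆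
    have h₇ : D * ((bdrySet (S : Set (Fin n → ℤ))).ncard : ℝ) ≤
        D * (2 * n * (N \ S).card) := by
      refine mul_le_mul_of_nonneg_left ?_ hD
      exact_mod_cast h₄
    have h₈ := Finset.sum_sdiff (f := fun k => ((q ⁻¹' {k}).ncard : ℝ)) hSN
    rw [h₂]
    have : (s.card : ℝ) ≤ (N.biUnion fib).card := by
      rw [h₃]
      linarith
    exact_mod_cast this
  refine ⟨f, hf, fun x l => ?_⟩
  obtain ⟨k, hk, hy⟩ := Finset.mem_biUnion.1 (hft x)
  rw [(hfib k _).1 hy]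
  exact (hnb _ _).1 hk l

/-- The union of the cubes of side `M` indexed by `S`. -/
noncomputable def blocks (M : ℕ) (S : Finset (Fin n → ℤ)) : Finset (Fin n → ℤ) :=
  open Classical in S.biUnion fun k => cube (fun l => M * k l) M

lemma mem_cube_mul {M : ℕ} (hM : 0 < M) {k x : Fin n → ℤ} :
    x ∈ cube (fun l => M * k l) M ↔ (fun l => x l / M) = k := by
  have hM' : (0 : ℤ) < M := by exact_mod_cast hM
  rw [mem_cube, funext_iff]
  refine forall_congr' fun l => ?_
  rw [Int.ediv_eq_iff_of_pos hM']
  rw [mul_comm]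

lemma mem_blocks {M : ℕ} (hM : 0 < M) {S : Finset (Fin n → ℤ)} {x : Fin n → ℤ} :
    x ∈ blocks M S ↔ (fun l => x l / M) ∈ S := by
  simp [blocks, mem_cube_mul hM]

lemma sum_blocks {M : ℕ} (hM : 0 < M) (S : Finset (Fin n → ℤ)) (φ : (Fin n → ℤ) → ℝ) :
    ∑ x ∈ blocks M S, φ x = ∑ k ∈ S, ∑ x ∈ cube (fun l => M * k l) M, φ x := by
  rw [blocks, Finset.sum_biUnion]
  intro k _ k' _ hkk'
  exact Finset.disjoint_left.2 fun x hx hx' =>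
    hkk' (((mem_cube_mul hM).1 hx).symm.trans ((mem_cube_mul hM).1 hx'))

lemma ncard_bdrySet_blocks_le {M : ℕ} (hM : 0 < M) (S : Finset (Fin (d + 1) → ℤ)) :
    (bdrySet (blocks M S : Set (Fin (d + 1) → ℤ))).ncard ≤
      M ^ d * (bdrySet (S : Set (Fin (d + 1) → ℤ))).ncard := by
  classical
  have hM' : (0 : ℤ) < M := by exact_mod_cast hM
  have hS := bdrySet_finite S.finite_toSet
  have hB := bdrySet_finite (blocks M S).finite_toSet
  have hstep : ∀ p ∈ bdrySet (blocks M S : Set (Fin (d + 1) → ℤ)),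
      ((fun l => p.1 l / M), p.2) ∈ bdrySet (S : Set (Fin (d + 1) → ℤ)) ∧
        p.1 p.2 = M * (p.1 p.2 / M) + (M - 1) := by
    rintro ⟨x, i⟩ hx
    change ¬ (_ ↔ _) at hx
    simp only [Finset.mem_coe, mem_blocks hM] at hx
    have hi : x i = M * (x i / M) + (M - 1) := by
      by_contra hne
      have h₁ := Int.emod_add_mul_ediv (x i) M
      have h₂ := Int.emod_nonneg (x i) hM'.ne'
      have h₃ := Int.emod_lt_of_pos (x i) hM'
      have heq : (fun l => (x + Pi.single i 1 : Fin (d + 1) → ℤ) l / (M : ℤ)) =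
          fun l => x l / M := by
        funext l
        rcases eq_or_ne l i with rfl | hl
        · rw [Int.ediv_eq_iff_of_pos hM']
          simp only [Pi.add_apply, Pi.single_eq_same]
          constructor <;> nlinarith [show x l % M < M - 1 by lia]
        · simp [hl]
      rw [heq] at hx
      exact hx Iff.rfl
    refine ⟨?_, hi⟩
    change ¬ (_ ↔ _)
    have heq : (fun l => (x + Pi.single i 1 : Fin (d + 1) → ℤ) l / (M : ℤ)) =
        (fun l => x l / (M : ℤ)) + Pi.single i 1 := ?_
    · rwa [heq] at hx
    funext l
    rcases eq_or_ne l i with rfl | hl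
    · rw [Int.ediv_eq_iff_of_pos hM']
      simp only [Pi.add_apply, Pi.single_eq_same]
      constructor <;> nlinarith
    · simp [hl]
  rw [Set.ncard_eq_toFinset_card _ hB, Set.ncard_eq_toFinset_card _ hS]
  refine Finset.card_le_mul_card_image_of_maps_to (f := fun p => ((fun l => p.1 l / (M : ℤ)), p.2))
    (fun p hp => hS.mem_toFinset.2 (hstep p (hB.mem_toFinset.1 hp)).1) _ ?_
  rintro ⟨k, i⟩ -
  rw [← card_cube (i.removeNth fun l => M * k l) M]
  refine Finset.card_le_card_of_injOn (fun p => i.removeNth p.1) ?_ ?_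
  · rintro ⟨x, j⟩ hx
    obtain ⟨-, hx₂⟩ := Finset.mem_filter.1 hx
    obtain ⟨rfl, rfl⟩ := Prod.mk.inj hx₂
    exact removeNth_mem_cube _ ((mem_cube_mul hM).2 rfl)
  · have hval : ∀ p ∈ Finset.filter (fun p => ((fun l => p.1 l / (M : ℤ)), p.2) = (k, i))
        hB.toFinset, p = (i.insertNth (M * k i + (M - 1)) (i.removeNth p.1), i) := by
      rintro ⟨x, j⟩ hx
      obtain ⟨hx₁, hx₂⟩ := Finset.mem_filter.1 hx
      obtain ⟨h, rfl⟩ := Prod.mk.inj hx₂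
      have h₂ := (hstep _ (hB.mem_toFinset.1 hx₁)).2
      have h₃ := congrFun h j
      simp only at h₂ h₃
      rw [h₃] at h₂
      rw [← h₂, Fin.insertNth_self_removeNth]
    intro p hp q hq hpq
    rw [hval p hp, hval q hq]
    simp only at hpq
    rw [hpq]

lemma exists_abs_sum_cellDev_le_ncard_bdrySet {X : Set (EuclideanSpace ℝ (Fin (d + 1)))}
    (hX : X.Countable) (hud : ∃ δ > 0, ∀ x ∈ X, ∀ y ∈ X, x ≠ y → δ ≤ dist x y)
    {ρ c₁ c₂ : ℝ} (hρ : 0 ≤ ρ) (hc₁ : 0 ≤ c₁) (hc₂ : 0 ≤ c₂) (hball : BallDiscrepancy X ρ c₁ c₂) :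
    ∃ B, 0 ≤ B ∧ ∀ U : Finset (Fin (d + 1) → ℤ),
      |∑ x ∈ U, cellDev X ρ x| ≤ B * (bdrySet (U : Set (Fin (d + 1) → ℤ))).ncard := by
  obtain ⟨N, hN⟩ := exists_ncard_inter_cell_le hud
  refine exists_abs_sum_le_ncard_bdrySet (c := N + ρ) (fun x => ?_) (exists_columnBound hX hud
    (fun K => finite_inter_of_uniformly_discrete hud) hρ hc₁ hc₂ hball)
  refine (abs_sub _ _).trans ?_
  rw [abs_of_nonneg (Nat.cast_nonneg _), abs_of_nonneg hρ]
  have : ((X ∩ cell x).ncard : ℝ) ≤ N := by exact_mod_cast (hN x).2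
  linarith

/-- The index of the block of side `M` containing a point. -/
noncomputable def blockIdx (M : ℕ) (z : EuclideanSpace ℝ (Fin n)) (l : Fin n) : ℤ := ⌊z l⌋ / M

lemma ncard_block {X : Set (EuclideanSpace ℝ (Fin n))} (hX : ∀ x, (X ∩ cell x).Finite) {M : ℕ}
    (hM : 0 < M) (k : Fin n → ℤ) :
    ((fun x : X => blockIdx M x.1) ⁻¹' {k}).Finite ∧
      ((fun x : X => blockIdx M x.1) ⁻¹' {k}).ncard =
        ∑ c ∈ cube (fun l => M * k l) M, (X ∩ cell c).ncard := by
  classical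
  have himg : Subtype.val '' ((fun x : X => blockIdx M x.1) ⁻¹' {k}) =
      (((cube (fun l => M * k l) M).biUnion fun c => (hX c).toFinset : Finset _) :
        Set (EuclideanSpace ℝ (Fin n))) := by
    ext z
    simp only [Set.mem_image, Set.mem_preimage, Set.mem_singleton_iff, Finset.mem_coe,
      Finset.mem_biUnion, Set.Finite.mem_toFinset, mem_cube_mul hM]
    constructor
    · rintro ⟨x, hx, rfl⟩
      exact ⟨fun l => ⌊x.1 l⌋, hx, x.2, mem_cell_floor _⟩
    · rintro ⟨c, hc, hzX, hzc⟩
      obtain rfl : (fun l => ⌊z l⌋) = c := funext hzc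
      exact ⟨⟨z, hzX⟩, hc, rfl⟩
  refine ⟨Set.Finite.of_finite_image (himg ▸ Finset.finite_toSet _)
    Subtype.val_injective.injOn, ?_⟩
  rw [← Set.ncard_image_of_injective _ Subtype.val_injective, himg, Set.ncard_coe_finset,
    Finset.card_biUnion]
  · exact Finset.sum_congr rfl fun c _ => (Set.ncard_eq_toFinset_card _ (hX c)).symm
  · intro c _ c' _ hcc'
    refine Finset.disjoint_left.2 fun z hz hz' => ?_
    exact Set.disjoint_left.1 (disjoint_cell hcc') ((hX c).mem_toFinset.1 hz).2
      ((hX c').mem_toFinset.1 hz').2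

lemma exists_injective_block {X Y : Set (EuclideanSpace ℝ (Fin (d + 1)))}
    (hX : ∀ x, (X ∩ cell x).Finite) (hY : ∀ x, (Y ∩ cell x).Finite) {ρ B : ℝ} (hB : 0 ≤ B)
    (hXB : ∀ U : Finset (Fin (d + 1) → ℤ),
      |∑ x ∈ U, cellDev X ρ x| ≤ B * (bdrySet (U : Set (Fin (d + 1) → ℤ))).ncard)
    (hYB : ∀ U : Finset (Fin (d + 1) → ℤ),
      |∑ x ∈ U, cellDev Y ρ x| ≤ B * (bdrySet (U : Set (Fin (d + 1) → ℤ))).ncard)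
    {M : ℕ} (hM : 0 < M) (hMB : 6 * (d + 1) * B ≤ ρ * M) :
    ∃ f : X → Y, Function.Injective f ∧
      ∀ x l, |blockIdx M (f x).1 l - blockIdx M x.1 l| ≤ 1 := by
  have hblocks : ∀ S : Finset (Fin (d + 1) → ℤ),
      B * ((bdrySet (blocks M S : Set (Fin (d + 1) → ℤ))).ncard : ℝ) ≤
        B * (M ^ d * (bdrySet (S : Set (Fin (d + 1) → ℤ))).ncard) := by
    intro S
    refine mul_le_mul_of_nonneg_left ?_ hB
    exact_mod_cast ncard_bdrySet_blocks_le hM S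
  refine exists_injective_near (D := 2 * B * M ^ d) (fun k => (ncard_block hX hM k).1)
    (fun k => (ncard_block hY hM k).1) (by positivity) (fun S => ?_) fun k => ?_
  · have hsum : ∑ k ∈ S, ((((fun x : X => blockIdx M x.1) ⁻¹' {k}).ncard : ℝ) -
        ((fun x : Y => blockIdx M x.1) ⁻¹' {k}).ncard) =
        ∑ x ∈ blocks M S, cellDev X ρ x - ∑ x ∈ blocks M S, cellDev Y ρ x := by
      rw [← Finset.sum_sub_distrib, sum_blocks hM]
      refine Finset.sum_congr rfl fun k _ => ?_
      rw [(ncard_block hX hM k).2, (ncard_block hY hM k).2]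
      push_cast
      rw [← Finset.sum_sub_distrib]
      exact Finset.sum_congr rfl fun c _ => by simp [cellDev]
    rw [hsum]
    refine (abs_sub _ _).trans ((add_le_add (hXB _) (hYB _)).trans ?_)
    linarith [hblocks S]
  · have hk : ∑ x ∈ blocks M {k}, cellDev Y ρ x =
        ((fun x : Y => blockIdx M x.1) ⁻¹' {k}).ncard - ρ * M ^ (d + 1) := by
      rw [sum_blocks hM, Finset.sum_singleton, (ncard_block hY hM k).2]
      simp only [cellDev, Finset.sum_sub_distrib, Finset.sum_const, card_cube, nsmul_eq_mul]
      push_cast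
      ring
    have h₁ := (abs_le.1 (hYB (blocks M {k}))).1
    have h₂ := hblocks {k}
    have h₃ : ((bdrySet (({k} : Finset (Fin (d + 1) → ℤ)) : Set (Fin (d + 1) → ℤ))).ncard : ℝ) ≤
        2 * (d + 1) := by
      have := ncard_bdrySet_le
        (S := (({k} : Finset (Fin (d + 1) → ℤ)) : Set (Fin (d + 1) → ℤ))) {k} fun x i hx => by
          simp only [IsBdry, Finset.mem_coe] at hx
          tauto
      rw [Finset.card_singleton, mul_one] at this
      exact_mod_cast this
    have hMd : (0 : ℝ) ≤ M ^ d := by positivity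
    have h₄ := mul_le_mul_of_nonneg_left h₃ (mul_nonneg hB hMd)
    have h₅ := mul_le_mul_of_nonneg_right hMB hMd
    have h₆ : ρ * M * M ^ d = ρ * (M : ℝ) ^ (d + 1) := by ring
    rw [hk] at h₁
    push_cast
    linarith

lemma abs_sub_le_of_floor_ediv {M : ℕ} (hM : 0 < M) {s t : ℝ}
    (h : |⌊s⌋ / (M : ℤ) - ⌊t⌋ / M| ≤ 1) : |s - t| ≤ 2 * M := by
  have hM' : (0 : ℤ) < M := by exact_mod_cast hM
  have key : ∀ r : ℝ, ((⌊r⌋ / (M : ℤ) : ℤ) : ℝ) * M ≤ r ∧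
      r < ((⌊r⌋ / (M : ℤ) : ℤ) : ℝ) * M + M := by
    intro r
    obtain ⟨h₁, h₂⟩ := (Int.ediv_eq_iff_of_pos hM').1 (rfl : ⌊r⌋ / (M : ℤ) = _)
    rw [Int.le_floor] at h₁
    rw [Int.floor_lt] at h₂
    push_cast at h₁ h₂
    exact ⟨h₁, h₂⟩
  obtain ⟨h₁, h₂⟩ := key s
  obtain ⟨h₃, h₄⟩ := key t
  have h₅ : |((⌊s⌋ / (M : ℤ) : ℤ) : ℝ) - ((⌊t⌋ / (M : ℤ) : ℤ) : ℝ)| ≤ 1 := by exact_mod_cast h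
  rw [abs_le] at h₅ ⊢
  have hM₀ : (0 : ℝ) < M := by exact_mod_cast hM
  constructor <;> nlinarith

/-- Two sets whose cell counts deviate from the same density by at most the perimeter are at
bounded displacement. -/
lemma exists_equiv_near {X Y : Set (EuclideanSpace ℝ (Fin (d + 1)))}
    (hX : ∀ x, (X ∩ cell x).Finite) (hY : ∀ x, (Y ∩ cell x).Finite) {ρ B : ℝ} (hρ : 0 < ρ)
    (hB : 0 ≤ B)
    (hXB : ∀ U : Finset (Fin (d + 1) → ℤ),
      |∑ x ∈ U, cellDev X ρ x| ≤ B * (bdrySet (U : Set (Fin (d + 1) → ℤ))).ncard)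
    (hYB : ∀ U : Finset (Fin (d + 1) → ℤ),
      |∑ x ∈ U, cellDev Y ρ x| ≤ B * (bdrySet (U : Set (Fin (d + 1) → ℤ))).ncard) :
    ∃ (b : X ≃ Y) (C : ℝ), ∀ x : X, ‖(b x : EuclideanSpace ℝ (Fin (d + 1))) - x‖ ≤ C := by
  obtain ⟨M, hM⟩ := exists_nat_gt (6 * (d + 1) * B / ρ)
  have hM₀ : 0 < M := by
    have : (0 : ℝ) < M := lt_of_le_of_lt (by positivity) hM
    exact_mod_cast this
  have hMB : 6 * (d + 1) * B ≤ ρ * M := by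
    rw [div_lt_iff₀ hρ] at hM
    linarith
  obtain ⟨f, hf, hf'⟩ := exists_injective_block hX hY hB hXB hYB hM₀ hMB
  obtain ⟨g, hg, hg'⟩ := exists_injective_block hY hX hB hYB hXB hM₀ hMB
  obtain ⟨h, hbij, hR⟩ := Function.Embedding.schroeder_bernstein_of_rel hf hg
    (fun x y => ∀ l, |blockIdx M y.1 l - blockIdx M x.1 l| ≤ 1) hf' fun y l => by
      rw [abs_sub_comm]
      exact hg' y l
  refine ⟨Equiv.ofBijective h hbij, √(d + 1 : ℕ) * (2 * M), fun x => ?_⟩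
  rw [EuclideanSpace.norm_eq, ← Real.sqrt_sq (by positivity : (0 : ℝ) ≤ 2 * M),
    ← Real.sqrt_mul (by positivity)]
  refine Real.sqrt_le_sqrt ?_
  calc ∑ l, ‖((Equiv.ofBijective h hbij x : EuclideanSpace ℝ (Fin (d + 1))) - x) l‖ ^ 2
      ≤ ∑ _l : Fin (d + 1), (2 * M : ℝ) ^ 2 := by
        gcongr with l
        exact abs_sub_le_of_floor_ediv hM₀ (hR x l)
    _ = (d + 1 : ℕ) * (2 * M : ℝ) ^ 2 := by simp

/-- A homothetic lattice of given density. -/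
lemma exists_linearEquiv_smul_det {ρ : ℝ} (hρ : 0 < ρ) (hn : n ≠ 0) :
    ∃ c > (0 : ℝ), ∃ A : EuclideanSpace ℝ (Fin n) ≃ₗ[ℝ] EuclideanSpace ℝ (Fin n),
      (∀ x, A x = c • x) ∧ |LinearMap.det (A : EuclideanSpace ℝ (Fin n) →ₗ[ℝ]
        EuclideanSpace ℝ (Fin n))| = 1 / ρ := by
  have hc : 0 < (1 / ρ) ^ ((n : ℝ)⁻¹) := by positivity
  refine ⟨_, hc, LinearEquiv.smulOfNeZero ℝ _ _ hc.ne', fun x => rfl, ?_⟩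
  have h : ((LinearEquiv.smulOfNeZero ℝ (EuclideanSpace ℝ (Fin n)) _ hc.ne' :
      EuclideanSpace ℝ (Fin n) ≃ₗ[ℝ] EuclideanSpace ℝ (Fin n)) :
      EuclideanSpace ℝ (Fin n) →ₗ[ℝ] EuclideanSpace ℝ (Fin n)) =
      (1 / ρ) ^ ((n : ℝ)⁻¹) • LinearMap.id := rfl
  rw [h, LinearMap.det_smul, LinearMap.det_id, finrank_euclideanSpace_fin, mul_one,
    Real.rpow_inv_natCast_pow (by positivity) hn, abs_of_pos (by positivity)]

/-- The converse implication: a discrepancy bound for topological balls yields a bounded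
displacement bijection with a lattice. -/
theorem exists_lattice_equiv_of_ballDiscrepancy {X : Set (EuclideanSpace ℝ (Fin (d + 1)))}
    (hX : X.Countable) (hud : ∃ δ > 0, ∀ x ∈ X, ∀ y ∈ X, x ≠ y → δ ≤ dist x y)
    {ρ c₁ c₂ : ℝ} (hρ : 0 < ρ) (hc₁ : 0 ≤ c₁) (hc₂ : 0 ≤ c₂) (hball : BallDiscrepancy X ρ c₁ c₂) :
    ∃ A : EuclideanSpace ℝ (Fin (d + 1)) ≃ₗ[ℝ] EuclideanSpace ℝ (Fin (d + 1)),
      |LinearMap.det (A : EuclideanSpace ℝ (Fin (d + 1)) →ₗ[ℝ]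
        EuclideanSpace ℝ (Fin (d + 1)))| = 1 / ρ ∧
      ∃ (b : X ≃ (⇑A '' {x : EuclideanSpace ℝ (Fin (d + 1)) | ∀ i, ∃ m : ℤ, x i = (m : ℝ)} :
        Set _)) (C : ℝ), ∀ x : X,
        ‖(b x : EuclideanSpace ℝ (Fin (d + 1))) - (x : EuclideanSpace ℝ (Fin (d + 1)))‖ ≤ C := by
  obtain ⟨c, hc, A, hA, hdet⟩ := exists_linearEquiv_smul_det (n := d + 1) hρ (by simp)
  refine ⟨A, hdet, ?_⟩
  obtain ⟨Λ, hΛ⟩ : ∃ Λ, Λ = ⇑A '' {x : EuclideanSpace ℝ (Fin (d + 1)) |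
    ∀ i, ∃ m : ℤ, x i = (m : ℝ)} := ⟨_, rfl⟩
  have hΛc : Λ.Countable := by
    rw [hΛ]
    refine Set.Countable.image ((Set.countable_range fun (m : Fin (d + 1) → ℤ) =>
      (WithLp.toLp 2 fun i => (m i : ℝ) : EuclideanSpace ℝ (Fin (d + 1)))).mono ?_) A
    intro x hx
    choose m hm using hx
    exact ⟨m, by ext i; exact (hm i).symm⟩
  have hΛud : ∃ δ > 0, ∀ x ∈ Λ, ∀ y ∈ Λ, x ≠ y → δ ≤ dist x y := by
    refine ⟨c, hc, ?_⟩
    rw [hΛ]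
    rintro _ ⟨x, hx, rfl⟩ _ ⟨y, hy, rfl⟩ hxy
    obtain ⟨l, hl⟩ : ∃ l, x l ≠ y l := by
      by_contra! h
      exact hxy (congrArg A (by ext l; exact h l))
    obtain ⟨k, hk⟩ := hx l
    obtain ⟨m, hm⟩ := hy l
    refine le_trans ?_ (PiLp.dist_apply_le (A x) (A y) l)
    rw [hA, hA, Real.dist_eq, PiLp.smul_apply, PiLp.smul_apply, smul_eq_mul, smul_eq_mul,
      ← mul_sub, abs_mul, abs_of_pos hc, hk, hm]
    rw [hk, hm] at hl
    have h₁ : 1 ≤ |k - m| := Int.one_le_abs (sub_ne_zero.2 fun h => hl (by rw [h]))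
    have h₂ : (1 : ℝ) ≤ |(k : ℝ) - m| := by exact_mod_cast h₁
    exact le_mul_of_one_le_right hc.le h₂
  obtain ⟨c', hc', hcol⟩ : ∃ c' > (0 : ℝ), ∀ U : Set (EuclideanSpace ℝ (Fin (d + 1))),
      IsCompact U → |((Λ ∩ U).ncard : ℝ) - ρ * (volume U).toReal| ≤
        c' * ((volume (Metric.cthickening 1 U)).toReal -
          (volume {x ∈ U | 1 ≤ Metric.infDist x Uᶜ}).toReal) := by
    refine discrepancy_le_collar_of_bounded_displacement hΛud hρ A hdet (Equiv.setCongr hΛ)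
      (C := 0) fun x => ?_
    simp
  obtain ⟨B, hB, hXB⟩ := exists_abs_sum_cellDev_le_ncard_bdrySet hX hud hρ.le hc₁ hc₂ hball
  obtain ⟨B', hB', hΛB⟩ := exists_abs_sum_cellDev_le_ncard_bdrySet hΛc hΛud hρ.le le_rfl hc'.le
    fun U hU _ => (hcol U hU).trans (zero_add _).ge
  obtain ⟨_, hN⟩ := exists_ncard_inter_cell_le hud
  obtain ⟨_, hN'⟩ := exists_ncard_inter_cell_le hΛud
  obtain ⟨b, C, hb⟩ := exists_equiv_near (fun x => (hN x).1) (fun x => (hN' x).1) hρ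
    (add_nonneg hB hB')
    (fun U => (hXB U).trans (mul_le_mul_of_nonneg_right (by linarith) (Nat.cast_nonneg _)))
    fun U => (hΛB U).trans (mul_le_mul_of_nonneg_right (by linarith) (Nat.cast_nonneg _))
  subst hΛ
  exact ⟨b, C, hb⟩

end CellSet

/-- **Laczkovich's theorem in dimension `n > 2`** (higher-dimensional variant of
Theorem 1.2 of the paper). A countable, uniformly discrete set `X ⊆ ℝⁿ` with well-defined
density `ρ > 0` is of bounded displacement from a lattice of density `ρ` iff there are
constants `c₁, c₂ > 0` such that for every topological ball `U`,
`|#(X ∩ U) - ρ·vol(U)| ≤ c₁ + c₂·(vol(U₁) - vol(U₋₁))`. -/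
theorem laczkovich_high_dim
    (n : ℕ) (hn : 2 < n)
    (X : Set (EuclideanSpace ℝ (Fin n)))
    (hcount : X.Countable)
    (hud : ∃ δ > 0, ∀ x ∈ X, ∀ y ∈ X, x ≠ y → δ ≤ dist x y)
    (ρ : ℝ) (hρ : 0 < ρ)
    (hdens : Filter.Tendsto
      (fun R : ℝ => ((X ∩ Metric.closedBall 0 R).ncard : ℝ) /
        (volume (Metric.closedBall (0 : EuclideanSpace ℝ (Fin n)) R)).toReal)
      Filter.atTop (nhds ρ)) :
    (∃ L : Set (EuclideanSpace ℝ (Fin n)),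
      (∃ A : EuclideanSpace ℝ (Fin n) ≃ₗ[ℝ] EuclideanSpace ℝ (Fin n),
        L = ⇑A '' {x : EuclideanSpace ℝ (Fin n) | ∀ i, ∃ m : ℤ, x i = (m : ℝ)} ∧
        |LinearMap.det (A : EuclideanSpace ℝ (Fin n) →ₗ[ℝ] EuclideanSpace ℝ (Fin n))| = 1 / ρ) ∧
      ∃ b : X ≃ L, ∃ C : ℝ, ∀ x : X,
        ‖(b x : EuclideanSpace ℝ (Fin n)) - (x : EuclideanSpace ℝ (Fin n))‖ ≤ C) ↔
    (∃ c₁ > (0 : ℝ), ∃ c₂ > (0 : ℝ), ∀ U : Set (EuclideanSpace ℝ (Fin n)),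
      IsCompact U →
      Nonempty (U ≃ₜ (Metric.closedBall (0 : EuclideanSpace ℝ (Fin n)) 1 : Set _)) →
      |((X ∩ U).ncard : ℝ) - ρ * (volume U).toReal| ≤
        c₁ + c₂ * ((volume (Metric.cthickening 1 U)).toReal -
          (volume {x ∈ U | 1 ≤ Metric.infDist x Uᶜ}).toReal)) := by
  constructor
  · rintro ⟨_, ⟨A, rfl, hA⟩, b, C, hC⟩
    obtain ⟨c, hc, h⟩ := discrepancy_le_collar_of_bounded_displacement hud hρ A hA b hC
    exact ⟨1, one_pos, c, hc, fun U hU _ => (h U hU).trans (by linarith)⟩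
  · rintro ⟨c₁, hc₁, c₂, hc₂, h⟩
    obtain ⟨d, rfl⟩ : ∃ d, n = d + 1 := ⟨n - 1, by omega⟩
    obtain ⟨A, hA, b, C, hb⟩ :=
      CellSet.exists_lattice_equiv_of_ballDiscrepancy hcount hud hρ hc₁.le hc₂.le h
    exact ⟨_, ⟨A, rfl, hA⟩, b, C, hb⟩
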